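/- In the pure p-spin spherical model with p ≥ 3, for every η ∈ ℝ one has lim_{N→∞} (1/N) log E[ Crt_N(η) ] = Σ(η), where Σ(η) = ½ log(p−1) if η ≤ 0; Σ(η) = ½ log(p−1) − ((p−2)/(4(p−1))) η² if 0 ≤ η ≤ THR; and Σ(η) = ½ log(p−1) − ((p−2)/(4(p−1))) η² − J(η) if η ≥ THR, with THR = 2√((p−1)/p) and J(η) = (η/THR²)√(η² − THR²) − log( η + √(η² − THR²) ) + log THR. -/

import Mathlib

open MeasureTheory ProbabilityTheory Filter
open scoped ENNReal NNReal

noncomputable section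

/-- Euclidean dot product on `ℝ^N`. -/
def dotp {N : ℕ} (σ τ : Fin N → ℝ) : ℝ := ∑ i, σ i * τ i

/-- The sphere `S_N = {σ : ‖σ‖₂² = N}`. -/
def sphereSet (N : ℕ) : Set (Fin N → ℝ) := {σ | ∑ i, (σ i) ^ 2 = (N : ℝ)}

/-- The mixture `ξ(x) = Σ_{k=2}^P c_k² x^k`. -/
def xiFun (P : ℕ) (c : ℕ → ℝ) (x : ℝ) : ℝ := ∑ k ∈ Finset.Icc 2 P, (c k) ^ 2 * x ^ k

/-- `ξ'`. -/
def xiD1 (P : ℕ) (c : ℕ → ℝ) (x : ℝ) : ℝ :=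
  ∑ k ∈ Finset.Icc 2 P, (k : ℝ) * (c k) ^ 2 * x ^ (k - 1)

/-- `ξ''`. -/
def xiD2 (P : ℕ) (c : ℕ → ℝ) (x : ℝ) : ℝ :=
  ∑ k ∈ Finset.Icc 2 P, (k : ℝ) * ((k : ℝ) - 1) * (c k) ^ 2 * x ^ (k - 2)

/-- The mixed p-spin Hamiltonian built from couplings `g`. -/
def hamiltonian (N P : ℕ) (c : ℕ → ℝ) (g : (k : ℕ) → (Fin k → Fin N) → ℝ)
    (σ : Fin N → ℝ) : ℝ :=
  ∑ k ∈ Finset.Icc 2 P, c k * (N : ℝ) ^ (-(((k : ℝ) - 1) / 2)) *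
    ∑ j : Fin k → Fin N, g k j * ∏ i, σ (j i)

/-- Index set for the entries of all the coupling tensors. -/
abbrev GIdx (N P : ℕ) : Type := Σ k : {k : ℕ // k ∈ Finset.Icc 2 P}, (Fin (k : ℕ) → Fin N)

/-- Flatten the couplings into a single Gaussian vector. -/
def flatten (N P : ℕ) (g : (k : ℕ) → (Fin k → Fin N) → ℝ) : GIdx N P → ℝ :=
  fun i => g i.1 i.2

/-- The couplings `(G^{(k)})_{2 ≤ k ≤ P}` are i.i.d. standard Gaussians. -/
def StdGaussianCouplings {Ω : Type*} [MeasureSpace Ω] (N P : ℕ)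
    (G : Ω → (k : ℕ) → (Fin k → Fin N) → ℝ) : Prop :=
  Measure.map (fun ω => flatten N P (G ω)) ℙ = Measure.pi fun _ : GIdx N P => gaussianReal 0 1

/-- The maximum of the Hamiltonian over the sphere. -/
def maxH (N P : ℕ) (c : ℕ → ℝ) (g : (k : ℕ) → (Fin k → Fin N) → ℝ) : ℝ :=
  ⨆ σ : sphereSet N, hamiltonian N P c g σ.1


/-- Euclidean gradient of the Hamiltonian. -/
def gradH (N P : ℕ) (c : ℕ → ℝ) (g : (k : ℕ) → (Fin k → Fin N) → ℝ)
    (σ : Fin N → ℝ) : Fin N → ℝ :=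
  fun i => fderiv ℝ (hamiltonian N P c g) σ (Pi.single i 1)

/-- Euclidean Hessian of the Hamiltonian, as a bilinear form. -/
def hessH (N P : ℕ) (c : ℕ → ℝ) (g : (k : ℕ) → (Fin k → Fin N) → ℝ)
    (σ v w : Fin N → ℝ) : ℝ :=
  fderiv ℝ (fun τ => fderiv ℝ (hamiltonian N P c g) τ w) σ v

/-- `σ` is a spherical critical point: `∇H(σ) = (⟨∇H(σ),σ⟩/N) σ`. -/
def IsCritPt (N P : ℕ) (c : ℕ → ℝ) (g : (k : ℕ) → (Fin k → Fin N) → ℝ)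
    (σ : Fin N → ℝ) : Prop :=
  σ ∈ sphereSet N ∧ gradH N P c g σ = (dotp (gradH N P c g σ) σ / N) • σ

/-- Cardinality of a set, valued in `ℝ≥0∞`. -/
def ecount {α : Type*} (s : Set α) : ℝ≥0∞ := ∑' _ : s, 1

/-- Spherical critical points with energy at least `Nη`. -/
def crtSet (N P : ℕ) (c : ℕ → ℝ) (g : (k : ℕ) → (Fin k → Fin N) → ℝ)
    (η : ℝ) : Set (Fin N → ℝ) :=
  {σ | IsCritPt N P c g σ ∧ (N : ℝ) * η ≤ hamiltonian N P c g σ}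

/-- Index (number of negative eigenvalues) of the spherical Hessian quadratic form at `σ`:
maximal dimension of a subspace of the tangent space on which the form is negative definite. -/
def critIndex (N P : ℕ) (c : ℕ → ℝ) (g : (k : ℕ) → (Fin k → Fin N) → ℝ)
    (σ : Fin N → ℝ) : ℕ :=
  sSup {d : ℕ | ∃ W : Submodule ℝ (Fin N → ℝ), Module.finrank ℝ W = d ∧
    (∀ v ∈ W, dotp v σ = 0) ∧
    ∀ v ∈ W, v ≠ 0 →
      hessH N P c g σ v v - (dotp (gradH N P c g σ) σ / N) * ∑ i, (v i) ^ 2 < 0}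

/-- Critical points of index `N-1-k` in the superlevel set. -/
def crtSetIdx (N P : ℕ) (c : ℕ → ℝ) (g : (k : ℕ) → (Fin k → Fin N) → ℝ)
    (η : ℝ) (k : ℕ) : Set (Fin N → ℝ) :=
  {σ | σ ∈ crtSet N P c g η ∧ critIndex N P c g σ = N - 1 - k}

/-- Coefficients of the pure p-spin model. -/
def pureC (p : ℕ) : ℕ → ℝ := fun k => if k = p then 1 else 0

/-- The uniform probability measure on the sphere `S_N`. -/
def sphereUniform (N : ℕ) : Measure (Fin N → ℝ) :=
  Measure.map (fun g i => Real.sqrt N * g i / Real.sqrt (∑ j, (g j) ^ 2))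
    (Measure.pi fun _ : Fin N => gaussianReal 0 1)

/-- The band around `m`. -/
def band (N : ℕ) (m : Fin N → ℝ) (δ : ℝ) : Set (Fin N → ℝ) :=
  {σ | σ ∈ sphereSet N ∧ |dotp (σ - m) m| < N * δ}

/-- `k`-tuples from the band with pairwise overlaps close to `⟨m,m⟩`. -/
def bandK (N k : ℕ) (m : Fin N → ℝ) (δ ε : ℝ) : Set (Fin k → Fin N → ℝ) :=
  {σs | (∀ i, σs i ∈ band N m δ) ∧
    ∀ i j, i ≠ j → |dotp (σs i) (σs j) - dotp m m| < N * ε}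

/-- `∫₀ᵗ γ(s) ds`, valued in `ℝ≥0∞`. -/
def gammaLInt (γ : ℝ → ℝ) (t : ℝ) : ℝ≥0∞ := ∫⁻ s in Set.Ioo 0 t, ENNReal.ofReal (γ s)

/-- The zero-temperature spherical Parisi functional (Crisanti–Sommers form), with the
convention `1/0 = +∞`. -/
def PFunE (P : ℕ) (c : ℕ → ℝ) (γ : ℝ → ℝ) : ℝ≥0∞ :=
  ⨅ L ∈ {L : ℝ | gammaLInt γ 1 ≤ ENNReal.ofReal L},
    (∫⁻ t in Set.Ioo (0 : ℝ) 1,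
      (ENNReal.ofReal (xiD2 P c t * (L - (gammaLInt γ t).toReal))
        + (ENNReal.ofReal (L - (gammaLInt γ t).toReal))⁻¹)) / 2

/-- The space `𝒰` of order parameters: non-decreasing, non-negative, integrable on `[0,1)`. -/
def calU : Set (ℝ → ℝ) :=
  {γ | (∀ t ∈ Set.Ico (0 : ℝ) 1, 0 ≤ γ t) ∧ MonotoneOn γ (Set.Ico 0 1) ∧
    IntegrableOn γ (Set.Ioo 0 1)}

/-- The support of `γ`: points of `[0,1]` near which `γ` is not constant. -/
def suppGamma (γ : ℝ → ℝ) : Set ℝ :=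
  {q | q ∈ Set.Icc (0 : ℝ) 1 ∧ ∀ ε > 0, ∃ s ∈ Set.Ico (0 : ℝ) 1, ∃ t ∈ Set.Ico (0 : ℝ) 1,
    |s - q| < ε ∧ |t - q| < ε ∧ γ s ≠ γ t}

/-- The superlevel set `L_N(η)`. -/
def levelSet (N P : ℕ) (c : ℕ → ℝ) (g : (k : ℕ) → (Fin k → Fin N) → ℝ)
    (η : ℝ) : Set (Fin N → ℝ) :=
  {σ | σ ∈ sphereSet N ∧ (N : ℝ) * η ≤ hamiltonian N P c g σ}

/-- Threshold energy of the pure p-spin model. -/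
def THRp (p : ℕ) : ℝ := 2 * Real.sqrt (((p : ℝ) - 1) / p)

/-- The function `J` of the pure p-spin complexity. -/
def Jp (p : ℕ) (η : ℝ) : ℝ :=
  η / (THRp p) ^ 2 * Real.sqrt (η ^ 2 - (THRp p) ^ 2)
    - Real.log (η + Real.sqrt (η ^ 2 - (THRp p) ^ 2)) + Real.log (THRp p)

/-- The annealed complexity of the pure p-spin spherical model. -/
def SigmaPure (p : ℕ) (η : ℝ) : ℝ :=
  if η ≤ 0 then Real.log ((p : ℝ) - 1) / 2
  else if η ≤ THRp p then
    Real.log ((p : ℝ) - 1) / 2 - ((p : ℝ) - 2) / (4 * ((p : ℝ) - 1)) * η ^ 2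
  else Real.log ((p : ℝ) - 1) / 2 - ((p : ℝ) - 2) / (4 * ((p : ℝ) - 1)) * η ^ 2 - Jp p η

/-- Couplings, unflattened from a vector indexed by `GIdx N P`. -/
def unflatten (N P : ℕ) (g : GIdx N P → ℝ) : (k : ℕ) → (Fin k → Fin N) → ℝ :=
  fun k j => if h : k ∈ Finset.Icc 2 P then g ⟨⟨k, h⟩, j⟩ else 0

/-- `ξ'''`. -/
def xiD3 (P : ℕ) (c : ℕ → ℝ) (x : ℝ) : ℝ :=
  ∑ k ∈ Finset.Icc 2 P, (k : ℝ) * ((k : ℝ) - 1) * ((k : ℝ) - 2) * (c k) ^ 2 * x ^ (k - 3)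

theorem ecount_eq_count {α : Type*} (s : Set α) :
    ecount s = @Measure.count α ⊤ s := by
  let : MeasurableSpace α := ⊤
  rw [Measure.count_apply MeasurableSpace.measurableSet_top]
  simp [ecount, ENNReal.tsum_one]

theorem ecount_iUnion {α : Type*} {s : ℕ → Set α} (hs : Pairwise (Function.onFun Disjoint s)) :
    ecount (⋃ k, s k) = ∑' k, ecount (s k) := by
  let : MeasurableSpace α := ⊤
  simp only [ecount_eq_count]
  exact measure_iUnion hs fun _ => MeasurableSpace.measurableSet_top

theorem ecount_image_of_injOn {α β : Type*} {s : Set α} {f : α → β} (hf : Set.InjOn f s) :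
    ecount (f '' s) = ecount s := by
  unfold ecount
  exact (Equiv.tsum_eq (Equiv.Set.imageOfInjOn f s hf) (fun _ => (1 : ℝ≥0∞))).symm

theorem ecount_fiber_of_injOn {α β : Type*} {s : Set α} {f : α → β} (hf : Set.InjOn f s) (y : β) :
    ecount {x | x ∈ s ∧ f x = y} = (f '' s).indicator 1 y := by
  by_cases hy : y ∈ f '' s
  · obtain ⟨x, hx, rfl⟩ := hy
    have : {z | z ∈ s ∧ f z = f x} = {x} := by
      ext z
      simp only [Set.mem_ofPred_eq, Set.mem_singleton_iff]
      exact ⟨fun h => hf h.1 hx h.2, fun h => by subst h; exact ⟨hx, rfl⟩⟩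
    rw [this, Set.indicator_of_mem (Set.mem_image_of_mem f hx)]
    simp [ecount]
  · have : {z | z ∈ s ∧ f z = y} = ∅ := by
      ext z
      simp only [Set.mem_ofPred_eq, Set.mem_empty_iff_false, iff_false]
      exact fun h => hy ⟨z, h.1, h.2⟩
    rw [this, Set.indicator_of_notMem hy]
    simp [ecount]

section Area

variable {E : Type*} [NormedAddCommGroup E] [NormedSpace ℝ E] [FiniteDimensional ℝ E]
  [MeasurableSpace E] [BorelSpace E] (μ : Measure E) [μ.IsAddHaarMeasure]

theorem exists_countable_injOn_cover {f : E → E} {f' : E → E →L[ℝ] E}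
    (hf : ∀ x, HasStrictFDerivAt f (f' x) x) :
    ∃ U : ℕ → Set E, (∀ k, MeasurableSet (U k)) ∧ (∀ k, Set.InjOn f (U k)) ∧
      Pairwise (Function.onFun Disjoint U) ∧ {x | (f' x).det ≠ 0} ⊆ ⋃ k, U k := by
  have key : ∀ x : E, ∃ W : Set E, IsOpen W ∧ Set.InjOn f W ∧ ((f' x).det ≠ 0 → x ∈ W) := by
    intro x
    by_cases hx : (f' x).det = 0
    · exact ⟨∅, isOpen_empty, Set.injOn_empty f, fun h => absurd hx h⟩
    · have hd : HasStrictFDerivAt f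
          ((f' x).toContinuousLinearEquivOfDetNeZero hx : E →L[ℝ] E) x := by
        simpa using hf x
      refine ⟨hd.toOpenPartialHomeomorph.source, hd.toOpenPartialHomeomorph.open_source,
        ?_, fun _ => hd.mem_toOpenPartialHomeomorph_source⟩
      exact hd.toOpenPartialHomeomorph.injOn
  choose W hWo hWi hWx using key
  obtain ⟨T, hTc, hT⟩ := TopologicalSpace.isOpen_iUnion_countable W hWo
  rcases T.eq_empty_or_nonempty with hTe | hTn
  · refine ⟨fun _ => ∅, fun _ => MeasurableSet.empty, fun _ => Set.injOn_empty f,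
      fun i j _ => by simp [Function.onFun], fun x hx => ?_⟩
    have : x ∈ ⋃ i, W i := Set.mem_iUnion.2 ⟨x, hWx x hx⟩
    rw [← hT, hTe] at this
    simp at this
  · obtain ⟨t, ht⟩ := hTc.exists_eq_range hTn
    refine ⟨disjointed fun k => W (t k),
      fun k => MeasurableSet.disjointed (fun i => (hWo (t i)).measurableSet) k,
      fun k => (hWi (t k)).mono (disjointed_subset _ k), disjoint_disjointed _, fun x hx => ?_⟩
    rw [iUnion_disjointed]
    have : x ∈ ⋃ i, W i := Set.mem_iUnion.2 ⟨x, hWx x hx⟩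
    rw [← hT, ht] at this
    simpa using this

/-- The area formula with multiplicity for a `C¹` map between spaces of equal dimension. -/
theorem area_formula {f : E → E} {f' : E → E →L[ℝ] E}
    (hf : ∀ x, HasStrictFDerivAt f (f' x) x) (hf' : Continuous f')
    {A : Set E} (hA : MeasurableSet A) :
    AEMeasurable (fun y => ecount {x | x ∈ A ∧ f x = y}) μ ∧
    ∀ g : E → ℝ≥0∞, Measurable g →
      ∫⁻ y, ecount {x | x ∈ A ∧ f x = y} * g y ∂μ =
        ∫⁻ x in A, ENNReal.ofReal |(f' x).det| * g (f x) ∂μ := by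
  obtain ⟨U, hUm, hUi, hUd, hUc⟩ := exists_countable_injOn_cover hf
  have hdet : Continuous fun x => (f' x).det := ContinuousLinearMap.continuous_det.comp hf'
  set R : Set E := {x | (f' x).det ≠ 0} with hR
  have hRm : MeasurableSet R := (isOpen_ne_fun hdet continuous_const).measurableSet
  set B : ℕ → Set E := fun k => A ∩ R ∩ U k with hB
  have hBm : ∀ k, MeasurableSet (B k) := fun k => (hA.inter hRm).inter (hUm k)
  have hBi : ∀ k, Set.InjOn f (B k) := fun k => (hUi k).mono Set.inter_subset_right
  have hBd : Pairwise (Function.onFun Disjoint B) := fun i j hij =>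
    (hUd hij).mono Set.inter_subset_right Set.inter_subset_right
  have hfw : ∀ (s : Set E), ∀ x ∈ s, HasFDerivWithinAt f (f' x) s x := fun s x _ =>
    (hf x).hasFDerivAt.hasFDerivWithinAt
  have hnull : μ (f '' (A ∩ Rᶜ)) = 0 :=
    addHaar_image_eq_zero_of_det_fderivWithin_eq_zero μ (hfw _) fun x hx => by
      simpa [hR] using hx.2
  have hBU : (⋃ k, B k) = A ∩ R := by
    rw [hB, ← Set.inter_iUnion, Set.inter_eq_left]
    exact fun x hx => hUc hx.2
  have hcount : (fun y => ecount {x | x ∈ A ∧ f x = y}) =ᵐ[μ]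
      fun y => ∑' k, (f '' B k).indicator (1 : E → ℝ≥0∞) y := by
    filter_upwards [measure_eq_zero_iff_ae_notMem.1 hnull] with y hy
    have h1 : {x | x ∈ A ∧ f x = y} = ⋃ k, {x | x ∈ B k ∧ f x = y} := by
      ext x
      have : x ∈ A ∩ R ↔ x ∈ ⋃ k, B k := by rw [hBU]
      simp only [Set.mem_ofPred_eq, Set.mem_iUnion] at this ⊢
      constructor
      · rintro ⟨hx, hxy⟩
        have hxR : x ∈ R := by
          by_contra h
          exact hy ⟨x, ⟨hx, h⟩, hxy⟩
        obtain ⟨k, hk⟩ := this.1 ⟨hx, hxR⟩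
        exact ⟨k, hk, hxy⟩
      · rintro ⟨k, hk, hxy⟩
        exact ⟨hk.1.1, hxy⟩
    rw [h1, ecount_iUnion]
    · exact tsum_congr fun k => ecount_fiber_of_injOn (hBi k) y
    · intro i j hij
      refine (hBd hij).mono ?_ ?_ <;> exact fun x hx => hx.1
  have hfB : ∀ k, MeasurableSet (f '' B k) := fun k =>
    measurable_image_of_fderivWithin (hBm k) (hfw _) (hBi k)
  have hmeas : Measurable fun y => ∑' k, (f '' B k).indicator (1 : E → ℝ≥0∞) y :=
    Measurable.tsum fun k => measurable_one.indicator (hfB k)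
  refine ⟨hmeas.aemeasurable.congr hcount.symm, fun g hg => ?_⟩
  calc ∫⁻ y, ecount {x | x ∈ A ∧ f x = y} * g y ∂μ
      = ∫⁻ y, ∑' k, (f '' B k).indicator g y ∂μ := by
        refine lintegral_congr_ae ?_
        filter_upwards [hcount] with y hy
        rw [hy, ← ENNReal.tsum_mul_right]
        refine tsum_congr fun k => ?_
        by_cases h : y ∈ f '' B k <;> simp [h]
    _ = ∑' k, ∫⁻ y, (f '' B k).indicator g y ∂μ :=
        lintegral_tsum fun k => (hg.indicator (hfB k)).aemeasurable
    _ = ∑' k, ∫⁻ x in B k, ENNReal.ofReal |(f' x).det| * g (f x) ∂μ := by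
        refine tsum_congr fun k => ?_
        rw [lintegral_indicator (hfB k)]
        exact lintegral_image_eq_lintegral_abs_det_fderiv_mul μ (hBm k) (hfw _) (hBi k) g
    _ = ∫⁻ x in A ∩ R, ENNReal.ofReal |(f' x).det| * g (f x) ∂μ := by
        rw [← hBU, lintegral_iUnion hBm hBd]
    _ = ∫⁻ x in A, ENNReal.ofReal |(f' x).det| * g (f x) ∂μ := by
        have h0 : ∫⁻ x in A \ R, ENNReal.ofReal |(f' x).det| * g (f x) ∂μ = 0 := by
          rw [setLIntegral_congr_fun (g := fun _ => 0) (hA.diff hRm), lintegral_zero]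
          intro x hx
          have : (f' x).det = 0 := by
            by_contra h
            exact hx.2 h
          simp [this]
        rw [← lintegral_inter_add_sdiff _ A hRm, h0, add_zero]

end Area

/-- The standard Gaussian measure on `ι → ℝ`. -/
abbrev stdG (ι : Type*) [Fintype ι] : Measure (ι → ℝ) := Measure.pi fun _ => gaussianReal 0 1

theorem charFunDual_stdG {ι : Type*} [Fintype ι] [DecidableEq ι] (L : StrongDual ℝ (ι → ℝ)) :
    charFunDual (stdG ι) L = Complex.exp (-((∑ i, (L (Pi.single i 1)) ^ 2 : ℝ) : ℂ) / 2) := by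
  rw [charFunDual_pi]
  have : ∀ i : ι, charFunDual (gaussianReal 0 1) (L.comp (.single ℝ (fun _ => ℝ) i)) =
      Complex.exp (-((L (Pi.single i 1) ^ 2 : ℝ) : ℂ) / 2) := by
    intro i
    have h := charFun_gaussianReal (μ := 0) (v := 1) (L (Pi.single i 1))
    rw [charFun_apply] at h
    rw [charFunDual_apply]
    have e : ∀ x : ℝ, (L.comp (.single ℝ (fun _ => ℝ) i)) x = x * L (Pi.single i 1) := by
      intro x
      have : (Pi.single i x : ι → ℝ) = x • Pi.single i 1 := by
        ext j; by_cases h : j = i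
        · subst h; simp
        · simp [h]
      simp [this]
    simp only [e]
    simp only [RCLike.inner_apply, conj_trivial] at h
    simp only [mul_comm] at h ⊢
    rw [h]
    congr 1
    push_cast
    ring
  simp only [this]
  rw [← Complex.exp_sum]
  congr 1
  push_cast
  rw [← Finset.sum_div, ← Finset.sum_neg_distrib]

theorem map_stdG_mulVec {ι κ : Type*} [Fintype ι] [DecidableEq ι] [Fintype κ] [DecidableEq κ]
    (A : Matrix κ ι ℝ) (hA : A * A.transpose = 1) :
    (stdG ι).map (fun x => A.mulVec x) = stdG κ := by
  let T : (ι → ℝ) →L[ℝ] (κ → ℝ) := LinearMap.toContinuousLinearMap A.mulVecLin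
  have hT : (fun x => A.mulVec x) = T := by ext x; simp [T]
  rw [hT]
  have : IsProbabilityMeasure ((stdG ι).map T) :=
    Measure.isProbabilityMeasure_map T.continuous.measurable.aemeasurable
  refine Measure.ext_of_charFunDual ?_
  ext L
  rw [charFunDual_map, charFunDual_stdG, charFunDual_stdG]
  congr 4
  set l : κ → ℝ := fun k => L (Pi.single k 1) with hl
  have h1 : ∀ i, (L.comp T) (Pi.single i 1) = (Matrix.vecMul l A) i := by
    intro i
    have : T (Pi.single i 1) = ∑ k, A k i • (Pi.single k 1 : κ → ℝ) := by
      ext k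
      simp [T, Finset.sum_apply, Pi.single_apply]
    simp only [ContinuousLinearMap.comp_apply, this, map_sum, map_smul, smul_eq_mul,
      Matrix.vecMul, dotProduct, hl]
    exact Finset.sum_congr rfl fun _ _ => mul_comm _ _
  have h2 : ∑ i, (Matrix.vecMul l A i) ^ 2 = Matrix.vecMul l A ⬝ᵥ Matrix.vecMul l A := by
    simp [dotProduct, sq]
  simp only [h1, h2]
  rw [← Matrix.dotProduct_mulVec, ← Matrix.vecMul_transpose, Matrix.vecMul_vecMul, hA,
    Matrix.vecMul_one]
  simp [dotProduct, sq, hl]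

/-- Tensors of order `p` on `ℝ^(n+1)`. -/
abbrev Tens (p n : ℕ) : Type := (Fin p → Fin (n + 1)) → ℝ

/-- The multilinear form attached to a tensor. -/
def mform {p n : ℕ} (w : Tens p n) (X : Fin p → Fin (n + 1) → ℝ) : ℝ :=
  ∑ j, w j * ∏ m, X m (j m)

/-- The action of a matrix on tensors, as a matrix. -/
def tmap (p : ℕ) {n : ℕ} (R : Matrix (Fin (n + 1)) (Fin (n + 1)) ℝ) :
    Matrix (Fin p → Fin (n + 1)) (Fin p → Fin (n + 1)) ℝ :=
  Matrix.of fun j k => ∏ m, R (j m) (k m)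

section
variable {p n : ℕ}

theorem tmap_mul (R S : Matrix (Fin (n + 1)) (Fin (n + 1)) ℝ) :
    tmap p (R * S) = tmap p R * tmap p S := by
  ext j k
  simp only [tmap, Matrix.of_apply, Matrix.mul_apply, ← Finset.prod_mul_distrib]
  rw [Finset.prod_univ_sum]
  simp

theorem tmap_one : tmap p (1 : Matrix (Fin (n + 1)) (Fin (n + 1)) ℝ) = 1 := by
  ext j k
  simp only [tmap, Matrix.of_apply, Matrix.one_apply]
  rw [Finset.prod_ite_zero]
  simp [funext_iff]

theorem tmap_transpose (R : Matrix (Fin (n + 1)) (Fin (n + 1)) ℝ) :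
    (tmap p R).transpose = tmap p R.transpose := by
  ext j k
  simp [tmap]

theorem tmap_mulVec_apply (R : Matrix (Fin (n + 1)) (Fin (n + 1)) ℝ) (w : Tens p n)
    (j : Fin p → Fin (n + 1)) :
    ((tmap p R).mulVec w) j = mform w (fun m => R (j m)) := by
  simp only [tmap, mform, Matrix.mulVec, dotProduct, Matrix.of_apply]
  exact Finset.sum_congr rfl fun _ _ => mul_comm _ _

theorem mform_single (w : Tens p n) (j : Fin p → Fin (n + 1)) :
    mform w (fun m => Pi.single (j m) 1) = w j := by
  have h := tmap_mulVec_apply 1 w j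
  rw [tmap_one, Matrix.one_mulVec] at h
  rw [h]
  congr 1
  ext m k
  simp [Matrix.one_apply, Pi.single_apply, eq_comm]

theorem mform_tmap (R : Matrix (Fin (n + 1)) (Fin (n + 1)) ℝ) (w : Tens p n)
    (X : Fin p → Fin (n + 1) → ℝ) :
    mform ((tmap p R).mulVec w) X = mform w (fun m => Matrix.vecMul (X m) R) := by
  simp only [mform, tmap, Matrix.mulVec, Matrix.vecMul, dotProduct, Matrix.of_apply]
  simp only [Finset.prod_univ_sum, Fintype.piFinset_univ, Finset.sum_mul, Finset.mul_sum,
    Finset.prod_mul_distrib]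
  rw [Finset.sum_comm]
  exact Finset.sum_congr rfl fun _ _ => Finset.sum_congr rfl fun _ _ => by ring

theorem mform_update_add (w : Tens p n) (X : Fin p → Fin (n + 1) → ℝ) (m : Fin p)
    (x y : Fin (n + 1) → ℝ) :
    mform w (Function.update X m (x + y)) =
      mform w (Function.update X m x) + mform w (Function.update X m y) := by
  simp only [mform, ← Finset.sum_add_distrib, ← mul_add]
  refine Finset.sum_congr rfl fun j _ => ?_
  congr 1
  simp only [← Finset.mul_prod_erase Finset.univ _ (Finset.mem_univ m), Function.update_self]
  have : ∀ z, ∏ l ∈ Finset.univ.erase m, Function.update X m z l (j l) =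
      ∏ l ∈ Finset.univ.erase m, X l (j l) := fun z =>
    Finset.prod_congr rfl fun l hl => by rw [Function.update_of_ne (Finset.ne_of_mem_erase hl)]
  simp only [this, Pi.add_apply, add_mul]

theorem mform_update_smul (w : Tens p n) (X : Fin p → Fin (n + 1) → ℝ) (m : Fin p)
    (a : ℝ) (x : Fin (n + 1) → ℝ) :
    mform w (Function.update X m (a • x)) = a * mform w (Function.update X m x) := by
  simp only [mform, Finset.mul_sum]
  refine Finset.sum_congr rfl fun j _ => ?_
  rw [mul_left_comm]
  congr 1
  simp only [← Finset.mul_prod_erase Finset.univ _ (Finset.mem_univ m), Function.update_self]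
  have : ∀ z, ∏ l ∈ Finset.univ.erase m, Function.update X m z l (j l) =
      ∏ l ∈ Finset.univ.erase m, X l (j l) := fun z =>
    Finset.prod_congr rfl fun l hl => by rw [Function.update_of_ne (Finset.ne_of_mem_erase hl)]
  simp only [this, Pi.smul_apply, smul_eq_mul, mul_assoc]

theorem mform_update_sum (w : Tens p n) (X : Fin p → Fin (n + 1) → ℝ) (m : Fin p)
    {ι : Type*} (t : Finset ι) (x : ι → Fin (n + 1) → ℝ) :
    mform w (Function.update X m (∑ i ∈ t, x i)) =
      ∑ i ∈ t, mform w (Function.update X m (x i)) := by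
  classical
  induction t using Finset.induction_on with
  | empty =>
    have := mform_update_smul w X m 0 0
    simpa using this
  | insert a t ha ih => rw [Finset.sum_insert ha, Finset.sum_insert ha, mform_update_add, ih]

theorem mform_update_single (w : Tens p n) (j : Fin p → Fin (n + 1)) (m : Fin p)
    (i : Fin (n + 1)) :
    mform w (Function.update (fun l => Pi.single (j l) 1) m (Pi.single i 1)) =
      w (Function.update j m i) := by
  rw [← mform_single w]
  congr 1
  ext l a
  by_cases h : l = m
  · subst h; simp
  · simp [h]

theorem mform_update (w : Tens p n) (j : Fin p → Fin (n + 1)) (m : Fin p)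
    (x : Fin (n + 1) → ℝ) :
    mform w (Function.update (fun l => Pi.single (j l) 1) m x) =
      ∑ i, x i * w (Function.update j m i) := by
  have hx : x = ∑ i, x i • (Pi.single i 1 : Fin (n + 1) → ℝ) := by
    ext a; simp [Finset.sum_apply, Pi.single_apply]
  conv_lhs => rw [hx]
  rw [mform_update_sum]
  simp only [mform_update_smul, mform_update_single]

theorem hasDerivAt_mform (w : Tens p n) {X : ℝ → Fin p → Fin (n + 1) → ℝ}
    {X' : Fin p → Fin (n + 1) → ℝ} {t : ℝ}
    (hX : ∀ m a, HasDerivAt (fun t => X t m a) (X' m a) t) :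
    HasDerivAt (fun t => mform w (X t)) (∑ m, mform w (Function.update (X t) m (X' m))) t := by
  have h1 : ∀ j : Fin p → Fin (n + 1), HasDerivAt (fun t => w j * ∏ m, X t m (j m))
      (w j * ∑ m, (∏ l ∈ Finset.univ.erase m, X t l (j l)) • X' m (j m)) t := fun j =>
    (HasDerivAt.fun_finsetProd fun m _ => hX m (j m)).const_mul _
  have h2 := HasDerivAt.fun_sum (u := Finset.univ) fun j _ => h1 j
  refine h2.congr_deriv ?_
  simp only [mform, Finset.mul_sum]
  rw [Finset.sum_comm]
  refine Finset.sum_congr rfl fun m _ => Finset.sum_congr rfl fun j _ => ?_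
  congr 1
  rw [← Finset.mul_prod_erase Finset.univ _ (Finset.mem_univ m), Function.update_self, smul_eq_mul,
    mul_comm]
  congr 1
  exact Finset.prod_congr rfl fun l hl => by
    rw [Function.update_of_ne (Finset.ne_of_mem_erase hl)]

/-- The vector `(1, s)`. -/
def hvec (s : Fin n → ℝ) : Fin (n + 1) → ℝ := Matrix.vecCons 1 s

/-- The vector `(0, k)`. -/
def tvec (k : Fin n → ℝ) : Fin (n + 1) → ℝ := Matrix.vecCons 0 k

/-- The reflection exchanging the pole with its stereographic image. -/
def hrefl (s : Fin n → ℝ) : Matrix (Fin (n + 1)) (Fin (n + 1)) ℝ :=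
  1 - (2 / (1 + s ⬝ᵥ s)) • Matrix.vecMulVec (hvec s) (hvec s)

theorem hvec_dot_self (s : Fin n → ℝ) : hvec s ⬝ᵥ hvec s = 1 + s ⬝ᵥ s := by
  simp [hvec]

theorem one_add_dot_pos (s : Fin n → ℝ) : 0 < 1 + s ⬝ᵥ s := by
  have : 0 ≤ s ⬝ᵥ s := Finset.sum_nonneg fun i _ => mul_self_nonneg _
  linarith

theorem hrefl_mulVec (s : Fin n → ℝ) (a : Fin (n + 1) → ℝ) :
    (hrefl s).mulVec a = a - (2 * (hvec s ⬝ᵥ a) / (1 + s ⬝ᵥ s)) • hvec s := by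
  ext i
  simp [hrefl, Matrix.sub_mulVec, Matrix.smul_mulVec, Matrix.vecMulVec_mulVec]
  ring

theorem hrefl_transpose (s : Fin n → ℝ) : (hrefl s).transpose = hrefl s := by
  simp [hrefl, Matrix.transpose_vecMulVec]

theorem vecMul_hrefl (s : Fin n → ℝ) (a : Fin (n + 1) → ℝ) :
    Matrix.vecMul a (hrefl s) = (hrefl s).mulVec a := by
  rw [← Matrix.mulVec_transpose, hrefl_transpose]

theorem hrefl_mulVec_mulVec (s : Fin n → ℝ) (a : Fin (n + 1) → ℝ) :
    (hrefl s).mulVec ((hrefl s).mulVec a) = a := by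
  have hq := (one_add_dot_pos s).ne'
  simp only [hrefl_mulVec, dotProduct_sub, dotProduct_smul, hvec_dot_self, smul_eq_mul]
  ext i
  simp only [Pi.sub_apply, Pi.smul_apply, smul_eq_mul]
  field_simp
  ring

theorem hrefl_mul_self (s : Fin n → ℝ) : hrefl s * hrefl s = 1 := by
  refine Matrix.toLin'.injective (LinearMap.ext fun a => ?_)
  rw [Matrix.toLin'_apply, Matrix.toLin'_apply, ← Matrix.mulVec_mulVec, hrefl_mulVec_mulVec,
    Matrix.one_mulVec]

theorem hrefl_dot (s : Fin n → ℝ) (a b : Fin (n + 1) → ℝ) :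
    (hrefl s).mulVec a ⬝ᵥ (hrefl s).mulVec b = a ⬝ᵥ b := by
  rw [Matrix.dotProduct_mulVec, vecMul_hrefl, hrefl_mulVec_mulVec]

theorem tmap_hrefl_mul_self (s : Fin n → ℝ) : tmap p (hrefl s) * tmap p (hrefl s) = 1 := by
  rw [← tmap_mul, hrefl_mul_self, tmap_one]

theorem tmap_hrefl_mulVec_mulVec (s : Fin n → ℝ) (w : Tens p n) :
    (tmap p (hrefl s)).mulVec ((tmap p (hrefl s)).mulVec w) = w := by
  rw [Matrix.mulVec_mulVec, tmap_hrefl_mul_self, Matrix.one_mulVec]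

theorem abs_det_tmap_hrefl (s : Fin n → ℝ) : |(tmap p (hrefl s)).det| = 1 := by
  have h : (tmap p (hrefl s)).det * (tmap p (hrefl s)).det = 1 := by
    rw [← Matrix.det_mul, tmap_hrefl_mul_self, Matrix.det_one]
  rcases mul_self_eq_one_iff.1 h with h | h <;> simp [h]

theorem tmap_hrefl_dot (s : Fin n → ℝ) (w : Tens p n) :
    (tmap p (hrefl s)).mulVec w ⬝ᵥ (tmap p (hrefl s)).mulVec w = w ⬝ᵥ w := by
  rw [Matrix.dotProduct_mulVec, ← Matrix.mulVec_transpose, tmap_transpose, hrefl_transpose,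
    tmap_hrefl_mulVec_mulVec]

theorem hvec_add_smul (s k : Fin n → ℝ) (t : ℝ) : hvec (s + t • k) = hvec s + t • tvec k := by
  ext i
  refine Fin.cases ?_ (fun i => ?_) i <;> simp [hvec, tvec]

theorem hasDerivAt_hrefl (s k : Fin n → ℝ) (a : Fin (n + 1) → ℝ) (i : Fin (n + 1)) :
    HasDerivAt (fun t : ℝ => (hrefl (s + t • k)).mulVec ((hrefl s).mulVec a) i)
      ((2 / (1 + s ⬝ᵥ s)) * ((hvec s ⬝ᵥ a) * tvec k i - (tvec k ⬝ᵥ a) * hvec s i)) 0 := by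
  have hq := (one_add_dot_pos s).ne'
  set b := (hrefl s).mulVec a with hb
  have e : ∀ t : ℝ, (hrefl (s + t • k)).mulVec b i =
      b i - (2 * (hvec s ⬝ᵥ b + t * (tvec k ⬝ᵥ b)) /
        (1 + s ⬝ᵥ s + 2 * t * (hvec s ⬝ᵥ tvec k) + t ^ 2 * (tvec k ⬝ᵥ tvec k))) *
          (hvec s i + t * tvec k i) := by
    intro t
    rw [hrefl_mulVec, ← hvec_dot_self, hvec_add_smul, ← hvec_dot_self]
    simp only [add_dotProduct, dotProduct_add, smul_dotProduct, dotProduct_smul, smul_eq_mul,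
      Pi.sub_apply, Pi.smul_apply, Pi.add_apply, dotProduct_comm (tvec k) (hvec s)]
    congr 3
    ring
  simp only [e]
  have hd1 : HasDerivAt (fun t : ℝ => 2 * (hvec s ⬝ᵥ b + t * (tvec k ⬝ᵥ b)))
      (2 * (tvec k ⬝ᵥ b)) 0 := by
    have := (((hasDerivAt_id (0 : ℝ)).mul_const (tvec k ⬝ᵥ b)).const_add (hvec s ⬝ᵥ b)).const_mul 2
    simpa using this
  have hd2 : HasDerivAt (fun t : ℝ => 1 + s ⬝ᵥ s + 2 * t * (hvec s ⬝ᵥ tvec k) +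
      t ^ 2 * (tvec k ⬝ᵥ tvec k)) (2 * (hvec s ⬝ᵥ tvec k)) 0 := by
    have h1 := (((hasDerivAt_id (0 : ℝ)).const_mul 2).mul_const (hvec s ⬝ᵥ tvec k)).const_add
      (1 + s ⬝ᵥ s)
    have h2 := ((hasDerivAt_id (0 : ℝ)).pow 2).mul_const (tvec k ⬝ᵥ tvec k)
    refine (h1.fun_add h2).congr_deriv ?_
    simp
  have hd3 : HasDerivAt (fun t : ℝ => hvec s i + t * tvec k i) (tvec k i) 0 := by
    have := ((hasDerivAt_id (0 : ℝ)).mul_const (tvec k i)).const_add (hvec s i)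
    simpa using this
  have hd := ((hd1.div hd2 (by simpa using hq)).mul hd3).const_sub (b i)
  refine hd.congr_deriv ?_
  simp only [hb, hrefl_mulVec, dotProduct_sub, dotProduct_smul, hvec_dot_self, smul_eq_mul,
    dotProduct_comm (tvec k) (hvec s), Pi.div_apply]
  simp
  field_simp
  ring

end

section
variable {p n : ℕ}

/-- The index which is `i` at slot `m` and zero elsewhere. -/
def idx1 (p : ℕ) {n : ℕ} (m : Fin p) (i : Fin n) : Fin p → Fin (n + 1) :=
  Function.update 0 m i.succ

/-- The index which is `i` at slot `m`, `l` at slot `m'` and zero elsewhere. -/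
def idx2 (p : ℕ) {n : ℕ} (m m' : Fin p) (i l : Fin n) : Fin p → Fin (n + 1) :=
  Function.update (Function.update 0 m i.succ) m' l.succ

theorem idx1_inj {m m' : Fin p} {i i' : Fin n} :
    idx1 p m i = idx1 p m' i' ↔ m = m' ∧ i = i' := by
  constructor
  · intro h
    have h1 := congrFun h m
    by_cases hm : m = m'
    · subst hm
      simpa [idx1] using h1
    · simp [idx1, hm] at h1
  · rintro ⟨rfl, rfl⟩; rfl

theorem idx1_ne_zero (m : Fin p) (i : Fin n) : idx1 p m i ≠ 0 := by
  intro h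
  simpa [idx1] using congrFun h m

theorem idx2_ne_idx1 {m m' : Fin p} (h : m' ≠ m) (i l k : Fin n) (r : Fin p) :
    idx2 p m m' i l ≠ idx1 p r k := by
  intro e
  by_cases hr : r = m
  · have := congrFun e m'
    simp [idx2, idx1, hr, h] at this
  · have := congrFun e m
    simp [idx2, idx1, Ne.symm h, Ne.symm hr] at this

/-- The normalized tangential gradient at the pole, as a matrix acting on tensors. -/
def bmat (p n : ℕ) : Matrix (Fin n) (Fin p → Fin (n + 1)) ℝ :=
  Matrix.of fun i j => (√(p : ℝ))⁻¹ * ∑ m, if j = idx1 p m i then 1 else 0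

theorem bmat_mulVec (w : Tens p n) (i : Fin n) :
    (bmat p n).mulVec w i = (√(p : ℝ))⁻¹ * ∑ m, w (idx1 p m i) := by
  simp only [bmat, Matrix.mulVec, dotProduct, Matrix.of_apply, mul_assoc, ← Finset.mul_sum,
    Finset.sum_mul]
  rw [Finset.sum_comm]
  simp

theorem bmat_mul_transpose (hp : 0 < p) : bmat p n * (bmat p n).transpose = 1 := by
  have hp' : (0 : ℝ) < p := by exact_mod_cast hp
  ext i l
  rw [Matrix.mul_apply_eq_vecMul, ← Matrix.mulVec_transpose, Matrix.transpose_transpose]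
  rw [bmat_mulVec]
  simp only [bmat, Matrix.of_apply, idx1_inj, ite_and]
  simp only [Finset.sum_ite_eq, Finset.mem_univ, if_true, Matrix.one_apply]
  by_cases h : i = l
  · subst h
    simp
    field_simp
    rw [Real.sq_sqrt hp'.le]
  · simp [h, Ne.symm h]

theorem bmat_transpose_mulVec_eq_zero (s : Fin n → ℝ) {j : Fin p → Fin (n + 1)}
    (hj : ∀ m i, j ≠ idx1 p m i) : (bmat p n).transpose.mulVec s j = 0 := by
  simp [Matrix.mulVec, dotProduct, bmat, hj]

/-- Removal of the tangential gradient at the pole. -/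
def bproj (v : Tens p n) : Tens p n := v - (bmat p n).transpose.mulVec ((bmat p n).mulVec v)

theorem bmat_bproj (hp : 0 < p) (v : Tens p n) : (bmat p n).mulVec (bproj v) = 0 := by
  rw [bproj, Matrix.mulVec_sub, Matrix.mulVec_mulVec, Matrix.mulVec_mulVec,
    bmat_mul_transpose hp, Matrix.one_mul, sub_self]

theorem bproj_apply (v : Tens p n) {j : Fin p → Fin (n + 1)}
    (hj : ∀ m i, j ≠ idx1 p m i) : bproj v j = v j := by
  rw [bproj, Pi.sub_apply, bmat_transpose_mulVec_eq_zero _ hj, sub_zero]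

theorem bproj_zero (v : Tens p n) : bproj v 0 = v 0 :=
  bproj_apply v fun m i => (idx1_ne_zero m i).symm

theorem bproj_dot (hp : 0 < p) (v : Tens p n) : bproj v ⬝ᵥ bproj v =
    v ⬝ᵥ v - (bmat p n).mulVec v ⬝ᵥ (bmat p n).mulVec v := by
  have h1 : ∀ x : Fin n → ℝ, ∀ w : Tens p n,
      (bmat p n).transpose.mulVec x ⬝ᵥ w = x ⬝ᵥ (bmat p n).mulVec w := by
    intro x w
    rw [Matrix.dotProduct_mulVec, Matrix.mulVec_transpose]
  have h2 : bproj v ⬝ᵥ bproj v = v ⬝ᵥ bproj v := by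
    conv_lhs => enter [1]; rw [bproj]
    rw [sub_dotProduct, h1, bmat_bproj hp, dotProduct_zero, sub_zero]
  rw [h2, dotProduct_comm, bproj, sub_dotProduct, h1]

/-- The map whose fibres are parametrized by critical points. -/
def Psi (v : Tens p n) : Tens p n :=
  (tmap p (hrefl ((bmat p n).mulVec v))).mulVec (bproj v)

theorem Psi_dot (hp : 0 < p) (v : Tens p n) : Psi v ⬝ᵥ Psi v =
    v ⬝ᵥ v - (bmat p n).mulVec v ⬝ᵥ (bmat p n).mulVec v := by
  rw [Psi, tmap_hrefl_dot, bproj_dot hp]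

theorem contDiff_Psi : ContDiff ℝ 1 (Psi : Tens p n → Tens p n) := by
  have hb : ContDiff ℝ 1 fun v : Tens p n => (bmat p n).mulVec v :=
    (LinearMap.toContinuousLinearMap (bmat p n).mulVecLin).contDiff
  have hbp : ContDiff ℝ 1 fun v : Tens p n => bproj v :=
    contDiff_id.sub ((LinearMap.toContinuousLinearMap
      (bmat p n).transpose.mulVecLin).contDiff.comp hb)
  have hbi : ∀ i, ContDiff ℝ 1 fun v : Tens p n => (bmat p n).mulVec v i := contDiff_pi.1 hb
  have hv : ∀ a, ContDiff ℝ 1 fun v : Tens p n => hvec ((bmat p n).mulVec v) a := by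
    intro a
    refine Fin.cases ?_ (fun i => ?_) a
    · simpa [hvec] using contDiff_const
    · simpa [hvec] using hbi i
  have hq : ContDiff ℝ 1 fun v : Tens p n =>
      1 + (bmat p n).mulVec v ⬝ᵥ (bmat p n).mulVec v := by
    refine contDiff_const.add ?_
    simp only [dotProduct]
    exact ContDiff.sum fun i _ => (hbi i).mul (hbi i)
  have hh : ∀ a b, ContDiff ℝ 1 fun v : Tens p n => hrefl ((bmat p n).mulVec v) a b := by
    intro a b
    simp only [hrefl, Matrix.sub_apply, Matrix.smul_apply, Matrix.vecMulVec_apply, smul_eq_mul]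
    exact contDiff_const.sub ((contDiff_const.div hq fun v => (one_add_dot_pos _).ne').mul
      ((hv a).mul (hv b)))
  refine contDiff_pi.2 fun j => ?_
  simp only [Psi, tmap, Matrix.mulVec, dotProduct, Matrix.of_apply]
  exact ContDiff.sum fun k _ => (contDiff_prod fun m _ => hh _ _).mul (contDiff_pi.1 hbp k)

/-- Derivative of the rotated tensor, in coordinates. -/
def dmat (s : Fin n → ℝ) (w : Tens p n) : Matrix (Fin p → Fin (n + 1)) (Fin n) ℝ :=
  Matrix.of fun j l => ∑ m, ∑ a, (2 / (1 + s ⬝ᵥ s)) *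
    (hvec s (j m) * tvec (Pi.single l 1) a - tvec (Pi.single l 1) (j m) * hvec s a) *
      w (Function.update j m a)

theorem tvec_eq_sum (k : Fin n → ℝ) (a : Fin (n + 1)) :
    tvec k a = ∑ l, tvec (Pi.single l 1) a * k l := by
  refine Fin.cases ?_ (fun i => ?_) a <;> simp [tvec, Pi.single_apply]

theorem dmat_mulVec (s k : Fin n → ℝ) (w : Tens p n) (j : Fin p → Fin (n + 1)) :
    (dmat s w).mulVec k j = ∑ m, ∑ a, (2 / (1 + s ⬝ᵥ s)) *
    (hvec s (j m) * tvec k a - tvec k (j m) * hvec s a) * w (Function.update j m a) := by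
  simp only [dmat, Matrix.mulVec, dotProduct, Matrix.of_apply, Finset.sum_mul]
  rw [Finset.sum_comm]
  refine Finset.sum_congr rfl fun m _ => ?_
  rw [Finset.sum_comm]
  refine Finset.sum_congr rfl fun a _ => ?_
  rw [tvec_eq_sum k a, tvec_eq_sum k (j m), Finset.mul_sum, Finset.sum_mul,
    ← Finset.sum_sub_distrib, Finset.mul_sum, Finset.sum_mul]
  exact Finset.sum_congr rfl fun l _ => by ring

theorem mform_add_smul (w r : Tens p n) (t : ℝ) (X : Fin p → Fin (n + 1) → ℝ) :
    mform (w + t • r) X = mform w X + t * mform r X := by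
  simp only [mform, Finset.mul_sum, ← Finset.sum_add_distrib]
  exact Finset.sum_congr rfl fun j _ => by simp; ring

theorem hasDerivAt_tmap_hrefl (s k : Fin n → ℝ) (w r : Tens p n) (j : Fin p → Fin (n + 1)) :
    HasDerivAt (fun t : ℝ => (tmap p (hrefl s)).mulVec
      ((tmap p (hrefl (s + t • k))).mulVec (w + t • r)) j)
      (r j + (dmat s w).mulVec k j) 0 := by
  set X : ℝ → Fin p → Fin (n + 1) → ℝ := fun t m =>
    (hrefl (s + t • k)).mulVec ((hrefl s).mulVec (Pi.single (j m) 1)) with hX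
  have hX0 : X 0 = fun m => Pi.single (j m) 1 := by
    ext1 m
    simp only [hX, zero_smul, add_zero, hrefl_mulVec_mulVec]
  have e : ∀ t : ℝ, (tmap p (hrefl s)).mulVec
      ((tmap p (hrefl (s + t • k))).mulVec (w + t • r)) j = mform w (X t) + t * mform r (X t) := by
    intro t
    rw [tmap_mulVec_apply, mform_tmap, mform_add_smul]
    have : (fun m => Matrix.vecMul (hrefl s (j m)) (hrefl (s + t • k))) = X t := by
      ext1 m
      rw [vecMul_hrefl, hX]
      simp only
      congr 1
      rw [← vecMul_hrefl, Matrix.single_one_vecMul]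
      rfl
    rw [this]
  simp only [e]
  have hd : ∀ w : Tens p n, HasDerivAt (fun t => mform w (X t)) _ 0 := fun w =>
    hasDerivAt_mform w (t := 0) fun m a => hasDerivAt_hrefl s k (Pi.single (j m) 1) a
  refine ((hd w).fun_add ((hasDerivAt_id (0 : ℝ)).fun_mul (hd r))).congr_deriv ?_
  simp only [hX0, mform_single, mform_update, dmat_mulVec, id]
  simp
  ring

theorem dmat_idx1 (s : Fin n → ℝ) (w : Tens p n) (m : Fin p) (i l : Fin n) :
    dmat s w (idx1 p m i) l = (2 / (1 + s ⬝ᵥ s)) *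
      ((∑ m', if m' = m then 0 else w (idx2 p m m' i l)) +
        (s i * w (idx1 p m l) - if i = l then w 0 + ∑ a, s a * w (idx1 p m a) else 0)) := by
  simp only [dmat, Matrix.of_apply, mul_assoc, ← Finset.mul_sum]
  congr 1
  rw [← Finset.sum_erase_add _ _ (Finset.mem_univ m)]
  congr 1
  · rw [← Finset.sum_erase_add _ _ (Finset.mem_univ m)]
    simp only [if_true, add_zero]
    refine Finset.sum_congr rfl fun m' hm' => ?_
    have hm := Finset.ne_of_mem_erase hm'
    rw [if_neg hm]
    have h0 : idx1 p m i m' = 0 := by simp [idx1, hm]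
    rw [h0]
    simp [Fin.sum_univ_succ, hvec, tvec, Pi.single_apply, idx2, idx1]
  · have h1 : idx1 p m i m = i.succ := by simp [idx1]
    have h2 : ∀ a, Function.update (idx1 p m i) m a = Function.update (0 : Fin p → Fin (n + 1)) m a := by
      intro a; simp [idx1]
    have h3 : Function.update (0 : Fin p → Fin (n + 1)) m 0 = 0 := by
      rw [Function.update_eq_iff]; simp
    rw [h1]
    simp only [h2]
    by_cases hil : i = l
    · subst hil
      simp [Fin.sum_univ_succ, hvec, tvec, Pi.single_apply, idx1, sub_mul, Finset.sum_sub_distrib,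
        h3]
    · simp [Fin.sum_univ_succ, hvec, tvec, Pi.single_apply, idx1, hil, h3]

/-- The tangential Hessian at the pole. -/
def hess (w : Tens p n) : Matrix (Fin n) (Fin n) ℝ :=
  Matrix.of fun i l => ∑ m, ∑ m', if m' = m then 0 else w (idx2 p m m' i l)

theorem hess_bproj (v : Tens p n) : hess (bproj v) = hess v := by
  ext i l
  simp only [hess, Matrix.of_apply]
  refine Finset.sum_congr rfl fun m _ => Finset.sum_congr rfl fun m' _ => ?_
  split_ifs with h
  · rfl
  · exact bproj_apply v fun r k => idx2_ne_idx1 h i l k r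

theorem bmat_mul_dmat (hp : 0 < p) (s : Fin n → ℝ) (w : Tens p n)
    (hw : (bmat p n).mulVec w = 0) :
    bmat p n * dmat s w =
      ((√(p : ℝ))⁻¹ * (2 / (1 + s ⬝ᵥ s))) • (hess w - (p * w 0) • (1 : Matrix _ _ ℝ)) := by
  have hp' : (0 : ℝ) < √(p : ℝ) := by positivity
  have hw' : ∀ i, ∑ m, w (idx1 p m i) = 0 := by
    intro i
    have := congrFun hw i
    rw [bmat_mulVec, Pi.zero_apply] at this
    simpa [hp'.ne'] using this
  ext i l
  have e : (bmat p n * dmat s w) i l = (bmat p n).mulVec (fun j => dmat s w j l) i := rfl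
  rw [e, bmat_mulVec]
  simp only [dmat_idx1, ← Finset.mul_sum, Finset.sum_add_distrib, Finset.sum_sub_distrib, hw']
  simp only [Matrix.smul_apply, Matrix.sub_apply, hess, Matrix.of_apply, smul_eq_mul,
    Matrix.one_apply]
  by_cases h : i = l
  · simp only [h, if_true, Finset.sum_add_distrib, Finset.sum_const, Finset.card_univ,
      Fintype.card_fin, nsmul_eq_mul]
    have h0 : ∑ m, ∑ a, s a * w (idx1 p m a) = 0 := by
      rw [Finset.sum_comm]
      simp [← Finset.mul_sum, hw']
    rw [h0]
    ring
  · simp [h]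
    ring

theorem det_fderiv_Psi (hp : 0 < p) (v : Tens p n) :
    |(fderiv ℝ (Psi : Tens p n → Tens p n) v).det| =
      ((√(p : ℝ))⁻¹ * (2 / (1 + (bmat p n).mulVec v ⬝ᵥ (bmat p n).mulVec v))) ^ n *
        |(hess v - (p * v 0) • (1 : Matrix _ _ ℝ)).det| := by
  set s := (bmat p n).mulVec v with hs
  set L := fderiv ℝ (Psi : Tens p n → Tens p n) v with hL
  have hd : HasFDerivAt Psi L v := (contDiff_Psi.differentiable one_ne_zero v).hasFDerivAt
  have key : ∀ h : Tens p n, (tmap p (hrefl s)).mulVec (L h) =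
      bproj h + (dmat s (bproj v)).mulVec ((bmat p n).mulVec h) := by
    intro h
    have h1 : HasDerivAt (fun t : ℝ => Psi (v + t • h)) (L h) 0 := by
      have h2 : HasDerivAt (fun t : ℝ => v + t • h) h 0 := by
        simpa using ((hasDerivAt_id (0 : ℝ)).smul_const h).const_add v
      have h3 : HasFDerivAt Psi L (v + (0 : ℝ) • h) := by simpa using hd
      exact h3.comp_hasDerivAt (0 : ℝ) h2
    ext j
    have h4 : HasDerivAt (fun t : ℝ => (tmap p (hrefl s)).mulVec (Psi (v + t • h)) j)
        ((tmap p (hrefl s)).mulVec (L h) j) 0 := by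
      simp only [Matrix.mulVec, dotProduct]
      exact HasDerivAt.fun_sum fun k _ => ((hasDerivAt_pi.1 h1) k).const_mul _
    refine h4.unique ?_
    have h5 := hasDerivAt_tmap_hrefl s ((bmat p n).mulVec h) (bproj v) (bproj h) j
    have h6 : ∀ t : ℝ, Psi (v + t • h) =
        (tmap p (hrefl (s + t • (bmat p n).mulVec h))).mulVec (bproj v + t • bproj h) := by
      intro t
      rw [Psi, Matrix.mulVec_add, Matrix.mulVec_smul, ← hs]
      congr 1
      ext k
      simp only [bproj, Matrix.mulVec_add, Matrix.mulVec_smul, Pi.add_apply, Pi.sub_apply,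
        Pi.smul_apply, smul_eq_mul]
      ring
    simp only [h6]
    exact h5
  have hmat : tmap p (hrefl s) * LinearMap.toMatrix' (L : Tens p n →ₗ[ℝ] Tens p n) =
      1 + (dmat s (bproj v) - (bmat p n).transpose) * bmat p n := by
    refine Matrix.toLin'.injective (LinearMap.ext fun h => ?_)
    rw [Matrix.toLin'_apply, Matrix.toLin'_apply, ← Matrix.mulVec_mulVec,
      LinearMap.toMatrix'_mulVec, Matrix.add_mulVec, ← Matrix.mulVec_mulVec, Matrix.sub_mulVec,
      Matrix.one_mulVec]
    have := key h
    rw [bproj] at this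
    rw [ContinuousLinearMap.coe_coe, this]
    abel
  have hdet := congrArg (fun M => |Matrix.det M|) hmat
  simp only [Matrix.det_mul, abs_mul, abs_det_tmap_hrefl, one_mul] at hdet
  rw [ContinuousLinearMap.det, ← LinearMap.det_toMatrix', hdet, Matrix.det_one_add_mul_comm,
    Matrix.mul_sub, bmat_mul_transpose hp, add_sub_cancel, bmat_mul_dmat hp _ _ (bmat_bproj hp v),
    Matrix.det_smul, abs_mul, hess_bproj, bproj_zero, Fintype.card_fin, abs_of_nonneg]
  have := one_add_dot_pos s
  positivity

end

theorem stdG_eq_withDensity (ι : Type*) [Fintype ι] :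
    stdG ι = volume.withDensity fun x : ι → ℝ =>
      ENNReal.ofReal ((√(2 * Real.pi))⁻¹ ^ Fintype.card ι * Real.exp (-(x ⬝ᵥ x) / 2)) := by
  have hdens : ∀ x : ι → ℝ, (√(2 * Real.pi))⁻¹ ^ Fintype.card ι * Real.exp (-(x ⬝ᵥ x) / 2) =
      ∏ i, gaussianPDFReal 0 1 (x i) := by
    intro x
    simp only [gaussianPDFReal, Finset.prod_mul_distrib, ← Real.exp_sum]
    simp only [NNReal.coe_one, mul_one, sub_zero, Finset.prod_const, Finset.card_univ]
    congr 2
    rw [dotProduct, neg_div, Finset.sum_div, ← Finset.sum_neg_distrib]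
    exact Finset.sum_congr rfl fun i _ => by ring
  refine Measure.pi_eq fun s hs => ?_
  rw [withDensity_apply _ (MeasurableSet.univ_pi hs), volume_pi, Measure.restrict_pi_pi]
  simp only [hdens]
  rw [← ofReal_integral_eq_lintegral_ofReal, integral_fintype_prod_eq_prod,
    ENNReal.ofReal_prod_of_nonneg]
  · refine Finset.prod_congr rfl fun i _ => ?_
    rw [gaussianReal_apply_eq_integral _ one_ne_zero]
  · exact fun i _ => integral_nonneg fun x => gaussianPDFReal_nonneg _ _ _
  · exact Integrable.fintype_prod fun i => (integrable_gaussianPDFReal 0 1).restrict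
  · exact ae_of_all _ fun x => Finset.prod_nonneg fun i _ => gaussianPDFReal_nonneg _ _ _

theorem continuous_dot_self {ι : Type*} [Fintype ι] : Continuous fun x : ι → ℝ => x ⬝ᵥ x :=
  continuous_id.dotProduct continuous_id

theorem measurable_gdens (ι : Type*) [Fintype ι] : Measurable fun x : ι → ℝ =>
      ENNReal.ofReal ((√(2 * Real.pi))⁻¹ ^ Fintype.card ι * Real.exp (-(x ⬝ᵥ x) / 2)) := by
  have := continuous_dot_self (ι := ι)
  exact (by fun_prop : Continuous fun x : ι → ℝ =>
    (√(2 * Real.pi))⁻¹ ^ Fintype.card ι * Real.exp (-(x ⬝ᵥ x) / 2)).measurable.ennreal_ofReal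

section
variable {p n : ℕ}

theorem continuous_bmat_mulVec : Continuous fun v : Tens p n => (bmat p n).mulVec v :=
  (LinearMap.toContinuousLinearMap (bmat p n).mulVecLin).continuous

theorem area_Psi (hp : 0 < p) {A : Set (Tens p n)} (hA : MeasurableSet A) :
    AEMeasurable (fun G => ecount {v | v ∈ A ∧ Psi v = G}) (stdG (Fin p → Fin (n + 1))) ∧
    ∫⁻ G, ecount {v | v ∈ A ∧ Psi v = G} ∂(stdG (Fin p → Fin (n + 1))) =
      ∫⁻ v in A, ENNReal.ofReal (((√(p : ℝ))⁻¹ *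
        (2 / (1 + (bmat p n).mulVec v ⬝ᵥ (bmat p n).mulVec v))) ^ n *
        Real.exp ((bmat p n).mulVec v ⬝ᵥ (bmat p n).mulVec v / 2)) *
        ENNReal.ofReal |(hess v - (p * v 0) • (1 : Matrix _ _ ℝ)).det|
          ∂(stdG (Fin p → Fin (n + 1))) := by
  obtain ⟨h1, h2⟩ := area_formula (volume : Measure (Tens p n)) (f := Psi)
    (f' := fderiv ℝ Psi)
    (fun x => contDiff_Psi.contDiffAt.hasStrictFDerivAt one_ne_zero)
    (contDiff_Psi.continuous_fderiv one_ne_zero) hA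
  have hac : stdG (Fin p → Fin (n + 1)) ≪ (volume : Measure (Tens p n)) := by
    rw [stdG_eq_withDensity]
    exact withDensity_absolutelyContinuous _ _
  refine ⟨h1.mono_ac hac, ?_⟩
  have hm := measurable_gdens (Fin p → Fin (n + 1))
  rw [stdG_eq_withDensity, lintegral_withDensity_eq_lintegral_mul₀ hm.aemeasurable h1,
    restrict_withDensity hA, lintegral_withDensity_eq_lintegral_mul_non_measurable₀ _
      hm.aemeasurable]
  · have h3 := h2 _ hm
    simp only [Pi.mul_apply]
    simp only [mul_comm (ecount _)] at h3
    rw [h3]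
    refine lintegral_congr fun v => ?_
    rw [det_fderiv_Psi hp, Psi_dot hp, ENNReal.ofReal_mul
      (by have := one_add_dot_pos ((bmat p n).mulVec v); positivity)]
    rw [mul_right_comm, ← mul_assoc]
    congr 1
    rw [← ENNReal.ofReal_mul (by have := one_add_dot_pos ((bmat p n).mulVec v); positivity),
      ← ENNReal.ofReal_mul (by positivity)]
    congr 1
    have : Real.exp (-(v ⬝ᵥ v - (bmat p n).mulVec v ⬝ᵥ (bmat p n).mulVec v) / 2) =
      Real.exp (-(v ⬝ᵥ v) / 2) * Real.exp ((bmat p n).mulVec v ⬝ᵥ (bmat p n).mulVec v / 2) := by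
      rw [← Real.exp_add]; congr 1; ring
    rw [this]
    ring
  · exact ae_of_all _ fun x => ENNReal.ofReal_lt_top

end

theorem map_stdG_sums {ι κ : Type*} [Fintype ι] [DecidableEq ι] [Fintype κ] [DecidableEq κ]
    (α : κ → Type*) [∀ k, Fintype (α k)] [∀ k, Nonempty (α k)] (f : (k : κ) → α k → ι)
    (hf : Function.Injective fun x : Σ k, α k => f x.1 x.2) :
    (stdG ι).map (fun w k => (√(Fintype.card (α k) : ℝ))⁻¹ * ∑ a, w (f k a)) = stdG κ := by
  classical
  let A : Matrix κ ι ℝ := Matrix.of fun k i => (√(Fintype.card (α k) : ℝ))⁻¹ *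
    ∑ a, if i = f k a then 1 else 0
  have hA : ∀ (w : ι → ℝ) k, A.mulVec w k = (√(Fintype.card (α k) : ℝ))⁻¹ * ∑ a, w (f k a) := by
    intro w k
    simp only [A, Matrix.mulVec, dotProduct, Matrix.of_apply, mul_assoc, ← Finset.mul_sum,
      Finset.sum_mul]
    rw [Finset.sum_comm]
    simp
  have h := map_stdG_mulVec A ?_
  · rw [← h]
    congr 1
    ext w k
    rw [hA]
  · ext k l
    have e : (A * A.transpose) k l = A.mulVec (fun i => A l i) k := rfl
    rw [e, hA]
    simp only [A, Matrix.of_apply]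
    by_cases hkl : k = l
    · subst hkl
      have h1 : ∀ a b, f k a = f k b ↔ a = b := fun a b =>
        ⟨fun h => by simpa using hf (a₁ := ⟨k, a⟩) (a₂ := ⟨k, b⟩) h, fun h => by rw [h]⟩
      have hc : (0 : ℝ) < Fintype.card (α k) := by exact_mod_cast Fintype.card_pos
      simp only [h1, Finset.sum_ite_eq, Finset.mem_univ, if_true, Matrix.one_apply_eq, mul_one,
        Finset.sum_const, Finset.card_univ, nsmul_eq_mul]
      field_simp
      rw [Real.sq_sqrt hc.le]
    · have h1 : ∀ a b, f k a ≠ f l b := fun a b h => by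
        have := hf (a₁ := ⟨k, a⟩) (a₂ := ⟨l, b⟩) h
        simp [hkl] at this
      simp [h1, hkl]

theorem map_stdG_comp {ι κ : Type*} [Fintype ι] [Fintype κ]
    (φ : κ → ι) (hφ : Function.Injective φ) :
    (stdG ι).map (fun w k => w (φ k)) = stdG κ := by
  classical
  have := map_stdG_sums (ι := ι) (κ := κ) (fun _ => Unit) (fun k _ => φ k)
    (fun x y h => by
      have := hφ h
      cases x; cases y; simp_all)
  simpa using this

/-- The symmetric matrix with Gaussian entries (GOE normalization with off-diagonal variance 1). -/
def goe {n : ℕ} (X : Fin n × Fin n → ℝ) : Matrix (Fin n) (Fin n) ℝ :=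
  Matrix.of fun i j => (X (i, j) + X (j, i)) / √2

/-- The characteristic polynomial of `goe X` at `x`. -/
def dgoe {n : ℕ} (x : ℝ) (X : Fin n × Fin n → ℝ) : ℝ :=
  (x • (1 : Matrix (Fin n) (Fin n) ℝ) - goe X).det

theorem continuous_goe {n : ℕ} : Continuous (goe : (Fin n × Fin n → ℝ) → _) := by
  refine continuous_matrix fun i j => ?_
  simp only [goe, Matrix.of_apply]
  fun_prop

theorem continuous_dgoe {n : ℕ} :
    Continuous fun y : ℝ × (Fin n × Fin n → ℝ) => dgoe y.1 y.2 := by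
  have := continuous_goe (n := n)
  unfold dgoe
  refine Continuous.matrix_det ?_
  fun_prop

/-- The spherical part of the Kac–Rice integral. -/
def krConst (n : ℕ) : ℝ≥0∞ :=
  ∫⁻ s, ENNReal.ofReal ((2 / (1 + s ⬝ᵥ s)) ^ n * Real.exp (s ⬝ᵥ s / 2)) ∂(stdG (Fin n))

/-- The averaged absolute characteristic polynomial of the GOE. -/
def absDet (n : ℕ) (x : ℝ) : ℝ≥0∞ :=
  ∫⁻ X, ENNReal.ofReal |dgoe x X| ∂(stdG (Fin n × Fin n))

section
variable {p n : ℕ}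

/-- Ordered pairs of slots. -/
abbrev SlotPair (p : ℕ) : Type := {x : Fin p × Fin p // x.1 < x.2}

theorem idx2_comm {m m' : Fin p} (h : m ≠ m') (i l : Fin n) :
    idx2 p m m' i l = idx2 p m' m l i := by
  unfold idx2
  rw [Function.update_comm h]

theorem idx2_ne_zero (m m' : Fin p) (i l : Fin n) : idx2 p m m' i l ≠ 0 := by
  intro h
  simpa [idx2] using congrFun h m'

theorem idx2_inj {m m' r r' : Fin p} {i l k h : Fin n} (hm : m < m') (hr : r < r')
    (e : idx2 p m m' i l = idx2 p r r' k h) : m = r ∧ m' = r' ∧ i = k ∧ l = h := by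
  have nz : ∀ {m m' : Fin p} {i l : Fin n} (a : Fin p), idx2 p m m' i l a ≠ 0 ↔ a = m ∨ a = m' := by
    intro m m' i l a
    by_cases h1 : a = m'
    · subst h1; simp [idx2]
    · by_cases h2 : a = m
      · subst h2; simp [idx2, h1]
      · simp [idx2, h1, h2]
  have hs : ∀ a, (a = m ∨ a = m') ↔ (a = r ∨ a = r') := by
    intro a
    rw [← nz (i := i) (l := l), e, nz]
  have h1 := (hs m).1 (Or.inl rfl)
  have h2 := (hs m').1 (Or.inr rfl)
  have h3 := (hs r).2 (Or.inl rfl)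
  have hmr : m = r ∧ m' = r' := by
    rcases h1 with h1 | h1 <;> rcases h2 with h2 | h2 <;> rcases h3 with h3 | h3 <;>
      subst_vars <;> simp_all [lt_asymm]
  obtain ⟨rfl, rfl⟩ := hmr
  have e1 := congrFun e m
  have e2 := congrFun e m'
  simp [idx2, hm.ne] at e1 e2
  exact ⟨rfl, rfl, e1, e2⟩

theorem card_slotPair (p : ℕ) : (Fintype.card (SlotPair p) : ℝ) = p * (p - 1) / 2 := by
  have h : ∑ x : Fin p × Fin p, (if x.1 < x.2 then (1 : ℝ) else 0) = p * (p - 1) / 2 := by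
    have h1 : ∑ x : Fin p × Fin p, (if x.1 < x.2 then (1 : ℝ) else 0) =
        ∑ x : Fin p × Fin p, (if x.2 < x.1 then (1 : ℝ) else 0) :=
      Fintype.sum_equiv (Equiv.prodComm _ _) _ _ fun x => rfl
    have h2 : ∑ x : Fin p × Fin p, ((if x.1 < x.2 then (1 : ℝ) else 0) +
        (if x.2 < x.1 then (1 : ℝ) else 0) + (if x.1 = x.2 then 1 else 0)) = p * p := by
      rw [Finset.sum_congr rfl (g := fun _ => (1 : ℝ))]
      · simp
      · intro x _
        rcases lt_trichotomy x.1 x.2 with h | h | h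
        · simp [h, h.ne, lt_asymm h]
        · simp [h]
        · simp [h, h.ne', lt_asymm h]
    have h3 : ∑ x : Fin p × Fin p, (if x.1 = x.2 then (1 : ℝ) else 0) = p := by
      rw [Fintype.sum_prod_type]
      simp
    rw [Finset.sum_add_distrib, Finset.sum_add_distrib, ← h1, h3] at h2
    linarith
  rw [← h, Fintype.card_subtype]
  simp

/-- The normalized second order coefficients. -/
def xcoef (v : Tens p n) (y : Fin n × Fin n) : ℝ :=
  (√(Fintype.card (SlotPair p) : ℝ))⁻¹ * ∑ a : SlotPair p, v (idx2 p a.1.1 a.1.2 y.1 y.2)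

theorem hess_eq (hp : 3 ≤ p) (v : Tens p n) :
    hess v = √((p : ℝ) * (p - 1)) • goe (xcoef v) := by
  have hp' : (3 : ℝ) ≤ p := by exact_mod_cast hp
  have hc : (0 : ℝ) < p * (p - 1) / 2 := by
    have : (0 : ℝ) < p - 1 := by linarith
    positivity
  ext i l
  have h1 : ∀ i l : Fin n, ∑ a : SlotPair p, v (idx2 p a.1.1 a.1.2 i l) =
      ∑ m, ∑ m', if m < m' then v (idx2 p m m' i l) else 0 := by
    intro i l
    rw [← Fintype.sum_prod_type' (f := fun m m' => if m < m' then v (idx2 p m m' i l) else 0),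
      ← Finset.sum_filter]
    exact (Finset.sum_subtype (p := fun x : Fin p × Fin p => x.1 < x.2)
      (Finset.univ.filter fun x => x.1 < x.2) (by simp)
      (fun x => v (idx2 p x.1 x.2 i l))).symm
  have h2 : hess v i l = (∑ a : SlotPair p, v (idx2 p a.1.1 a.1.2 i l)) +
      ∑ a : SlotPair p, v (idx2 p a.1.1 a.1.2 l i) := by
    rw [h1, h1 l i, Finset.sum_comm (f := fun m m' => if m < m' then v (idx2 p m m' l i) else 0),
      ← Finset.sum_add_distrib]
    simp only [hess, Matrix.of_apply]
    refine Finset.sum_congr rfl fun m _ => ?_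
    rw [← Finset.sum_add_distrib]
    refine Finset.sum_congr rfl fun m' _ => ?_
    rcases lt_trichotomy m m' with h | h | h
    · simp [h, h.ne', lt_asymm h]
    · simp [h]
    · simp [h, h.ne, lt_asymm h, idx2_comm h.ne']
  rw [h2]
  simp only [Matrix.smul_apply, goe, Matrix.of_apply, xcoef, card_slotPair, smul_eq_mul]
  have h3 : √((p : ℝ) * (p - 1)) = √(p * (p - 1) / 2) * √2 := by
    rw [← Real.sqrt_mul hc.le]; congr 1; ring
  have h4 : 0 < √((p : ℝ) * (p - 1) / 2) := Real.sqrt_pos.2 hc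
  rw [h3]
  field_simp

theorem abs_det_hess (hp : 3 ≤ p) (v : Tens p n) :
    |(hess v - (p * v 0) • (1 : Matrix _ _ ℝ)).det| =
      √((p : ℝ) * (p - 1)) ^ n * |dgoe (√((p : ℝ) / (p - 1)) * v 0) (xcoef v)| := by
  have hp' : (3 : ℝ) ≤ p := by exact_mod_cast hp
  have h1 : (0 : ℝ) < p - 1 := by linarith
  have h0 : (0 : ℝ) < p := by linarith
  have e : hess v - (p * v 0) • (1 : Matrix (Fin n) (Fin n) ℝ) = (-√((p : ℝ) * (p - 1))) •
      ((√((p : ℝ) / (p - 1)) * v 0) • (1 : Matrix _ _ ℝ) - goe (xcoef v)) := by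
    rw [hess_eq hp, smul_sub, smul_smul, neg_mul, ← mul_assoc, ← Real.sqrt_mul (by positivity)]
    have : (p : ℝ) * (p - 1) * (p / (p - 1)) = p * p := by field_simp
    rw [this, Real.sqrt_mul_self h0.le, neg_smul, neg_smul]
    abel
  rw [e, Matrix.det_smul, abs_mul, Fintype.card_fin, abs_pow, abs_neg,
    abs_of_nonneg (Real.sqrt_nonneg _), dgoe]

/-- The slots entering the three groups of linear statistics. -/
def Slot (p : ℕ) {n : ℕ} : Fin n ⊕ (Unit ⊕ (Fin n × Fin n)) → Type
  | .inl _ => Fin p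
  | .inr (.inl _) => Unit
  | .inr (.inr _) => SlotPair p

instance Slot.instFintype : (k : Fin n ⊕ (Unit ⊕ (Fin n × Fin n))) → Fintype (Slot p k)
  | .inl _ => inferInstanceAs (Fintype (Fin p))
  | .inr (.inl _) => inferInstanceAs (Fintype Unit)
  | .inr (.inr _) => inferInstanceAs (Fintype (SlotPair p))

/-- The tensor index attached to a slot. -/
def slotIdx : (k : Fin n ⊕ (Unit ⊕ (Fin n × Fin n))) → Slot p k → (Fin p → Fin (n + 1))
  | .inl i => fun m : Fin p => idx1 p m i
  | .inr (.inl _) => fun _ => 0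
  | .inr (.inr y) => fun a : SlotPair p => idx2 p a.1.1 a.1.2 y.1 y.2

theorem lintegral_stdG_joint (hp : 3 ≤ p) (Φ : (Fin n → ℝ) → ℝ≥0∞) (hΦ : Measurable Φ)
    (Θ : ℝ × (Fin n × Fin n → ℝ) → ℝ≥0∞) (hΘ : Measurable Θ) :
    ∫⁻ v, Φ ((bmat p n).mulVec v) * Θ (v 0, xcoef v) ∂(stdG (Fin p → Fin (n + 1))) =
      (∫⁻ s, Φ s ∂(stdG (Fin n))) *
        ∫⁻ z, ∫⁻ X, Θ (z, X) ∂(stdG (Fin n × Fin n)) ∂(gaussianReal 0 1) := by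
  have : Nonempty (SlotPair p) := ⟨⟨(⟨0, by omega⟩, ⟨1, by omega⟩), by simp [Fin.lt_def]⟩⟩
  have : Nonempty (Fin p) := ⟨⟨0, by omega⟩⟩
  have instN : ∀ k : Fin n ⊕ (Unit ⊕ (Fin n × Fin n)), Nonempty (Slot p k) := by
    rintro (i | u | y)
    · exact (inferInstance : Nonempty (Fin p))
    · exact (inferInstance : Nonempty Unit)
    · exact (inferInstance : Nonempty (SlotPair p))
  have hf : Function.Injective fun x : Σ k, Slot (n := n) p k => slotIdx x.1 x.2 := by
    rintro ⟨i | u | y, a⟩ ⟨i' | u' | y', a'⟩ h <;> simp only [slotIdx] at h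
    · obtain ⟨rfl, rfl⟩ := idx1_inj.1 h; rfl
    · exact absurd h (idx1_ne_zero _ _)
    · exact absurd h.symm (idx2_ne_idx1 (Subtype.prop a').ne' _ _ _ _)
    · exact absurd h.symm (idx1_ne_zero _ _)
    · rfl
    · exact absurd h.symm (idx2_ne_zero _ _ _ _)
    · exact absurd h (idx2_ne_idx1 (Subtype.prop a).ne' _ _ _ _)
    · exact absurd h (idx2_ne_zero _ _ _ _)
    · obtain ⟨h1, h2, h3, h4⟩ := idx2_inj (Subtype.prop a) (Subtype.prop a') h
      obtain ⟨⟨a1, a2⟩, ha⟩ := a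
      obtain ⟨⟨b1, b2⟩, hb⟩ := a'
      obtain ⟨y1, y2⟩ := y
      obtain ⟨z1, z2⟩ := y'
      simp only at h1 h2 h3 h4
      subst h1 h2 h3 h4
      rfl
  have hmap := map_stdG_sums (Slot (n := n) p) slotIdx hf
  set F : Tens p n → (Fin n ⊕ (Unit ⊕ (Fin n × Fin n)) → ℝ) :=
    fun w k => (√(Fintype.card (Slot p k) : ℝ))⁻¹ * ∑ a, w (slotIdx k a) with hF
  have hFm : Measurable F := by
    refine measurable_pi_lambda _ fun k => ?_
    refine measurable_const.mul (Finset.measurable_sum _ fun a _ => measurable_pi_apply _)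
  have e1 : ∀ v, (bmat p n).mulVec v = fun i => F v (.inl i) := by
    intro v; ext i
    rw [bmat_mulVec]
    have : Fintype.card (Slot p (Sum.inl i)) = p := Fintype.card_fin p
    simp only [hF, this]
    rfl
  have e2 : ∀ v, xcoef v = fun y => F v (.inr (.inr y)) := by
    intro v; ext y; rfl
  have e3 : ∀ v, v 0 = F v (.inr (.inl ())) := by
    intro v
    have : Fintype.card (Slot (n := n) p (.inr (.inl ()))) = 1 := Fintype.card_unit
    simp only [hF, this]
    simp only [Nat.cast_one, Real.sqrt_one, inv_one, one_mul]
    exact (Fintype.sum_unique (ι := Unit) fun _ => v 0).symm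
  have hΘ2 : Measurable fun y : (Unit ⊕ (Fin n × Fin n) → ℝ) =>
      Θ (y (.inl ()), fun z => y (.inr z)) :=
    hΘ.comp ((measurable_pi_apply _).prodMk (measurable_pi_lambda _ fun z => measurable_pi_apply _))
  have hΦ2 : Measurable fun u : (Fin n ⊕ (Unit ⊕ (Fin n × Fin n)) → ℝ) =>
      Φ (fun i => u (.inl i)) :=
    hΦ.comp (measurable_pi_lambda _ fun z => measurable_pi_apply _)
  have hΘ3 : Measurable fun u : (Fin n ⊕ (Unit ⊕ (Fin n × Fin n)) → ℝ) =>
      Θ (u (.inr (.inl ())), fun y => u (.inr (.inr y))) :=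
    hΘ.comp ((measurable_pi_apply _).prodMk (measurable_pi_lambda _ fun z => measurable_pi_apply _))
  calc ∫⁻ v, Φ ((bmat p n).mulVec v) * Θ (v 0, xcoef v) ∂(stdG (Fin p → Fin (n + 1)))
      = ∫⁻ u, Φ (fun i => u (.inl i)) * Θ (u (.inr (.inl ())), fun y => u (.inr (.inr y)))
          ∂(stdG (Fin n ⊕ (Unit ⊕ (Fin n × Fin n)))) := by
        have hm : Measurable fun u : (Fin n ⊕ (Unit ⊕ (Fin n × Fin n)) → ℝ) =>
            Φ (fun i => u (.inl i)) * Θ (u (.inr (.inl ())), fun y => u (.inr (.inr y))) :=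
          hΦ2.mul hΘ3
        rw [← hmap, lintegral_map hm hFm]
        refine lintegral_congr fun v => ?_
        rw [e1, e2, e3 v]
    _ = ∫⁻ y, Φ y.1 * Θ (y.2 (.inl ()), fun z => y.2 (.inr z))
          ∂((stdG (Fin n)).prod (stdG (Unit ⊕ (Fin n × Fin n)))) := by
        have h := measurePreserving_sumPiEquivProdPi
          (fun _ : Fin n ⊕ (Unit ⊕ (Fin n × Fin n)) => gaussianReal 0 1)
        rw [← h.map_eq, lintegral_map_equiv]
        rfl
    _ = (∫⁻ s, Φ s ∂(stdG (Fin n))) * ∫⁻ y, Θ (y (.inl ()), fun z => y (.inr z))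
          ∂(stdG (Unit ⊕ (Fin n × Fin n))) :=
        lintegral_prod_mul hΦ.aemeasurable hΘ2.aemeasurable
    _ = _ := by
        congr 1
        have h := measurePreserving_sumPiEquivProdPi
          (fun _ : Unit ⊕ (Fin n × Fin n) => gaussianReal 0 1)
        have h2 : ∫⁻ y, Θ (y (.inl ()), fun z => y (.inr z)) ∂(stdG (Unit ⊕ (Fin n × Fin n))) =
            ∫⁻ y, Θ (y.1 (), y.2) ∂((stdG Unit).prod (stdG (Fin n × Fin n))) := by
          rw [← h.map_eq, lintegral_map_equiv]
          rfl
        have hm : Measurable fun y : (Unit → ℝ) × (Fin n × Fin n → ℝ) => Θ (y.1 (), y.2) :=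
          hΘ.comp (((measurable_pi_apply _).comp measurable_fst).prodMk measurable_snd)
        rw [h2, lintegral_prod _ hm.aemeasurable]
        have h3 := measurePreserving_funUnique (gaussianReal 0 1) Unit
        rw [← h3.map_eq, lintegral_map_equiv]
        rfl

theorem lintegral_kac_rice (hp : 3 ≤ p) (a : ℝ) :
    ∫⁻ G, ecount {v : Tens p n | v ∈ {v | a ≤ v 0} ∧ Psi v = G}
        ∂(stdG (Fin p → Fin (n + 1))) =
      ENNReal.ofReal (√((p : ℝ) - 1) ^ n) * krConst n *
        ∫⁻ z in Set.Ici a, absDet n (√((p : ℝ) / (p - 1)) * z) ∂(gaussianReal 0 1) := by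
  have hp' : (3 : ℝ) ≤ p := by exact_mod_cast hp
  have h1 : (0 : ℝ) < p - 1 := by linarith
  have h0 : (0 : ℝ) < p := by linarith
  have hA : MeasurableSet {v : Tens p n | a ≤ v 0} :=
    measurableSet_le measurable_const (measurable_pi_apply _)
  rw [(area_Psi (by omega) hA).2, ← lintegral_indicator hA]
  set Φ : (Fin n → ℝ) → ℝ≥0∞ := fun s =>
    ENNReal.ofReal ((2 / (1 + s ⬝ᵥ s)) ^ n * Real.exp (s ⬝ᵥ s / 2)) with hΦ
  set Θ : ℝ × (Fin n × Fin n → ℝ) → ℝ≥0∞ := fun y =>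
    (Set.Ici a).indicator (fun _ => ENNReal.ofReal |dgoe (√((p : ℝ) / (p - 1)) * y.1) y.2|) y.1
    with hΘ
  have hΦm : Measurable Φ := by
    have := (continuous_dot_self (ι := Fin n)).measurable
    fun_prop
  have hΘm : Measurable Θ := by
    have hc : Continuous fun y : ℝ × (Fin n × Fin n → ℝ) =>
        |dgoe (√((p : ℝ) / (p - 1)) * y.1) y.2| :=
      (continuous_dgoe.comp (by fun_prop : Continuous fun y : ℝ × (Fin n × Fin n → ℝ) =>
        (√((p : ℝ) / (p - 1)) * y.1, y.2))).abs
    exact (hc.measurable.ennreal_ofReal).indicator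
      (measurableSet_Ici.preimage measurable_fst)
  have e : ∀ v : Tens p n, {v : Tens p n | a ≤ v 0}.indicator (fun v =>
      ENNReal.ofReal (((√(p : ℝ))⁻¹ *
        (2 / (1 + (bmat p n).mulVec v ⬝ᵥ (bmat p n).mulVec v))) ^ n *
        Real.exp ((bmat p n).mulVec v ⬝ᵥ (bmat p n).mulVec v / 2)) *
        ENNReal.ofReal |(hess v - (p * v 0) • (1 : Matrix _ _ ℝ)).det|) v =
      ENNReal.ofReal (√((p : ℝ) - 1) ^ n) *
        (Φ ((bmat p n).mulVec v) * Θ (v 0, xcoef v)) := by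
    intro v
    by_cases hv : a ≤ v 0
    · rw [Set.indicator_of_mem (by exact hv)]
      simp only [hΦ, hΘ]
      rw [Set.indicator_of_mem (by exact hv), abs_det_hess hp, mul_pow, mul_assoc,
        ENNReal.ofReal_mul (p := (√(p : ℝ))⁻¹ ^ n) (by positivity),
        ENNReal.ofReal_mul (p := √((p : ℝ) * (p - 1)) ^ n) (by positivity)]
      have : ENNReal.ofReal (√((p : ℝ) - 1) ^ n) = ENNReal.ofReal ((√(p : ℝ))⁻¹ ^ n) *
          ENNReal.ofReal (√((p : ℝ) * (p - 1)) ^ n) := by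
        rw [← ENNReal.ofReal_mul (by positivity), ← mul_pow, Real.sqrt_mul h0.le]
        congr 2
        field_simp
      rw [this]
      ring
    · rw [Set.indicator_of_notMem (by exact hv)]
      simp only [hΘ]
      rw [Set.indicator_of_notMem (by exact hv)]
      simp
  simp only [e]
  rw [lintegral_const_mul, lintegral_stdG_joint hp Φ hΦm Θ hΘm, mul_assoc]
  · congr 2
    rw [← lintegral_indicator measurableSet_Ici]
    refine lintegral_congr fun z => ?_
    by_cases hz : z ∈ Set.Ici a
    · simp only [hΘ, Set.indicator_of_mem hz, absDet]
    · simp only [hΘ, Set.indicator_of_notMem hz]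
      simp
  · refine (hΦm.comp continuous_bmat_mulVec.measurable).mul (hΘm.comp ?_)
    refine (measurable_pi_apply _).prodMk (measurable_pi_lambda _ fun y => ?_)
    exact measurable_const.mul (Finset.measurable_sum _ fun a _ => measurable_pi_apply _)

end

section
variable {p n : ℕ}

theorem hamiltonian_pure (hp : 3 ≤ p) (g : (k : ℕ) → (Fin k → Fin (n + 1)) → ℝ)
    (σ : Fin (n + 1) → ℝ) :
    hamiltonian (n + 1) p (pureC p) g σ =
      ((n + 1 : ℕ) : ℝ) ^ (-(((p : ℝ) - 1) / 2)) * mform (g p) (fun _ => σ) := by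
  unfold hamiltonian
  rw [Finset.sum_eq_single p]
  · simp [pureC, mform]
  · intro k _ hk
    simp [pureC, hk]
  · intro h
    exact absurd (Finset.mem_Icc.2 ⟨by omega, le_rfl⟩) h

/-- The derivative of the diagonal form `x ↦ w(x, …, x)` in direction `y`. -/
def dform (w : Tens p n) (x y : Fin (n + 1) → ℝ) : ℝ :=
  ∑ m, mform w (Function.update (fun _ => x) m y)

theorem differentiable_hamiltonian (N P : ℕ) (c : ℕ → ℝ) (g : (k : ℕ) → (Fin k → Fin N) → ℝ) :
    Differentiable ℝ (hamiltonian N P c g) := by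
  unfold hamiltonian
  fun_prop

theorem fderiv_hamiltonian (hp : 3 ≤ p) (g : (k : ℕ) → (Fin k → Fin (n + 1)) → ℝ)
    (x y : Fin (n + 1) → ℝ) :
    fderiv ℝ (hamiltonian (n + 1) p (pureC p) g) x y =
      ((n + 1 : ℕ) : ℝ) ^ (-(((p : ℝ) - 1) / 2)) * dform (g p) x y := by
  have h1 := ((differentiable_hamiltonian (n + 1) p (pureC p) g x).hasFDerivAt).hasLineDerivAt y
  have h2 : HasDerivAt (fun t : ℝ => mform (g p) (fun _ => x + t • y)) (dform (g p) x y) 0 := by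
    have := hasDerivAt_mform (g p) (X := fun t _ => x + t • y) (X' := fun _ => y) (t := 0)
      (fun m a => by
        simp only [Pi.add_apply, Pi.smul_apply, smul_eq_mul]
        simpa using ((hasDerivAt_id (0 : ℝ)).mul_const (y a)).const_add (x a))
    simpa [dform] using this
  have h3 := h2.const_mul (((n + 1 : ℕ) : ℝ) ^ (-(((p : ℝ) - 1) / 2)))
  simp only [← hamiltonian_pure hp] at h3
  exact HasDerivAt.unique h1 h3

theorem gradH_dot (hp : 3 ≤ p) (g : (k : ℕ) → (Fin k → Fin (n + 1)) → ℝ)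
    (x y : Fin (n + 1) → ℝ) :
    dotp (gradH (n + 1) p (pureC p) g x) y =
      ((n + 1 : ℕ) : ℝ) ^ (-(((p : ℝ) - 1) / 2)) * dform (g p) x y := by
  rw [← fderiv_hamiltonian hp]
  have hy : y = ∑ i, y i • (Pi.single i 1 : Fin (n + 1) → ℝ) := by
    ext a; simp [Finset.sum_apply, Pi.single_apply]
  conv_rhs => rw [hy]
  simp only [map_sum, map_smul, smul_eq_mul, dotp, gradH]
  exact Finset.sum_congr rfl fun i _ => mul_comm _ _

theorem isCritPt_iff (hp : 3 ≤ p) (g : (k : ℕ) → (Fin k → Fin (n + 1)) → ℝ)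
    (x : Fin (n + 1) → ℝ) :
    IsCritPt (n + 1) p (pureC p) g x ↔
      x ⬝ᵥ x = ((n + 1 : ℕ) : ℝ) ∧ ∀ y, x ⬝ᵥ y = 0 → dform (g p) x y = 0 := by
  have hN : (0 : ℝ) < ((n + 1 : ℕ) : ℝ) := by positivity
  have hs : x ∈ sphereSet (n + 1) ↔ x ⬝ᵥ x = ((n + 1 : ℕ) : ℝ) := by
    simp [sphereSet, dotProduct, sq]
  have hc : (0 : ℝ) < ((n + 1 : ℕ) : ℝ) ^ (-(((p : ℝ) - 1) / 2)) := by positivity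
  unfold IsCritPt
  rw [hs]
  refine and_congr_right fun hx => ?_
  set v := gradH (n + 1) p (pureC p) g x with hv
  have hd : ∀ y, dform (g p) x y = 0 ↔ v ⬝ᵥ y = 0 := by
    intro y
    have := gradH_dot hp g x y
    change v ⬝ᵥ y = _ at this
    rw [this, mul_eq_zero, or_iff_right hc.ne']
  simp only [hd]
  change v = ((v ⬝ᵥ x) / ((n + 1 : ℕ) : ℝ)) • x ↔ _
  constructor
  · intro h y hy
    rw [h, smul_dotProduct, hy, smul_zero]
  · intro h
    have h1 := h (v - ((v ⬝ᵥ x) / ((n + 1 : ℕ) : ℝ)) • x) (by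
      rw [dotProduct_sub, dotProduct_smul, hx, smul_eq_mul, div_mul_cancel₀ _ hN.ne',
        dotProduct_comm, sub_self])
    have h2 : (v - ((v ⬝ᵥ x) / ((n + 1 : ℕ) : ℝ)) • x) ⬝ᵥ
        (v - ((v ⬝ᵥ x) / ((n + 1 : ℕ) : ℝ)) • x) = 0 := by
      conv_lhs => rw [sub_dotProduct]
      rw [h1, smul_dotProduct, dotProduct_sub, dotProduct_smul, hx, smul_eq_mul,
        smul_eq_mul, div_mul_cancel₀ _ hN.ne', dotProduct_comm, sub_self]
      simp
    exact sub_eq_zero.1 (dotProduct_self_eq_zero.1 h2)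

theorem mform_smul (w : Tens p n) (c : ℝ) (X : Fin p → Fin (n + 1) → ℝ) :
    mform w (fun m => c • X m) = c ^ p * mform w X := by
  simp only [mform, Pi.smul_apply, smul_eq_mul, Finset.prod_mul_distrib, Finset.mul_sum]
  exact Finset.sum_congr rfl fun j _ => by simp; ring

theorem dform_smul (w : Tens p n) (c : ℝ) (x y : Fin (n + 1) → ℝ) :
    dform w (c • x) (c • y) = c ^ p * dform w x y := by
  unfold dform
  rw [Finset.mul_sum]
  refine Finset.sum_congr rfl fun m _ => ?_
  rw [← mform_smul]
  congr 1
  ext l a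
  by_cases h : l = m
  · subst h; simp
  · simp [h]

theorem dform_tmap (w : Tens p n) (s : Fin n → ℝ) (x y : Fin (n + 1) → ℝ) :
    dform ((tmap p (hrefl s)).mulVec w) x y =
      dform w ((hrefl s).mulVec x) ((hrefl s).mulVec y) := by
  unfold dform
  refine Finset.sum_congr rfl fun m _ => ?_
  rw [mform_tmap]
  congr 1
  ext l a
  by_cases h : l = m
  · subst h; simp [vecMul_hrefl]
  · simp [h, vecMul_hrefl]

/-- The pole of the sphere. -/
def pole (n : ℕ) : Fin (n + 1) → ℝ := Pi.single 0 1

theorem dform_pole (w : Tens p n) (y : Fin (n + 1) → ℝ) :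
    dform w (pole n) y = p * (y 0 * w 0) + ∑ i, y i.succ * ∑ m, w (idx1 p m i) := by
  have h : ∀ m : Fin p, mform w (Function.update (fun _ => pole n) m y) =
      y 0 * w 0 + ∑ i, y i.succ * w (idx1 p m i) := by
    intro m
    have := mform_update w (0 : Fin p → Fin (n + 1)) m y
    rw [Fin.sum_univ_succ] at this
    have h0 : Function.update (0 : Fin p → Fin (n + 1)) m 0 = 0 := by
      ext a; simp [Function.update_apply]
    rw [h0] at this
    exact this
  unfold dform
  simp only [h, Finset.sum_add_distrib, Finset.mul_sum]
  rw [Finset.sum_comm]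
  simp

theorem forall_dform_pole_iff (hp : 0 < p) (w : Tens p n) :
    (∀ y, pole n ⬝ᵥ y = 0 → dform w (pole n) y = 0) ↔ (bmat p n).mulVec w = 0 := by
  have hp' : (0 : ℝ) < √(p : ℝ) := by positivity
  simp only [pole, single_one_dotProduct]
  change (∀ y : Fin (n + 1) → ℝ, y 0 = 0 → dform w (pole n) y = 0) ↔ _
  simp only [dform_pole]
  constructor
  · intro h
    ext i
    rw [bmat_mulVec]
    have := h (Matrix.vecCons 0 (Pi.single i 1)) (by simp)
    simp [Pi.single_apply] at this
    simp [this]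
  · intro h y hy
    rw [hy]
    have : ∀ i, ∑ m, w (idx1 p m i) = 0 := by
      intro i
      have := congrFun h i
      rw [bmat_mulVec] at this
      simpa [hp'.ne'] using this
    simp [this]

theorem hrefl_pole (s : Fin n → ℝ) :
    (hrefl s).mulVec (pole n) = pole n - (2 / (1 + s ⬝ᵥ s)) • hvec s := by
  rw [hrefl_mulVec]
  simp [pole, hvec]

theorem hrefl_pole_injective : Function.Injective fun s : Fin n → ℝ => (hrefl s).mulVec (pole n) := by
  intro s t h
  simp only [hrefl_pole] at h
  have h0 := congrFun h 0
  have hq := one_add_dot_pos s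
  have hr := one_add_dot_pos t
  simp [pole, hvec] at h0
  ext i
  have hi := congrFun h i.succ
  simp [pole, hvec] at hi
  rw [h0] at hi
  have : 2 / (1 + t ⬝ᵥ t) ≠ 0 := by positivity
  exact mul_left_cancel₀ this hi

theorem exists_hrefl_pole {x : Fin (n + 1) → ℝ} (hx : x ⬝ᵥ x = 1) (hne : x ≠ pole n) :
    ∃ s, (hrefl s).mulVec (pole n) = x := by
  have hsum : x 0 * x 0 + ∑ i : Fin n, x i.succ * x i.succ = 1 := by
    rw [← hx, dotProduct, Fin.sum_univ_succ]
  have hS : 0 ≤ ∑ i : Fin n, x i.succ * x i.succ := Finset.sum_nonneg fun _ _ => mul_self_nonneg _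
  have h0 : x 0 ≠ 1 := by
    intro h
    apply hne
    rw [h] at hsum
    have h2 : ∑ i : Fin n, x i.succ * x i.succ = 0 := by linarith
    rw [Finset.sum_eq_zero_iff_of_nonneg fun _ _ => mul_self_nonneg _] at h2
    ext i
    refine Fin.cases ?_ (fun i => ?_) i
    · simpa [pole] using h
    · simpa [pole] using h2 i (Finset.mem_univ _)
  have h1 : 1 - x 0 ≠ 0 := sub_ne_zero.2 h0.symm
  refine ⟨fun i => -x i.succ / (1 - x 0), ?_⟩
  have hq : 1 + (fun i : Fin n => -x i.succ / (1 - x 0)) ⬝ᵥ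
      (fun i : Fin n => -x i.succ / (1 - x 0)) = 2 / (1 - x 0) := by
    have : (fun i : Fin n => -x i.succ / (1 - x 0)) ⬝ᵥ
      (fun i : Fin n => -x i.succ / (1 - x 0)) =
        (∑ i : Fin n, x i.succ * x i.succ) / (1 - x 0) ^ 2 := by
      rw [dotProduct, Finset.sum_div]
      exact Finset.sum_congr rfl fun i _ => by field_simp
    rw [this, eq_div_iff h1]
    have e : (1 - x 0) ^ 2 ≠ 0 := pow_ne_zero 2 h1
    have e2 : ∑ i : Fin n, x i.succ * x i.succ = (1 - x 0) * (1 + x 0) := by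
      linear_combination hsum
    rw [e2]
    field_simp
    ring
  rw [hrefl_pole, hq]
  ext i
  refine Fin.cases ?_ (fun i => ?_) i
  · simp [pole, hvec]
  · simp [pole, hvec]
    field_simp

theorem crtSet_eq_image (hp : 3 ≤ p) (g : (k : ℕ) → (Fin k → Fin (n + 1)) → ℝ) (η : ℝ)
    (hg : (bmat p n).mulVec (g p) ≠ 0) :
    crtSet (n + 1) p (pureC p) g η =
      (fun v : Tens p n => √((n + 1 : ℕ) : ℝ) • (hrefl ((bmat p n).mulVec v)).mulVec (pole n)) ''
        {v | v ∈ {v : Tens p n | √((n + 1 : ℕ) : ℝ) * η ≤ v 0} ∧ Psi v = g p} := by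
  have hp0 : 0 < p := by omega
  set R := √((n + 1 : ℕ) : ℝ) with hR
  have hRpos : 0 < R := by positivity
  have hRR : R * R = ((n + 1 : ℕ) : ℝ) := Real.mul_self_sqrt (by positivity)
  have hcrit : ∀ x : Fin (n + 1) → ℝ, IsCritPt (n + 1) p (pureC p) g (R • x) ↔
      x ⬝ᵥ x = 1 ∧ ∀ y, x ⬝ᵥ y = 0 → dform (g p) x y = 0 := by
    intro x
    rw [isCritPt_iff hp, ← hRR]
    refine and_congr ?_ ⟨fun h y hy => ?_, fun h y hy => ?_⟩
    · simp only [smul_dotProduct, dotProduct_smul, smul_eq_mul]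
      constructor
      · intro h
        have : R * R * (x ⬝ᵥ x) = R * R * 1 := by linarith
        exact mul_left_cancel₀ (by positivity) this
      · intro h; rw [h]; ring
    · have := h (R • y) (by simp [hy])
      rw [dform_smul] at this
      simpa [hRpos.ne'] using this
    · have h2 : x ⬝ᵥ (R⁻¹ • y) = 0 := by
        simp only [smul_dotProduct, smul_eq_mul, mul_eq_zero, hRpos.ne', false_or] at hy
        simp [hy]
      have h3 := dform_smul (g p) R x (R⁻¹ • y)
      rw [h _ h2, smul_smul, mul_inv_cancel₀ hRpos.ne', one_smul] at h3
      simpa using h3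
  have hs : ∀ s : Fin n → ℝ, (∀ y, (hrefl s).mulVec (pole n) ⬝ᵥ y = 0 →
      dform (g p) ((hrefl s).mulVec (pole n)) y = 0) ↔
        (bmat p n).mulVec ((tmap p (hrefl s)).mulVec (g p)) = 0 := by
    intro s
    rw [← forall_dform_pole_iff hp0]
    constructor
    · intro h y hy
      rw [dform_tmap]
      exact h _ (by rw [hrefl_dot, hy])
    · intro h y hy
      have := h ((hrefl s).mulVec y) (by
        rw [← hrefl_dot s, hrefl_mulVec_mulVec, hy])
      rwa [dform_tmap, hrefl_mulVec_mulVec] at this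
  have hH : ∀ s : Fin n → ℝ, ((n + 1 : ℕ) : ℝ) * η ≤
      hamiltonian (n + 1) p (pureC p) g (R • (hrefl s).mulVec (pole n)) ↔
        R * η ≤ ((tmap p (hrefl s)).mulVec (g p)) 0 := by
    intro s
    rw [hamiltonian_pure hp, mform_smul (g p) R (fun _ => (hrefl s).mulVec (pole n))]
    have h1 : mform (g p) (fun _ => (hrefl s).mulVec (pole n)) =
        ((tmap p (hrefl s)).mulVec (g p)) 0 := by
      rw [← mform_single ((tmap p (hrefl s)).mulVec (g p)) (0 : Fin p → Fin (n + 1)), mform_tmap]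
      simp only [vecMul_hrefl]
      rfl
    have h2 : ((n + 1 : ℕ) : ℝ) ^ (-(((p : ℝ) - 1) / 2)) * R ^ p = R := by
      rw [hR, Real.sqrt_eq_rpow, ← Real.rpow_natCast, ← Real.rpow_mul (by positivity),
        ← Real.rpow_add (by positivity)]
      congr 1
      ring
    rw [h1, ← mul_assoc, h2, ← hRR, mul_assoc, mul_le_mul_iff_right₀ hRpos]
  have hunit : ∀ s : Fin n → ℝ,
      (hrefl s).mulVec (pole n) ⬝ᵥ (hrefl s).mulVec (pole n) = 1 := by
    intro s; rw [hrefl_dot]; simp [pole]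
  ext σ
  constructor
  · rintro ⟨hc, he⟩
    obtain ⟨x, rfl⟩ : ∃ x, R • x = σ := ⟨R⁻¹ • σ, by simp [smul_smul, hRpos.ne']⟩
    obtain ⟨hx, hc⟩ := (hcrit x).1 hc
    have hne : x ≠ pole n := by
      rintro rfl
      exact hg ((forall_dform_pole_iff hp0 _).1 hc)
    obtain ⟨s, rfl⟩ := exists_hrefl_pole hx hne
    rw [hs] at hc
    rw [hH] at he
    set w := (tmap p (hrefl s)).mulVec (g p) with hw
    have hb : (bmat p n).mulVec (w + (bmat p n).transpose.mulVec s) = s := by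
      rw [Matrix.mulVec_add, hc, zero_add, Matrix.mulVec_mulVec, bmat_mul_transpose hp0,
        Matrix.one_mulVec]
    have hbp : bproj (w + (bmat p n).transpose.mulVec s) = w := by
      rw [bproj, hb, add_sub_cancel_right]
    refine ⟨w + (bmat p n).transpose.mulVec s, ⟨?_, ?_⟩, ?_⟩
    · change R * η ≤ _
      rw [← bproj_zero (w + _), hbp]; exact he
    · rw [Psi, hb, hbp, hw, tmap_hrefl_mulVec_mulVec]
    · simp only [hb]
  · rintro ⟨v, ⟨hv0, hv⟩, rfl⟩
    have hw : (tmap p (hrefl ((bmat p n).mulVec v))).mulVec (g p) = bproj v := by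
      rw [← hv, Psi, tmap_hrefl_mulVec_mulVec]
    refine ⟨(hcrit _).2 ⟨hunit _, ?_⟩, ?_⟩
    · rw [hs, hw, bmat_bproj hp0]
    · rw [hH, hw, bproj_zero]; exact hv0

theorem ecount_crtSet (hp : 3 ≤ p) (g : (k : ℕ) → (Fin k → Fin (n + 1)) → ℝ) (η : ℝ)
    (hg : (bmat p n).mulVec (g p) ≠ 0) :
    ecount (crtSet (n + 1) p (pureC p) g η) =
      ecount {v | v ∈ {v : Tens p n | √((n + 1 : ℕ) : ℝ) * η ≤ v 0} ∧ Psi v = g p} := by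
  rw [crtSet_eq_image hp g η hg, ecount_image_of_injOn]
  rintro v ⟨-, hv⟩ v' ⟨-, hv'⟩ h
  have hRpos : 0 < √((n + 1 : ℕ) : ℝ) := by positivity
  have h1 : (bmat p n).mulVec v = (bmat p n).mulVec v' :=
    hrefl_pole_injective (smul_right_injective _ hRpos.ne' h)
  have h2 : bproj v = bproj v' := by
    rw [← tmap_hrefl_mulVec_mulVec ((bmat p n).mulVec v) (bproj v)]
    conv_rhs => rw [← tmap_hrefl_mulVec_mulVec ((bmat p n).mulVec v') (bproj v')]
    change (tmap p (hrefl ((bmat p n).mulVec v))).mulVec (Psi v) =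
      (tmap p (hrefl ((bmat p n).mulVec v'))).mulVec (Psi v')
    rw [hv, hv', h1]
  unfold bproj at h2
  rw [h1] at h2
  exact sub_left_injective h2

theorem ae_bmat_ne_zero (hp : 0 < p) (hn : 0 < n) :
    ∀ᵐ w ∂(stdG (Fin p → Fin (n + 1))), (bmat p n).mulVec w ≠ 0 := by
  have h := map_stdG_mulVec (bmat p n) (bmat_mul_transpose hp)
  have : Nonempty (Fin n) := ⟨⟨0, hn⟩⟩
  have h0 : (stdG (Fin n)) {0} = 0 := by
    have : NullSingletonClass (gaussianReal 0 1) := nullSingletonClass_gaussianReal one_ne_zero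
    have := Measure.pi_singleton (fun _ : Fin n => gaussianReal 0 1) 0
    rw [this]
    simp [hn.ne']
  rw [← h, Measure.map_apply continuous_bmat_mulVec.measurable (measurableSet_singleton _)] at h0
  rw [ae_iff]
  convert h0 using 2
  ext w; simp

theorem lintegral_ecount_crtSet {Ω : Type*} [MeasureSpace Ω]
    (hp : 3 ≤ p) (hn : 0 < n) (G : Ω → (k : ℕ) → (Fin k → Fin (n + 1)) → ℝ)
    (hG : StdGaussianCouplings (n + 1) p G) (η : ℝ) :
    ∫⁻ ω, ecount (crtSet (n + 1) p (pureC p) (G ω) η) ∂ℙ =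
      ENNReal.ofReal (√((p : ℝ) - 1) ^ n) * krConst n *
        ∫⁻ z in Set.Ici (√((n + 1 : ℕ) : ℝ) * η),
          absDet n (√((p : ℝ) / (p - 1)) * z) ∂(gaussianReal 0 1) := by
  have hpmem : p ∈ Finset.Icc 2 p := Finset.mem_Icc.2 ⟨by omega, le_rfl⟩
  unfold StdGaussianCouplings at hG
  have hae : AEMeasurable (fun ω => flatten (n + 1) p (G ω)) ℙ := by
    by_contra h
    rw [Measure.map_of_not_aemeasurable h] at hG
    exact (IsProbabilityMeasure.ne_zero (Measure.pi fun _ : GIdx (n + 1) p => gaussianReal 0 1))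
      hG.symm
  let φ : (Fin p → Fin (n + 1)) → GIdx (n + 1) p := fun j => ⟨⟨p, hpmem⟩, j⟩
  have hφ : Function.Injective φ := fun j k h => by simpa [φ] using h
  have hmap : (ℙ : Measure Ω).map (fun ω => G ω p) = stdG (Fin p → Fin (n + 1)) := by
    rw [← map_stdG_comp φ hφ]
    change _ = Measure.map _ (Measure.pi fun _ : GIdx (n + 1) p => gaussianReal 0 1)
    rw [← hG, AEMeasurable.map_map_of_aemeasurable
      (measurable_pi_lambda _ fun k => measurable_pi_apply _).aemeasurable hae]
    rfl
  have hae2 : AEMeasurable (fun ω => G ω p) (ℙ : Measure Ω) :=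
    (measurable_pi_lambda (fun (w : GIdx (n + 1) p → ℝ) k => w (φ k))
      fun k => measurable_pi_apply _).comp_aemeasurable hae
  have hA : MeasurableSet {v : Tens p n | √((n + 1 : ℕ) : ℝ) * η ≤ v 0} :=
    measurableSet_le measurable_const (measurable_pi_apply _)
  rw [← lintegral_kac_rice hp, ← hmap, lintegral_map' (by
    rw [hmap]; exact (area_Psi (by omega) hA).1) hae2]
  refine lintegral_congr_ae ?_
  have h1 := ae_bmat_ne_zero (p := p) (n := n) (by omega) hn
  rw [← hmap] at h1
  filter_upwards [ae_of_ae_map hae2 h1] with ω hω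
  exact ecount_crtSet hp (G ω) η hω

end

theorem lintegral_rpow_mul_exp {a r : ℝ} (ha : 0 < a) (hr : 0 < r) :
    ∫⁻ t in Set.Ioi (0 : ℝ), ENNReal.ofReal (t ^ (a - 1) * Real.exp (-(r * t))) =
      ENNReal.ofReal (Real.Gamma a / r ^ a) := by
  have h := Real.integral_rpow_mul_exp_neg_mul_Ioi ha hr
  have hpos : 0 < (1 / r) ^ a * Real.Gamma a := by
    have := Real.Gamma_pos_of_pos ha
    positivity
  rw [← ofReal_integral_eq_lintegral_ofReal, h, one_div, Real.inv_rpow hr.le]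
  · congr 1; field_simp
  · refine not_imp_comm.1 integral_undef ?_
    rw [h]; exact hpos.ne'
  · filter_upwards [self_mem_ae_restrict measurableSet_Ioi] with t ht
    have : (0 : ℝ) < t := ht
    positivity

theorem lintegral_exp_dot (n : ℕ) {t : ℝ} (ht : 0 < t) :
    ∫⁻ s : Fin n → ℝ, ENNReal.ofReal (Real.exp (-(t * (s ⬝ᵥ s)))) =
      ENNReal.ofReal (√(Real.pi / t) ^ n) := by
  have h : ∀ s : Fin n → ℝ, Real.exp (-(t * (s ⬝ᵥ s))) = ∏ i, Real.exp (-t * s i ^ 2) := by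
    intro s
    rw [← Real.exp_sum, dotProduct, Finset.mul_sum, ← Finset.sum_neg_distrib]
    congr 1
    exact Finset.sum_congr rfl fun i _ => by ring
  simp only [h]
  rw [← ofReal_integral_eq_lintegral_ofReal, integral_fintype_prod_volume_eq_pow
    (fun x : ℝ => Real.exp (-t * x ^ 2)), integral_gaussian, Fintype.card_fin]
  · exact Integrable.fintype_prod fun i => integrable_exp_neg_mul_sq ht
  · exact ae_of_all _ fun s => Finset.prod_nonneg fun i _ => (Real.exp_pos _).le

theorem krConst_eq {n : ℕ} (hn : 0 < n) :
    krConst n = ENNReal.ofReal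
      (√2 ^ n * Real.Gamma ((n : ℝ) / 2) / Real.Gamma n) := by
  have hn' : (0 : ℝ) < n := by exact_mod_cast hn
  have hG := Real.Gamma_pos_of_pos hn'
  set c : ℝ := (√(2 * Real.pi))⁻¹ ^ n * 2 ^ n / Real.Gamma n with hc
  have hc0 : 0 ≤ c := by positivity
  have hd := measurable_gdens (Fin n)
  have h1 : krConst n = ∫⁻ s : Fin n → ℝ, ∫⁻ t in Set.Ioi (0 : ℝ),
      ENNReal.ofReal (c * (t ^ ((n : ℝ) - 1) * Real.exp (-((1 + s ⬝ᵥ s) * t)))) := by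
    unfold krConst
    rw [stdG_eq_withDensity, lintegral_withDensity_eq_lintegral_mul]
    · refine lintegral_congr fun s => ?_
      have hq := one_add_dot_pos s
      simp only [ENNReal.ofReal_mul hc0]
      rw [lintegral_const_mul _ (by fun_prop), lintegral_rpow_mul_exp hn' hq,
        ← ENNReal.ofReal_mul hc0]
      simp only [Pi.mul_apply]
      rw [← ENNReal.ofReal_mul (by positivity), Fintype.card_fin]
      congr 1
      have e : Real.exp (-(s ⬝ᵥ s) / 2) * Real.exp (s ⬝ᵥ s / 2) = 1 := by
        rw [← Real.exp_add]; simp; ring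
      rw [hc, Real.rpow_natCast, div_pow]
      field_simp
      rw [← e]
      ring_nf
    · exact hd
    · have := (continuous_dot_self (ι := Fin n)).measurable
      fun_prop
  rw [h1, lintegral_lintegral_swap]
  · have h2 : ∀ t ∈ Set.Ioi (0 : ℝ), ∫⁻ s : Fin n → ℝ,
        ENNReal.ofReal (c * (t ^ ((n : ℝ) - 1) * Real.exp (-((1 + s ⬝ᵥ s) * t)))) =
        ENNReal.ofReal (c * √Real.pi ^ n) *
          ENNReal.ofReal (t ^ ((n : ℝ) / 2 - 1) * Real.exp (-(1 * t))) := by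
      intro t ht
      have ht : 0 < t := ht
      have e : ∀ s : Fin n → ℝ, c * (t ^ ((n : ℝ) - 1) * Real.exp (-((1 + s ⬝ᵥ s) * t))) =
          (c * t ^ ((n : ℝ) - 1) * Real.exp (-t)) * Real.exp (-(t * (s ⬝ᵥ s))) := by
        intro s
        rw [mul_assoc, mul_assoc, ← Real.exp_add]
        congr 3; ring
      have hm : Measurable fun s : Fin n → ℝ => ENNReal.ofReal (Real.exp (-(t * (s ⬝ᵥ s)))) := by
        have := (continuous_dot_self (ι := Fin n)).measurable
        fun_prop
      simp only [e]
      simp only [ENNReal.ofReal_mul (p := c * t ^ ((n : ℝ) - 1) * Real.exp (-t))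
        (by positivity)]
      rw [lintegral_const_mul _ hm, lintegral_exp_dot n ht, ← ENNReal.ofReal_mul (by positivity),
        ← ENNReal.ofReal_mul (by positivity)]
      congr 1
      have e2 : t ^ ((n : ℝ) - 1) = t ^ ((n : ℝ) / 2 - 1) * √t ^ n := by
        rw [Real.sqrt_eq_rpow, ← Real.rpow_natCast, ← Real.rpow_mul ht.le, ← Real.rpow_add ht]
        congr 1; ring
      rw [Real.sqrt_div Real.pi_pos.le, div_pow, e2, one_mul]
      have : 0 < √t := Real.sqrt_pos.2 ht
      field_simp
    rw [setLIntegral_congr_fun measurableSet_Ioi h2, lintegral_const_mul _ (by fun_prop),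
      lintegral_rpow_mul_exp (by positivity) one_pos, ← ENNReal.ofReal_mul (by positivity),
      Real.one_rpow, div_one]
    congr 1
    rw [hc]
    have e3 : (√(2 * Real.pi))⁻¹ ^ n * 2 ^ n * √Real.pi ^ n = √2 ^ n := by
      rw [← mul_pow, ← mul_pow]
      congr 1
      rw [Real.sqrt_mul (by norm_num)]
      have : 0 < √Real.pi := Real.sqrt_pos.2 Real.pi_pos
      have h2 : √2 * √2 = 2 := Real.mul_self_sqrt (by norm_num)
      field_simp
      linear_combination -h2
    rw [← e3]
    ring
  · have := (continuous_dot_self (ι := Fin n)).measurable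
    refine Measurable.aemeasurable ?_
    simp only [Function.uncurry_def]
    fun_prop

theorem krConst_bounds {n : ℕ} (hn : 4 ≤ n) :
    ∃ A : ℝ, 0 < A ∧ krConst n = ENNReal.ofReal A ∧ 1 ≤ A ^ 2 * n.factorial ∧
      A ^ 2 * n.factorial ≤ 4 * n := by
  have hn0 : 0 < n := by omega
  have hn' : (4 : ℝ) ≤ n := by exact_mod_cast hn
  set x : ℝ := (n : ℝ) / 2 with hx
  have hx2 : 2 ≤ x := by rw [hx]; linarith
  have hG := Real.Gamma_pos_of_pos (s := (n : ℝ)) (by linarith)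
  have hGx := Real.Gamma_pos_of_pos (s := x) (by linarith)
  have hGh := Real.Gamma_pos_of_pos (s := x + 1 / 2) (by linarith)
  have hL := Real.Gamma_mul_Gamma_add_half x
  have h2x : 2 * x = n := by rw [hx]; ring
  rw [h2x] at hL
  have hm := Real.Gamma_strictMonoOn_Ici.monotoneOn
  have h1 : Real.Gamma x ≤ Real.Gamma (x + 1 / 2) :=
    hm (Set.mem_Ici.2 hx2) (Set.mem_Ici.2 (by linarith)) (by linarith)
  have h2 : Real.Gamma (x + 1 / 2) ≤ x * Real.Gamma x := by
    rw [← Real.Gamma_add_one (by linarith)]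
    exact hm (Set.mem_Ici.2 (by linarith)) (Set.mem_Ici.2 (by linarith)) (by linarith)
  have hf : (n.factorial : ℝ) = n * Real.Gamma n := by
    rw [← Real.Gamma_add_one (by linarith), Real.Gamma_nat_eq_factorial]
  have hpi : 1 ≤ √Real.pi := by
    rw [Real.one_le_sqrt]; linarith [Real.pi_gt_three]
  have hpi2 : √Real.pi ≤ 2 := by
    rw [Real.sqrt_le_left (by norm_num)]; linarith [Real.pi_lt_four]
  have hpow : (2 : ℝ) ^ (1 - (n : ℝ)) = 2 / 2 ^ n := by
    rw [Real.rpow_sub (by norm_num), Real.rpow_one, Real.rpow_natCast]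
  rw [hpow] at hL
  have hs : (√2 ^ n) ^ 2 = (2 : ℝ) ^ n := by
    rw [← pow_mul, mul_comm n 2, pow_mul, Real.sq_sqrt (by norm_num)]
  have key : (√2 ^ n * Real.Gamma x / Real.Gamma n) ^ 2 * n.factorial * Real.Gamma (x + 1 / 2) =
      2 * √Real.pi * n * Real.Gamma x := by
    rw [hf, div_pow, mul_pow, hs]
    field_simp
    field_simp at hL
    linear_combination hL
  refine ⟨_, by positivity, krConst_eq hn0, ?_, ?_⟩
  · refine le_of_mul_le_mul_right ?_ hGh
    rw [key, one_mul]
    refine h2.trans (mul_le_mul_of_nonneg_right ?_ hGx.le)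
    nlinarith
  · refine le_of_mul_le_mul_right ?_ hGh
    rw [key]
    have : 2 * √Real.pi * n ≤ 4 * n := by nlinarith
    exact mul_le_mul this h1 hGx.le (by positivity)

/-- Functions given by polynomials in the coordinates. -/
def IsPolyFun {ι : Type*} (f : (ι → ℝ) → ℝ) : Prop :=
  ∃ P : MvPolynomial ι ℝ, ∀ x, f x = MvPolynomial.eval x P

namespace IsPolyFun
variable {ι κ : Type*} {f g : (ι → ℝ) → ℝ}

theorem const (c : ℝ) : IsPolyFun fun _ : ι → ℝ => c := ⟨MvPolynomial.C c, by simp⟩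

theorem coord (i : ι) : IsPolyFun fun x : ι → ℝ => x i := ⟨MvPolynomial.X i, by simp⟩

theorem add (hf : IsPolyFun f) (hg : IsPolyFun g) : IsPolyFun fun x => f x + g x := by
  obtain ⟨P, hP⟩ := hf
  obtain ⟨Q, hQ⟩ := hg
  exact ⟨P + Q, by simp [hP, hQ]⟩

theorem sub (hf : IsPolyFun f) (hg : IsPolyFun g) : IsPolyFun fun x => f x - g x := by
  obtain ⟨P, hP⟩ := hf
  obtain ⟨Q, hQ⟩ := hg
  exact ⟨P - Q, by simp [hP, hQ]⟩

theorem mul (hf : IsPolyFun f) (hg : IsPolyFun g) : IsPolyFun fun x => f x * g x := by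
  obtain ⟨P, hP⟩ := hf
  obtain ⟨Q, hQ⟩ := hg
  exact ⟨P * Q, by simp [hP, hQ]⟩

theorem pow (hf : IsPolyFun f) (k : ℕ) : IsPolyFun fun x => f x ^ k := by
  obtain ⟨P, hP⟩ := hf
  exact ⟨P ^ k, by simp [hP]⟩

theorem sum {α : Type*} (t : Finset α) {F : α → (ι → ℝ) → ℝ} (hF : ∀ a, IsPolyFun (F a)) :
    IsPolyFun fun x => ∑ a ∈ t, F a x := by
  choose P hP using hF
  exact ⟨∑ a ∈ t, P a, by simp [hP]⟩

theorem det {m : Type*} [Fintype m] [DecidableEq m] {M : (ι → ℝ) → Matrix m m ℝ}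
    (hM : ∀ i j, IsPolyFun fun x => M x i j) : IsPolyFun fun x => (M x).det := by
  choose P hP using hM
  refine ⟨(Matrix.of P).det, fun x => ?_⟩
  rw [RingHom.map_det]
  refine congrArg Matrix.det ?_
  ext i j
  simpa using hP i j x

theorem comp (hf : IsPolyFun f) {T : (κ → ℝ) → ι → ℝ} (hT : ∀ i, IsPolyFun fun y => T y i) :
    IsPolyFun fun y => f (T y) := by
  obtain ⟨P, hP⟩ := hf
  choose Q hQ using hT
  refine ⟨MvPolynomial.bind₁ Q P, fun y => ?_⟩
  change f (T y) = _
  rw [hP, MvPolynomial.eval, MvPolynomial.eval, MvPolynomial.eval₂Hom_bind₁]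
  refine congrArg (fun z => MvPolynomial.eval₂Hom (RingHom.id ℝ) z P) ?_
  ext i
  simpa using hQ i y

theorem continuous (hf : IsPolyFun f) : Continuous f := by
  obtain ⟨P, hP⟩ := hf
  rw [funext hP]
  exact MvPolynomial.continuous_eval P

end IsPolyFun

theorem integrable_pow_gaussianReal (k : ℕ) :
    Integrable (fun x : ℝ => x ^ k) (gaussianReal 0 1) := by
  have h := memLp_id_gaussianReal (μ := 0) (v := 1) (k : ℝ≥0)
  have := h.integrable_norm_pow'
  refine (integrable_norm_iff (by fun_prop)).1 ?_
  simpa using this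

theorem integrable_monomial {ι : Type*} [Fintype ι] (d : ι → ℕ) :
    Integrable (fun x : ι → ℝ => ∏ i, x i ^ d i) (stdG ι) :=
  Integrable.fintype_prod fun i => integrable_pow_gaussianReal (d i)

theorem IsPolyFun.integrable {ι : Type*} [Fintype ι] {f : (ι → ℝ) → ℝ} (hf : IsPolyFun f) :
    Integrable f (stdG ι) := by
  obtain ⟨P, hP⟩ := hf
  rw [funext hP]
  simp only [MvPolynomial.eval_eq']
  exact integrable_finsetSum _ fun d _ => (integrable_monomial fun i => d i).const_mul _

theorem integrable_eval_gaussianReal (P : Polynomial ℝ) :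
    Integrable (fun x : ℝ => P.eval x) (gaussianReal 0 1) := by
  simp only [Polynomial.eval_eq_sum_range]
  exact integrable_finsetSum _ fun k _ => (integrable_pow_gaussianReal k).const_mul _

theorem hasDerivAt_gaussianPDFReal (x : ℝ) :
    HasDerivAt (gaussianPDFReal 0 1) (-x * gaussianPDFReal 0 1 x) x := by
  have h : HasDerivAt (fun y : ℝ => -(y - 0) ^ 2 / (2 * ((1 : ℝ≥0) : ℝ))) (-x) x := by
    have := ((((hasDerivAt_id x).sub_const 0).pow 2).neg).div_const (2 * ((1 : ℝ≥0) : ℝ))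
    refine this.congr_deriv ?_
    simp
    ring
  have h2 := (h.exp).const_mul (√(2 * Real.pi * ((1 : ℝ≥0) : ℝ)))⁻¹
  refine h2.congr_deriv ?_
  simp only [gaussianPDFReal]
  ring

theorem integrable_eval_mul_gaussianPDFReal (P : Polynomial ℝ) :
    Integrable (fun x : ℝ => P.eval x * gaussianPDFReal 0 1 x) := by
  have h := integrable_eval_gaussianReal P
  rw [gaussianReal_of_var_ne_zero _ one_ne_zero,
    integrable_withDensity_iff (measurable_gaussianPDF 0 1) (by simp [gaussianPDF])] at h
  simpa [gaussianPDF, ENNReal.toReal_ofReal (gaussianPDFReal_nonneg _ _ _)] using h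

theorem integral_gaussianReal_mul (f : ℝ → ℝ) :
    ∫ x, f x ∂(gaussianReal 0 1) = ∫ x, f x * gaussianPDFReal 0 1 x := by
  rw [integral_gaussianReal_eq_integral_smul one_ne_zero]
  simp [mul_comm]

theorem stein_polynomial (P : Polynomial ℝ) :
    ∫ x, x * P.eval x ∂(gaussianReal 0 1) = ∫ x, P.derivative.eval x ∂(gaussianReal 0 1) := by
  have hd : ∀ x, HasDerivAt (fun x => P.eval x * gaussianPDFReal 0 1 x)
      (P.derivative.eval x * gaussianPDFReal 0 1 x +
        P.eval x * (-x * gaussianPDFReal 0 1 x)) x := fun x =>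
    (P.hasDerivAt x).mul (hasDerivAt_gaussianPDFReal x)
  have h1 := integrable_eval_mul_gaussianPDFReal P.derivative
  have h2 := integrable_eval_mul_gaussianPDFReal (Polynomial.X * P)
  have h2' : Integrable (fun x : ℝ => P.eval x * (-x * gaussianPDFReal 0 1 x)) := by
    refine h2.neg.congr (ae_of_all _ fun x => ?_)
    simp; ring
  have h := integral_eq_zero_of_hasDerivAt_of_integrable hd (h1.add h2')
    (integrable_eval_mul_gaussianPDFReal P)
  rw [integral_add h1 h2'] at h
  rw [integral_gaussianReal_mul, integral_gaussianReal_mul]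
  have e : ∫ x, P.eval x * (-x * gaussianPDFReal 0 1 x) =
      -∫ x, x * P.eval x * gaussianPDFReal 0 1 x := by
    rw [← integral_neg]
    refine integral_congr_ae (ae_of_all _ fun x => ?_)
    simp only; ring
  linarith

theorem integral_pow_gaussianReal (k : ℕ) :
    ∫ x, x ^ (k + 2) ∂(gaussianReal 0 1) = (k + 1) * ∫ x, x ^ k ∂(gaussianReal 0 1) := by
  have h := stein_polynomial (Polynomial.X ^ (k + 1))
  simp only [Polynomial.eval_pow, Polynomial.eval_X, Polynomial.derivative_X_pow,
    Polynomial.eval_mul, Nat.add_sub_cancel, Polynomial.eval_C] at h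
  rw [integral_const_mul] at h
  rw [← Nat.cast_add_one, ← h]
  refine integral_congr_ae (ae_of_all _ fun x => ?_)
  simp only; ring

theorem integral_sq_gaussianReal : ∫ x, x ^ 2 ∂(gaussianReal 0 1) = 1 := by
  simpa using integral_pow_gaussianReal 0

theorem integral_pow_four_gaussianReal : ∫ x, x ^ 4 ∂(gaussianReal 0 1) = 3 := by
  have := integral_pow_gaussianReal 2
  norm_num [integral_sq_gaussianReal] at this
  exact this

section
variable (n : ℕ)

theorem integral_sq_mul_sq (i j : Fin n) :
    ∫ v, v i ^ 2 * v j ^ 2 ∂(stdG (Fin n)) = if i = j then 3 else 1 := by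
  by_cases h : i = j
  · subst h
    have := integral_comp_eval (μ := fun _ : Fin n => gaussianReal 0 1) (i := i)
      (f := fun x : ℝ => x ^ 4) (by fun_prop)
    rw [if_pos rfl, ← integral_pow_four_gaussianReal, ← this]
    refine integral_congr_ae (ae_of_all _ fun v => ?_)
    simp only; ring
  · have e : ∀ v : Fin n → ℝ, v i ^ 2 * v j ^ 2 =
        ∏ k, v k ^ ((if k = i then 2 else 0) + if k = j then 2 else 0) := by
      intro v
      simp only [pow_add, Finset.prod_mul_distrib]
      simp [pow_ite]
    simp only [e]
    rw [integral_fintype_prod_eq_prod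
      (f := fun k (x : ℝ) => x ^ ((if k = i then 2 else 0) + if k = j then 2 else 0)), if_neg h]
    refine Finset.prod_eq_one fun k _ => ?_
    by_cases h1 : k = i
    · subst h1
      simp [h, integral_sq_gaussianReal]
    · by_cases h2 : k = j
      · subst h2; simp [h1, integral_sq_gaussianReal]
      · simp [h1, h2]

theorem isPolyFun_dot : IsPolyFun fun v : Fin n → ℝ => v ⬝ᵥ v :=
  IsPolyFun.sum _ fun i => (IsPolyFun.coord i).mul (IsPolyFun.coord i)

theorem integral_dot : ∫ v, v ⬝ᵥ v ∂(stdG (Fin n)) = n := by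
  simp only [dotProduct]
  rw [integral_finsetSum _ fun i _ => ((IsPolyFun.coord i).mul (IsPolyFun.coord i)).integrable]
  have : ∀ i : Fin n, ∫ v, v i * v i ∂(stdG (Fin n)) = 1 := by
    intro i
    have := integral_comp_eval (μ := fun _ : Fin n => gaussianReal 0 1) (i := i)
      (f := fun x : ℝ => x ^ 2) (by fun_prop)
    rw [← integral_sq_gaussianReal, ← this]
    refine integral_congr_ae (ae_of_all _ fun v => ?_)
    simp only; ring
  simp [this]

theorem integral_dot_sq : ∫ v, (v ⬝ᵥ v) ^ 2 ∂(stdG (Fin n)) = n * (n + 2) := by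
  have e : ∀ v : Fin n → ℝ, (v ⬝ᵥ v) ^ 2 = ∑ i, ∑ j, v i ^ 2 * v j ^ 2 := by
    intro v
    simp only [dotProduct, sq, Finset.sum_mul_sum]
  have hp : ∀ i j : Fin n, IsPolyFun fun v : Fin n → ℝ => v i ^ 2 * v j ^ 2 := fun i j =>
    ((IsPolyFun.coord i).pow 2).mul ((IsPolyFun.coord j).pow 2)
  simp only [e]
  rw [integral_finsetSum _ fun i _ => (IsPolyFun.sum _ fun j => hp i j).integrable]
  simp_rw [integral_finsetSum _ fun j _ => (hp _ j).integrable, integral_sq_mul_sq]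
  have : ∀ i : Fin n, ∑ j, (if i = j then (3 : ℝ) else 1) = n + 2 := by
    intro i
    have h : ∀ j, (if i = j then (3 : ℝ) else 1) = 1 + if i = j then 2 else 0 := by
      intro j; split_ifs <;> norm_num
    simp [h, Finset.sum_add_distrib]
  simp only [this]
  simp
  ring

end

section bordered
variable {m n : ℕ}

/-- The block matrix with upper left entry `c`, first row `u`, first column `v` and lower right
block `B`. -/
def bordered (c : ℝ) (u v : Fin n → ℝ) (B : Matrix (Fin n) (Fin n) ℝ) :
    Matrix (Fin (n + 1)) (Fin (n + 1)) ℝ :=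
  Matrix.of (Fin.cons (Fin.cons c u) fun i => Fin.cons (v i) (B i))

theorem bordered_mul (c d : ℝ) (u v s t : Fin n → ℝ) (A B : Matrix (Fin n) (Fin n) ℝ) :
    bordered c u v A * bordered d s t B =
      bordered (c * d + u ⬝ᵥ t) (c • s + Matrix.vecMul u B) (d • v + A.mulVec t)
        (Matrix.vecMulVec v s + A * B) := by
  ext i j
  rw [Matrix.mul_apply, Fin.sum_univ_succ]
  refine Fin.cases ?_ (fun i => ?_) i <;> refine Fin.cases ?_ (fun j => ?_) j <;>
    simp [bordered, dotProduct, Matrix.mulVec, Matrix.vecMul, Matrix.mul_apply,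
      Matrix.vecMulVec_apply, mul_comm]

theorem det_bordered_pole (c r : ℝ) (B : Matrix (Fin (m + 1)) (Fin (m + 1)) ℝ) :
    (bordered c (r • pole m) (r • pole m) B).det =
      c * B.det - r ^ 2 * (B.submatrix Fin.succ Fin.succ).det := by
  rw [Matrix.det_succ_row_zero, Fin.sum_univ_succ, Fin.sum_univ_succ]
  have h0 : ∀ i : Fin m, bordered c (r • pole m) (r • pole m) B 0 i.succ.succ = 0 := by
    intro i; simp [bordered, pole]
  have h1 : bordered c (r • pole m) (r • pole m) B 0 0 = c := by simp [bordered]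
  have h2 : bordered c (r • pole m) (r • pole m) B 0 (Fin.succ 0) = r := by
    simp only [bordered, Matrix.of_apply, Fin.cons_zero, Fin.cons_succ]; simp [pole]
  have h3 : ((bordered c (r • pole m) (r • pole m) B).submatrix Fin.succ
      (Fin.succAbove 0)) = B := by
    ext i j; simp [bordered]
  have h4 : ((bordered c (r • pole m) (r • pole m) B).submatrix Fin.succ
      (Fin.succAbove (Fin.succ 0))).det = r * (B.submatrix Fin.succ Fin.succ).det := by
    rw [Matrix.det_succ_column_zero, Fin.sum_univ_succ]
    have g0 : ∀ i : Fin m, ((bordered c (r • pole m) (r • pole m) B).submatrix Fin.succ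
      (Fin.succAbove (Fin.succ 0))) i.succ 0 = 0 := by
      intro i; simp [bordered, pole]
    have g1 : ((bordered c (r • pole m) (r • pole m) B).submatrix Fin.succ
      (Fin.succAbove (Fin.succ 0))) 0 0 = r := by
      simp [bordered, pole]
    have g2 : (((bordered c (r • pole m) (r • pole m) B).submatrix Fin.succ
      (Fin.succAbove (Fin.succ 0))).submatrix (Fin.succAbove 0) Fin.succ) =
        B.submatrix Fin.succ Fin.succ := by
      ext i j
      have : Fin.succAbove (1 : Fin (m + 2)) j.succ = j.succ.succ := by
        rw [Fin.succAbove_of_lt_succ _ _ (by simp [Fin.lt_def])]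
      simp [bordered, this]
    simp only [g0, g1, g2]
    simp
  simp only [h0, h1, h2, h3, h4]
  simp
  ring

theorem exists_orthogonal_mulVec_eq (v : Fin (m + 1) → ℝ) :
    ∃ U : Matrix (Fin (m + 1)) (Fin (m + 1)) ℝ, U * U = 1 ∧ U.transpose = U ∧
      U.mulVec v = √(v ⬝ᵥ v) • pole m := by
  have hnn : 0 ≤ v ⬝ᵥ v := Finset.sum_nonneg fun i _ => mul_self_nonneg _
  by_cases hv : v ⬝ᵥ v = 0
  · refine ⟨1, by simp, by simp, ?_⟩
    have : v = 0 := dotProduct_self_eq_zero.1 hv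
    simp [this]
  have hr : 0 < √(v ⬝ᵥ v) := Real.sqrt_pos.2 (lt_of_le_of_ne hnn (Ne.symm hv))
  set r := √(v ⬝ᵥ v) with hrdef
  have hr2 : r * r = v ⬝ᵥ v := Real.mul_self_sqrt hnn
  have hx : (r⁻¹ • v) ⬝ᵥ (r⁻¹ • v) = 1 := by
    rw [smul_dotProduct, dotProduct_smul, ← hr2]
    simp only [smul_eq_mul]
    field_simp
  have hvr : v = r • (r⁻¹ • v) := by
    rw [smul_smul, mul_inv_cancel₀ hr.ne', one_smul]
  by_cases hp : r⁻¹ • v = pole m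
  · refine ⟨1, by simp, by simp, ?_⟩
    rw [Matrix.one_mulVec, ← hp]
    exact hvr
  · obtain ⟨s, hs⟩ := exists_hrefl_pole hx hp
    refine ⟨hrefl s, hrefl_mul_self s, hrefl_transpose s, ?_⟩
    conv_lhs => rw [hvr]
    rw [Matrix.mulVec_smul, ← hs, hrefl_mulVec_mulVec]

theorem det_bordered_conj (c : ℝ) (v : Fin n → ℝ) (B U : Matrix (Fin n) (Fin n) ℝ)
    (hU : U * U = 1) (hUT : U.transpose = U) :
    (bordered c v v B).det = (bordered c (U.mulVec v) (U.mulVec v) (U * B * U)).det := by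
  have h : bordered 1 0 0 U * bordered c v v B * bordered 1 0 0 U =
      bordered c (U.mulVec v) (U.mulVec v) (U * B * U) := by
    have : Matrix.vecMul v U = U.mulVec v := by
      rw [← Matrix.mulVec_transpose, hUT]
    simp [bordered_mul, this]
  have h1 : bordered 1 0 0 U * bordered 1 0 0 U = 1 := by
    rw [bordered_mul]
    ext i j
    refine Fin.cases ?_ (fun i => ?_) i <;> refine Fin.cases ?_ (fun j => ?_) j <;>
      simp [bordered, hU, Matrix.one_apply, Fin.succ_ne_zero, eq_comm (a := (0 : Fin (n+1)))]
  have h2 : (bordered 1 0 0 U).det * (bordered 1 0 0 U).det = 1 := by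
    rw [← Matrix.det_mul, h1, Matrix.det_one]
  rw [← h, Matrix.det_mul, Matrix.det_mul, mul_right_comm, h2, one_mul]

end bordered

section goe
variable {m n : ℕ}

/-- The lower right minor. -/
def lowerMinor (X : Fin (n + 1) × Fin (n + 1) → ℝ) : Fin n × Fin n → ℝ :=
  fun y => X (y.1.succ, y.2.succ)

theorem continuous_lowerMinor : Continuous (lowerMinor (n := n)) :=
  continuous_pi fun _ => continuous_apply _

theorem submatrix_smul_one_sub_goe (x : ℝ) (X : Fin (n + 1) × Fin (n + 1) → ℝ) :
    (x • 1 - goe X).submatrix Fin.succ Fin.succ = x • 1 - goe (lowerMinor X) := by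
  ext i j
  simp [goe, lowerMinor, Matrix.one_apply]

theorem smul_one_sub_goe_eq_bordered (x : ℝ) (X : Fin (n + 1) × Fin (n + 1) → ℝ) :
    x • 1 - goe X = bordered (x - √2 * X (0, 0))
      (-fun j => (X (0, j.succ) + X (j.succ, 0)) / √2)
      (-fun j => (X (0, j.succ) + X (j.succ, 0)) / √2) (x • 1 - goe (lowerMinor X)) := by
  ext i j
  have h2 : √2 * √2 = (2 : ℝ) := Real.mul_self_sqrt (by norm_num)
  refine Fin.cases ?_ (fun i => ?_) i <;> refine Fin.cases ?_ (fun j => ?_) j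
  · simp [bordered, goe, -Real.div_sqrt]
    field_simp
    rw [sq, h2]; ring
  · simp [bordered, goe, eq_comm (a := (0 : Fin (n+1)))]
  · simp [bordered, goe, add_comm]
  · simp [bordered, goe, Matrix.one_apply, lowerMinor]

/-- Conjugation of the matrix with entries `X` by a symmetric matrix `U`. -/
def conjBy (U : Matrix (Fin n) (Fin n) ℝ) (X : Fin n × Fin n → ℝ) : Fin n × Fin n → ℝ :=
  (Matrix.kronecker U U).mulVec X

theorem goe_conjBy (U : Matrix (Fin n) (Fin n) ℝ) (hUT : U.transpose = U)
    (X : Fin n × Fin n → ℝ) : goe (conjBy U X) = U * goe X * U := by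
  have hs : ∀ i j, U i j = U j i := fun i j => by
    conv_lhs => rw [← hUT]
    rfl
  ext i j
  simp only [goe, conjBy, Matrix.of_apply, Matrix.mulVec, dotProduct, Matrix.mul_apply,
    Fintype.sum_prod_type, Finset.sum_mul]
  rw [add_div, Finset.sum_div, Finset.sum_div]
  simp_rw [Finset.sum_div]
  conv_lhs => rw [Finset.sum_comm]
  rw [← Finset.sum_add_distrib]
  refine Finset.sum_congr rfl fun k _ => ?_
  rw [← Finset.sum_add_distrib]
  refine Finset.sum_congr rfl fun l _ => ?_
  rw [hs k j]
  change U i l * U j k * X (l, k) / √2 + U j k * U i l * X (k, l) / √2 = _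
  ring

theorem map_stdG_conjBy (U : Matrix (Fin n) (Fin n) ℝ) (hU : U * U = 1) (hUT : U.transpose = U) :
    (stdG (Fin n × Fin n)).map (conjBy U) = stdG (Fin n × Fin n) := by
  refine map_stdG_mulVec _ ?_
  have : (Matrix.kronecker U U).transpose = Matrix.kronecker U U := by
    conv_rhs => rw [← hUT]
    exact (Matrix.kroneckerMap_transpose _ _ _)
  rw [this]
  have h := Matrix.mul_kronecker_mul U U U U
  rw [hU, Matrix.one_kronecker_one] at h
  exact h.symm

theorem continuous_conjBy (U : Matrix (Fin n) (Fin n) ℝ) : Continuous (conjBy U) := by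
  unfold conjBy
  fun_prop

/-- Averaging over the lower right block, a bordered determinant may be replaced by its
value when the border is a multiple of the first basis vector. -/
theorem integral_bordered_goe (x c : ℝ) (v : Fin (m + 1) → ℝ) (F : ℝ → ℝ → ℝ)
    (hF : Continuous fun y : ℝ × ℝ => F y.1 y.2) :
    ∫ Y, F (dgoe x Y) (bordered c v v (x • 1 - goe Y)).det ∂(stdG (Fin (m + 1) × Fin (m + 1))) =
      ∫ Y, F (dgoe x Y) (c * dgoe x Y - v ⬝ᵥ v * dgoe x (lowerMinor Y))
        ∂(stdG (Fin (m + 1) × Fin (m + 1))) := by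
  obtain ⟨U, hU, hUT, hv⟩ := exists_orthogonal_mulVec_eq v
  have hnn : 0 ≤ v ⬝ᵥ v := Finset.sum_nonneg fun i _ => mul_self_nonneg _
  have hd : ∀ y : Fin (m + 1) × Fin (m + 1) → ℝ,
      U * (x • 1 - goe y) * U = x • 1 - goe (conjBy U y) := by
    intro y
    rw [goe_conjBy U hUT, Matrix.mul_sub, Matrix.sub_mul]
    simp [hU]
  have hc : Continuous fun Y : Fin (m + 1) × Fin (m + 1) → ℝ => dgoe x Y :=
    continuous_dgoe.comp (Continuous.prodMk_right x)
  have hc2 : Continuous fun Y : Fin (m + 1) × Fin (m + 1) → ℝ => dgoe x (lowerMinor Y) :=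
    (continuous_dgoe.comp (Continuous.prodMk_right x)).comp continuous_lowerMinor
  have hcont : Continuous fun Y : Fin (m + 1) × Fin (m + 1) → ℝ =>
      F (dgoe x Y) (c * dgoe x Y - v ⬝ᵥ v * dgoe x (lowerMinor Y)) :=
    hF.comp (hc.prodMk ((hc.const_mul c).sub (hc2.const_mul _)))
  conv_rhs => rw [← map_stdG_conjBy U hU hUT,
    integral_map (continuous_conjBy U).aemeasurable hcont.aestronglyMeasurable]
  refine integral_congr_ae (ae_of_all _ fun Y => ?_)
  have h1 : dgoe x Y = dgoe x (conjBy U Y) := by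
    rw [dgoe, dgoe, ← hd, Matrix.det_mul, Matrix.det_mul, mul_right_comm, ← Matrix.det_mul, hU]
    simp
  simp only
  rw [h1, det_bordered_conj c v _ U hU hUT, hv, det_bordered_pole, hd, Real.sq_sqrt hnn,
    submatrix_smul_one_sub_goe]
  rfl

end goe

section blocks
variable {m n : ℕ}

/-- The number of matrix entries averaged in each coordinate of the block decomposition. -/
def blockSize {n : ℕ} : Unit ⊕ (Fin n ⊕ (Fin n × Fin n)) → ℕ
  | .inl _ => 1
  | .inr (.inl _) => 2
  | .inr (.inr _) => 1

/-- The matrix entries averaged in each coordinate of the block decomposition. -/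
def blockIdx : (k : Unit ⊕ (Fin n ⊕ (Fin n × Fin n))) → Fin (blockSize k) →
    Fin (n + 1) × Fin (n + 1)
  | .inl _ => fun _ => (0, 0)
  | .inr (.inl j) => fun a : Fin 2 => if a = 0 then (0, j.succ) else (j.succ, 0)
  | .inr (.inr y) => fun _ => (y.1.succ, y.2.succ)

/-- Corner entry, symmetrised border and lower right minor of a matrix. -/
def blocks (X : Fin (n + 1) × Fin (n + 1) → ℝ) : ℝ × (Fin n → ℝ) × (Fin n × Fin n → ℝ) :=
  (X (0, 0), fun j => (X (0, j.succ) + X (j.succ, 0)) / √2, lowerMinor X)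

theorem continuous_blocks : Continuous (blocks (n := n)) := by
  refine Continuous.prodMk (by fun_prop) (Continuous.prodMk ?_ continuous_lowerMinor)
  fun_prop

theorem map_blocks : (stdG (Fin (n + 1) × Fin (n + 1))).map blocks =
    (gaussianReal 0 1).prod ((stdG (Fin n)).prod (stdG (Fin n × Fin n))) := by
  have instN : ∀ k : Unit ⊕ (Fin n ⊕ (Fin n × Fin n)), Nonempty (Fin (blockSize k)) := by
    rintro (u | j | y)
    · exact ⟨(0 : Fin 1)⟩
    · exact ⟨(0 : Fin 2)⟩
    · exact ⟨(0 : Fin 1)⟩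
  have hf : Function.Injective fun x : Σ k : Unit ⊕ (Fin n ⊕ (Fin n × Fin n)),
      Fin (blockSize k) => blockIdx x.1 x.2 := by
    rintro ⟨u | j | y, a⟩ ⟨u' | j' | y', a'⟩ h <;> simp only [blockIdx] at h
    · obtain rfl : a = a' := Subsingleton.elim (α := Fin 1) a a'
      rfl
    · split_ifs at h <;> simp [Fin.ext_iff] at h
    · simp [Fin.ext_iff] at h
    · split_ifs at h <;> simp [Fin.ext_iff] at h
    · change Fin 2 at a a'
      fin_cases a <;> fin_cases a' <;> simp [Fin.ext_iff] at h
      · obtain rfl := Fin.ext h; rfl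
      · obtain rfl := Fin.ext h; rfl
    · split_ifs at h <;> simp [Fin.ext_iff] at h
    · simp [Fin.ext_iff] at h
    · split_ifs at h <;> simp [Fin.ext_iff] at h
    · obtain rfl : y = y' := by
        simp only [Prod.mk.injEq, Fin.succ_inj] at h
        exact Prod.ext h.1 h.2
      obtain rfl : a = a' := Subsingleton.elim (α := Fin 1) a a'
      rfl
  have hmap := map_stdG_sums (fun k : Unit ⊕ (Fin n ⊕ (Fin n × Fin n)) => Fin (blockSize k))
    blockIdx hf
  have h1 := measurePreserving_sumPiEquivProdPi
    (fun _ : Unit ⊕ (Fin n ⊕ (Fin n × Fin n)) => gaussianReal 0 1)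
  have h2 := measurePreserving_sumPiEquivProdPi
    (fun _ : Fin n ⊕ (Fin n × Fin n) => gaussianReal 0 1)
  have h3 := measurePreserving_funUnique (gaussianReal 0 1) Unit
  have h4 := (h3.prod h2).comp h1
  have hm : Measurable fun (w : Fin (n + 1) × Fin (n + 1) → ℝ)
      (k : Unit ⊕ (Fin n ⊕ (Fin n × Fin n))) =>
      (√(Fintype.card (Fin (blockSize k)) : ℝ))⁻¹ * ∑ a, w (blockIdx k a) := by
    refine measurable_pi_lambda _ fun k => ?_
    exact measurable_const.mul (Finset.measurable_sum _ fun a _ => measurable_pi_apply _)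
  have h5 : MeasurePreserving (fun (w : Fin (n + 1) × Fin (n + 1) → ℝ)
      (k : Unit ⊕ (Fin n ⊕ (Fin n × Fin n))) =>
      (√(Fintype.card (Fin (blockSize k)) : ℝ))⁻¹ * ∑ a, w (blockIdx k a))
      (stdG _) (stdG _) := ⟨hm, hmap⟩
  have h6 := h4.comp h5
  rw [← h6.map_eq]
  congr 1
  ext X j
  · change _ = (√(Fintype.card (Fin 1) : ℝ))⁻¹ * ∑ a : Fin 1, X (0, 0)
    simp [blocks]
  · change _ = (√(Fintype.card (Fin 2) : ℝ))⁻¹ * ∑ a : Fin 2, X (if a = 0 then _ else _)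
    simp [blocks]
    ring
  · change _ = (√(Fintype.card (Fin 1) : ℝ))⁻¹ * ∑ a : Fin 1, X (j.1.succ, j.2.succ)
    simp [blocks, lowerMinor]

theorem dgoe_eq_bordered (x : ℝ) (X : Fin (n + 1) × Fin (n + 1) → ℝ) :
    dgoe x X = (bordered (x - √2 * (blocks X).1) (-(blocks X).2.1) (-(blocks X).2.1)
      (x • 1 - goe (blocks X).2.2)).det := by
  rw [dgoe, smul_one_sub_goe_eq_bordered]
  rfl

theorem isPolyFun_dgoe (x : ℝ) : IsPolyFun fun X : Fin n × Fin n → ℝ => dgoe x X := by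
  refine IsPolyFun.det fun i j => ?_
  simp only [goe, Matrix.sub_apply, Matrix.of_apply, div_eq_mul_inv]
  exact (IsPolyFun.const _).sub
    (((IsPolyFun.coord _).add (IsPolyFun.coord _)).mul (IsPolyFun.const _))

theorem isPolyFun_dgoe_lowerMinor (x : ℝ) :
    IsPolyFun fun X : Fin (n + 1) × Fin (n + 1) → ℝ => dgoe x (lowerMinor X) :=
  (isPolyFun_dgoe x).comp fun _ => IsPolyFun.coord _

theorem map_lowerMinor : (stdG (Fin (n + 1) × Fin (n + 1))).map lowerMinor =
    stdG (Fin n × Fin n) :=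
  map_stdG_comp (fun y : Fin n × Fin n => (y.1.succ, y.2.succ)) fun y z h => by
    simp only [Prod.mk.injEq, Fin.succ_inj] at h
    exact Prod.ext h.1 h.2

theorem integral_lowerMinor {f : (Fin n × Fin n → ℝ) → ℝ} (hf : Continuous f) :
    ∫ X, f (lowerMinor X) ∂(stdG (Fin (n + 1) × Fin (n + 1))) = ∫ Y, f Y ∂(stdG _) := by
  rw [← map_lowerMinor (n := n),
    integral_map continuous_lowerMinor.aemeasurable hf.aestronglyMeasurable]

/-- Integration of a monomial in a GOE determinant and its minor, one border at a time. -/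
theorem integral_dgoe_succ (x : ℝ) (i j : ℕ) :
    ∫ X, dgoe x X ^ i * dgoe x (lowerMinor X) ^ j ∂(stdG (Fin (m + 2) × Fin (m + 2))) =
      ∫ a, ∫ v : Fin (m + 1) → ℝ, ∫ Y, ((x - √2 * a) * dgoe x Y -
        v ⬝ᵥ v * dgoe x (lowerMinor Y)) ^ i * dgoe x Y ^ j
        ∂(stdG (Fin (m + 1) × Fin (m + 1))) ∂(stdG (Fin (m + 1))) ∂(gaussianReal 0 1) := by
  let f : ℝ × (Fin (m + 1) → ℝ) × (Fin (m + 1) × Fin (m + 1) → ℝ) → ℝ := fun y =>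
    (bordered (x - √2 * y.1) (-y.2.1) (-y.2.1) (x • 1 - goe y.2.2)).det ^ i * dgoe x y.2.2 ^ j
  have hfc : Continuous f := by
    refine Continuous.mul (Continuous.pow (Continuous.matrix_det ?_) _) (Continuous.pow ?_ _)
    · refine continuous_matrix fun k l => ?_
      have hg : Continuous fun y : ℝ × (Fin (m + 1) → ℝ) × (Fin (m + 1) × Fin (m + 1) → ℝ) =>
        x • (1 : Matrix (Fin (m + 1)) (Fin (m + 1)) ℝ) - goe y.2.2 :=
        continuous_const.sub (continuous_goe.comp (by fun_prop))
      refine Fin.cases ?_ (fun k => ?_) k <;> refine Fin.cases ?_ (fun l => ?_) l <;>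
        simp only [bordered, Matrix.of_apply, Fin.cons_zero, Fin.cons_succ]
      · fun_prop
      · fun_prop
      · fun_prop
      · exact hg.matrix_elem k l
    · exact continuous_dgoe.comp (continuous_const.prodMk continuous_snd.snd)
  have hfX : ∀ X, dgoe x X ^ i * dgoe x (lowerMinor X) ^ j = f (blocks X) := by
    intro X
    simp only [f]
    rw [← dgoe_eq_bordered]
    rfl
  have hint : Integrable f ((gaussianReal 0 1).prod
      ((stdG (Fin (m + 1))).prod (stdG (Fin (m + 1) × Fin (m + 1))))) := by
    rw [← map_blocks, integrable_map_measure hfc.aestronglyMeasurable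
      continuous_blocks.aemeasurable]
    refine (((isPolyFun_dgoe x).pow i).mul ((isPolyFun_dgoe_lowerMinor x).pow j)).integrable.congr
      (ae_of_all _ fun X => hfX X)
  simp_rw [hfX]
  rw [← integral_map (φ := blocks) (f := f) continuous_blocks.aemeasurable
    hfc.aestronglyMeasurable, map_blocks, integral_prod _ hint]
  refine integral_congr_ae ?_
  filter_upwards [hint.prod_right_ae] with a ha
  rw [integral_prod _ ha]
  refine integral_congr_ae (ae_of_all _ fun v => ?_)
  simp only [f]
  have h := integral_bordered_goe x (x - √2 * a) (-v) (fun s t => t ^ i * s ^ j) (by fun_prop)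
  simpa using h

end blocks

section moments
variable {m n : ℕ}

/-- First moment of the shifted GOE determinant. -/
def mom1 (n : ℕ) (x : ℝ) : ℝ := ∫ X, dgoe x X ∂(stdG (Fin n × Fin n))

/-- Second moment of the shifted GOE determinant. -/
def mom2 (n : ℕ) (x : ℝ) : ℝ := ∫ X, dgoe x X ^ 2 ∂(stdG (Fin n × Fin n))

/-- Mixed moment of the shifted GOE determinant and its minor. -/
def momx (n : ℕ) (x : ℝ) : ℝ :=
  ∫ X, dgoe x X * dgoe x (lowerMinor X) ∂(stdG (Fin (n + 1) × Fin (n + 1)))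

theorem integral_linear_comb {α : Type*} [MeasurableSpace α] {μ : Measure α} {f g h : α → ℝ}
    (hf : Integrable f μ) (hg : Integrable g μ) (hh : Integrable h μ) (a b c : ℝ) :
    ∫ x, (a * f x + b * g x + c * h x) ∂μ = a * ∫ x, f x ∂μ + b * ∫ x, g x ∂μ + c * ∫ x, h x ∂μ := by
  have h1 : Integrable (fun x => a * f x + b * g x) μ := (hf.const_mul a).add (hg.const_mul b)
  rw [integral_add h1 (hh.const_mul c), integral_add (hf.const_mul a) (hg.const_mul b),
    integral_const_mul, integral_const_mul, integral_const_mul]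

theorem integral_stdG_affine (n : ℕ) (a b : ℝ) :
    ∫ v, (a - v ⬝ᵥ v * b) ∂(stdG (Fin n)) = a - n * b := by
  rw [integral_sub (integrable_const _) ((isPolyFun_dot n).integrable.mul_const b),
    integral_mul_const, integral_dot]
  simp

theorem integral_gaussianReal_id : ∫ x, x ∂(gaussianReal 0 1) = 0 := by simp

theorem integrable_id_gaussianReal' : Integrable (fun x : ℝ => x) (gaussianReal 0 1) := by
  simpa using integrable_pow_gaussianReal 1

theorem integral_gaussian_affine (x a b : ℝ) :
    ∫ t, ((x - √2 * t) * a - b) ∂(gaussianReal 0 1) = x * a - b := by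
  have h : Integrable (fun t : ℝ => (x - √2 * t) * a) (gaussianReal 0 1) :=
    ((integrable_const x).sub (integrable_id_gaussianReal'.const_mul √2)).mul_const a
  rw [integral_sub h (integrable_const _), integral_mul_const,
    integral_sub (integrable_const _) (integrable_id_gaussianReal'.const_mul √2),
    integral_const_mul, integral_gaussianReal_id]
  simp

theorem mom1_succ_succ (m : ℕ) (x : ℝ) :
    mom1 (m + 2) x = x * mom1 (m + 1) x - (m + 1) * mom1 m x := by
  have h := integral_dgoe_succ (m := m) x 1 0
  simp only [pow_one, pow_zero, mul_one] at h
  rw [mom1, h]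
  have i1 := (isPolyFun_dgoe (n := m + 1) x).integrable
  have i2 := (isPolyFun_dgoe_lowerMinor (n := m) x).integrable
  have e : ∀ a (v : Fin (m + 1) → ℝ), ∫ Y, ((x - √2 * a) * dgoe x Y -
        v ⬝ᵥ v * dgoe x (lowerMinor Y)) ∂(stdG (Fin (m + 1) × Fin (m + 1))) =
      (x - √2 * a) * mom1 (m + 1) x - v ⬝ᵥ v * mom1 m x := by
    intro a v
    rw [integral_sub (i1.const_mul _) (i2.const_mul _), integral_const_mul, integral_const_mul,
      integral_lowerMinor (f := fun Y => dgoe x Y) (isPolyFun_dgoe x).continuous]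
    rfl
  simp_rw [e, integral_stdG_affine, integral_gaussian_affine]
  push_cast
  ring

theorem momx_succ (m : ℕ) (x : ℝ) :
    momx (m + 1) x = x * mom2 (m + 1) x - (m + 1) * momx m x := by
  have h := integral_dgoe_succ (m := m) x 1 1
  simp only [pow_one] at h
  rw [momx, h]
  have i1 := ((isPolyFun_dgoe (n := m + 1) x).pow 2).integrable
  have i2 := ((isPolyFun_dgoe (n := m + 1) x).mul (isPolyFun_dgoe_lowerMinor (n := m) x)).integrable
  have e : ∀ a (v : Fin (m + 1) → ℝ), ∫ Y, ((x - √2 * a) * dgoe x Y -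
        v ⬝ᵥ v * dgoe x (lowerMinor Y)) * dgoe x Y ∂(stdG (Fin (m + 1) × Fin (m + 1))) =
      (x - √2 * a) * mom2 (m + 1) x - v ⬝ᵥ v * momx m x := by
    intro a v
    rw [mom2, momx, ← integral_const_mul, ← integral_const_mul,
      ← integral_sub (i1.const_mul _) (i2.const_mul _)]
    refine integral_congr_ae (ae_of_all _ fun Y => ?_)
    simp only; ring
  simp_rw [e, integral_stdG_affine, integral_gaussian_affine]
  push_cast
  ring

theorem mom2_succ_succ (m : ℕ) (x : ℝ) :
    mom2 (m + 2) x = (x ^ 2 + 2) * mom2 (m + 1) x - 2 * x * (m + 1) * momx m x +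
      (m + 1) * (m + 3) * mom2 m x := by
  have h := integral_dgoe_succ (m := m) x 2 0
  simp only [pow_zero, mul_one] at h
  rw [mom2, h]
  have i1 := ((isPolyFun_dgoe (n := m + 1) x).pow 2).integrable
  have i2 := ((isPolyFun_dgoe (n := m + 1) x).mul (isPolyFun_dgoe_lowerMinor (n := m) x)).integrable
  have i3 := ((isPolyFun_dgoe_lowerMinor (n := m) x).pow 2).integrable
  have e : ∀ a (v : Fin (m + 1) → ℝ), ∫ Y, ((x - √2 * a) * dgoe x Y -
        v ⬝ᵥ v * dgoe x (lowerMinor Y)) ^ 2 ∂(stdG (Fin (m + 1) × Fin (m + 1))) =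
      (x - √2 * a) ^ 2 * mom2 (m + 1) x - v ⬝ᵥ v * (2 * (x - √2 * a) * momx m x) +
        (v ⬝ᵥ v) ^ 2 * mom2 m x := by
    intro a v
    rw [mom2, momx, mom2, ← integral_lowerMinor (f := fun Y => dgoe x Y ^ 2) (n := m)
      ((isPolyFun_dgoe x).pow 2).continuous]
    have := integral_linear_comb i1 i2 i3 ((x - √2 * a) ^ 2) (-(v ⬝ᵥ v * (2 * (x - √2 * a))))
      ((v ⬝ᵥ v) ^ 2)
    refine Eq.trans (integral_congr_ae (ae_of_all _ fun Y => ?_)) (this.trans ?_)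
    · simp only; ring
    · ring
  have e2 : ∀ a, ∫ v : Fin (m + 1) → ℝ, ((x - √2 * a) ^ 2 * mom2 (m + 1) x -
      v ⬝ᵥ v * (2 * (x - √2 * a) * momx m x) + (v ⬝ᵥ v) ^ 2 * mom2 m x) ∂(stdG (Fin (m + 1))) =
      (x - √2 * a) ^ 2 * mom2 (m + 1) x - (m + 1) * (2 * (x - √2 * a) * momx m x) +
        (m + 1) * (m + 3) * mom2 m x := by
    intro a
    have j1 := (isPolyFun_dot (m + 1)).integrable
    have j2 := ((isPolyFun_dot (m + 1)).pow 2).integrable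
    have := integral_linear_comb (integrable_const (1 : ℝ)) j1 j2 ((x - √2 * a) ^ 2 * mom2 (m + 1) x)
      (-(2 * (x - √2 * a) * momx m x)) (mom2 m x)
    rw [integral_dot, integral_dot_sq] at this
    refine Eq.trans (integral_congr_ae (ae_of_all _ fun Y => ?_)) (this.trans ?_)
    · simp only; ring
    · simp
      ring
  simp_rw [e, e2]
  have h2 : √2 ^ 2 = (2 : ℝ) := Real.sq_sqrt (by norm_num)
  have := integral_linear_comb (integrable_pow_gaussianReal 2) integrable_id_gaussianReal'
    (integrable_const (1 : ℝ)) (2 * mom2 (m + 1) x)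
    (-(2 * x * √2 * mom2 (m + 1) x - 2 * (m + 1) * √2 * momx m x))
    (x ^ 2 * mom2 (m + 1) x - 2 * x * (m + 1) * momx m x + (m + 1) * (m + 3) * mom2 m x)
  rw [integral_sq_gaussianReal, integral_gaussianReal_id] at this
  refine Eq.trans (integral_congr_ae (ae_of_all _ fun a => ?_)) (this.trans ?_)
  · have : (x - √2 * a) ^ 2 = x ^ 2 - 2 * x * √2 * a + 2 * a ^ 2 := by
      linear_combination a ^ 2 * h2
    simp only [this]
    ring
  · simp
    ring

theorem dgoe_zero (x : ℝ) (X : Fin 0 × Fin 0 → ℝ) : dgoe x X = 1 := by simp [dgoe]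

theorem dgoe_one (x : ℝ) (X : Fin 1 × Fin 1 → ℝ) : dgoe x X = x - √2 * X (0, 0) := by
  have h2 : √2 * √2 = (2 : ℝ) := Real.mul_self_sqrt (by norm_num)
  simp [dgoe, goe]
  field_simp
  rw [sq, h2]; ring

theorem mom1_zero (x : ℝ) : mom1 0 x = 1 := by simp [mom1, dgoe_zero, stdG]

theorem mom2_zero (x : ℝ) : mom2 0 x = 1 := by simp [mom2, dgoe_zero, stdG]

theorem integral_stdG_one {f : ℝ → ℝ} (hf : Continuous f) :
    ∫ X, f (X (0, 0)) ∂(stdG (Fin 1 × Fin 1)) = ∫ x, f x ∂(gaussianReal 0 1) :=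
  integral_comp_eval (μ := fun _ : Fin 1 × Fin 1 => gaussianReal 0 1) (i := (0, 0))
    hf.aestronglyMeasurable

theorem mom1_one (x : ℝ) : mom1 1 x = x := by
  simp_rw [mom1, dgoe_one]
  rw [integral_stdG_one (f := fun t => x - √2 * t) (by fun_prop)]
  simpa using integral_gaussian_affine x 1 0

theorem momx_zero (x : ℝ) : momx 0 x = x := by
  simp_rw [momx, dgoe_zero, mul_one]
  exact mom1_one x

theorem mom2_one (x : ℝ) : mom2 1 x = x ^ 2 + 2 := by
  simp_rw [mom2, dgoe_one]
  rw [integral_stdG_one (f := fun t => (x - √2 * t) ^ 2) (by fun_prop)]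
  have h2 : √2 ^ 2 = (2 : ℝ) := Real.sq_sqrt (by norm_num)
  have := integral_linear_comb (integrable_pow_gaussianReal 2) integrable_id_gaussianReal'
    (integrable_const (1 : ℝ)) 2 (-(2 * x * √2)) (x ^ 2)
  rw [integral_sq_gaussianReal, integral_gaussianReal_id] at this
  refine Eq.trans (integral_congr_ae (ae_of_all _ fun a => ?_)) (this.trans ?_)
  · have : (x - √2 * a) ^ 2 = x ^ 2 - 2 * x * √2 * a + 2 * a ^ 2 := by
      linear_combination a ^ 2 * h2
    simp only [this]
    ring
  · simp
    ring

end moments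

section hermite

/-- The probabilists' Hermite polynomials over `ℝ`. -/
def hermP (n : ℕ) : Polynomial ℝ := (Polynomial.hermite n).map (Int.castRingHom ℝ)

/-- The Hermite polynomials as functions. -/
def herm (n : ℕ) (x : ℝ) : ℝ := (hermP n).eval x

theorem hermP_zero : hermP 0 = 1 := by simp [hermP]

theorem hermP_succ (n : ℕ) :
    hermP (n + 1) = Polynomial.X * hermP n - Polynomial.derivative (hermP n) := by
  simp [hermP, Polynomial.hermite_succ, Polynomial.derivative_map]

theorem derivative_hermP_succ (n : ℕ) :
    Polynomial.derivative (hermP (n + 1)) = ((n : Polynomial ℝ) + 1) * hermP n := by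
  induction n with
  | zero => simp [hermP_succ, hermP_zero]
  | succ n ih =>
    rw [hermP_succ (n + 1), Polynomial.derivative_sub, Polynomial.derivative_mul, ih,
      Polynomial.derivative_X, Polynomial.derivative_mul, hermP_succ n]
    simp
    ring

theorem herm_zero (x : ℝ) : herm 0 x = 1 := by simp [herm, hermP_zero]

theorem herm_one (x : ℝ) : herm 1 x = x := by simp [herm, hermP_succ, hermP_zero]

theorem herm_succ_succ (n : ℕ) (x : ℝ) :
    herm (n + 2) x = x * herm (n + 1) x - (n + 1) * herm n x := by
  simp only [herm]
  rw [hermP_succ (n + 1), derivative_hermP_succ]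
  simp

theorem hasDerivAt_herm_succ (n : ℕ) (x : ℝ) :
    HasDerivAt (herm (n + 1)) ((n + 1) * herm n x) x := by
  have h := (hermP (n + 1)).hasDerivAt x
  rw [derivative_hermP_succ] at h
  refine h.congr_deriv ?_
  simp [herm]

theorem continuous_herm (n : ℕ) : Continuous (herm n) := (hermP n).continuous

theorem mom1_eq_herm (n : ℕ) (x : ℝ) : mom1 n x = herm n x := by
  induction n using Nat.twoStepInduction with
  | zero => rw [mom1_zero, herm_zero]
  | one => rw [mom1_one, herm_one]
  | more n h1 h2 => rw [mom1_succ_succ, herm_succ_succ, h1, h2]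

theorem integral_hermP_sq (n : ℕ) :
    ∫ x, herm n x ^ 2 ∂(gaussianReal 0 1) = n.factorial := by
  induction n with
  | zero => simp [herm_zero]
  | succ n ih =>
    have h := stein_polynomial (hermP n * hermP (n + 1))
    have i1 := integrable_eval_gaussianReal (Polynomial.X * (hermP n * hermP (n + 1)))
    have i2 := integrable_eval_gaussianReal (Polynomial.derivative (hermP n) * hermP (n + 1))
    have i3 := integrable_eval_gaussianReal (hermP n * hermP n)
    have e : ∀ x, herm (n + 1) x ^ 2 =
        (Polynomial.X * (hermP n * hermP (n + 1))).eval x -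
          (Polynomial.derivative (hermP n) * hermP (n + 1)).eval x := by
      intro x
      rw [← Polynomial.eval_sub, herm, sq, ← Polynomial.eval_mul]
      congr 1
      conv_lhs => rw [hermP_succ n]
      rw [hermP_succ n]
      ring
    simp_rw [e]
    rw [integral_sub i1 i2]
    simp only [Polynomial.eval_mul, Polynomial.eval_X] at h ⊢
    rw [h]
    have e2 : ∀ x, (Polynomial.derivative (hermP n * hermP (n + 1))).eval x =
        (Polynomial.derivative (hermP n) * hermP (n + 1)).eval x +
          (n + 1) * (hermP n * hermP n).eval x := by
      intro x
      rw [Polynomial.derivative_mul, derivative_hermP_succ]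
      simp
      ring
    simp_rw [e2]
    rw [integral_add i2 (i3.const_mul _), integral_const_mul]
    have : ∫ x, (hermP n * hermP n).eval x ∂(gaussianReal 0 1) = n.factorial := by
      rw [← ih]
      refine integral_congr_ae (ae_of_all _ fun x => ?_)
      simp [herm, sq]
    rw [this, Nat.factorial_succ]
    simp

/-- Christoffel–Darboux type kernel on the diagonal. -/
def hermKer (n : ℕ) (x : ℝ) : ℝ := ∑ m ∈ Finset.range (n + 1), herm m x ^ 2 / m.factorial

theorem hermKer_succ (n : ℕ) (x : ℝ) :
    hermKer (n + 1) x = hermKer n x + herm (n + 1) x ^ 2 / (n + 1).factorial :=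
  Finset.sum_range_succ _ _

/-- Shifted analogue of `hermKer`. -/
def hermKerX (n : ℕ) (x : ℝ) : ℝ :=
  ∑ m ∈ Finset.range (n + 1), herm (m + 1) x * herm m x / m.factorial

theorem hermKerX_succ (n : ℕ) (x : ℝ) :
    hermKerX (n + 1) x = hermKerX n x + herm (n + 2) x * herm (n + 1) x / (n + 1).factorial :=
  Finset.sum_range_succ _ _

theorem hermKer_identity (n : ℕ) (x : ℝ) :
    (n + 3) * (hermKer (n + 3) x - hermKer (n + 1) x) - (x ^ 2 + 1) * hermKer (n + 2) x +
      2 * x * hermKerX (n + 1) x = 0 := by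
  induction n with
  | zero =>
    simp [hermKer, hermKerX, Finset.sum_range_succ, herm_succ_succ, herm_zero, herm_one,
      Nat.factorial]
    ring
  | succ n ih =>
    have f3 : ((n + 3).factorial : ℝ) = (n + 3) * (n + 2).factorial := by
      rw [Nat.factorial_succ]; push_cast; ring
    have f4 : ((n + 4).factorial : ℝ) = (n + 4) * ((n + 3) * (n + 2).factorial) := by
      rw [Nat.factorial_succ, Nat.cast_mul, f3]; push_cast; ring
    have e2 : hermKer (n + 2) x = hermKer (n + 1) x + herm (n + 2) x ^ 2 / (n + 2).factorial :=
      hermKer_succ _ _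
    have e3 : hermKer (n + 3) x =
        hermKer (n + 2) x + herm (n + 3) x ^ 2 / ((n + 3) * (n + 2).factorial) := by
      rw [← f3]; exact hermKer_succ _ _
    have e4 : hermKer (n + 4) x = hermKer (n + 3) x +
        (x * herm (n + 3) x - (n + 3) * herm (n + 2) x) ^ 2 /
          ((n + 4) * ((n + 3) * (n + 2).factorial)) := by
      rw [← f4]
      have := herm_succ_succ (n + 2) x
      push_cast at this
      rw [show (n : ℝ) + 3 = n + 2 + 1 by ring, ← this]
      exact hermKer_succ _ _
    have ex : hermKerX (n + 2) x =
        hermKerX (n + 1) x + herm (n + 3) x * herm (n + 2) x / (n + 2).factorial :=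
      hermKerX_succ _ _
    change (((n + 1 : ℕ) : ℝ) + 3) * (hermKer (n + 4) x - hermKer (n + 2) x) -
      (x ^ 2 + 1) * hermKer (n + 3) x + 2 * x * hermKerX (n + 2) x = 0
    rw [e4, ex]
    rw [e3, e2] at ih ⊢
    push_cast
    have hf : ((n + 2 : ℕ).factorial : ℝ) ≠ 0 := by positivity
    have h3 : (n : ℝ) + 3 ≠ 0 := by positivity
    have h4 : (n : ℝ) + 4 ≠ 0 := by positivity
    generalize ((n + 2 : ℕ).factorial : ℝ) = f at *
    rw [show (n : ℝ) + 1 + 3 = n + 4 by ring]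
    field_simp at ih ⊢
    linear_combination ((n : ℝ) + 3) * ih

/-- Iterated sums of `hermKer`. -/
def hermKer2 (n : ℕ) (x : ℝ) : ℝ := ∑ m ∈ Finset.range (n + 1), hermKer m x

/-- Iterated sums of `hermKerX`. -/
def hermKerX2 (n : ℕ) (x : ℝ) : ℝ := ∑ m ∈ Finset.range (n + 1), hermKerX m x

theorem hermKer2_succ (n : ℕ) (x : ℝ) : hermKer2 (n + 1) x = hermKer2 n x + hermKer (n + 1) x :=
  Finset.sum_range_succ _ _

theorem hermKerX2_succ (n : ℕ) (x : ℝ) :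
    hermKerX2 (n + 1) x = hermKerX2 n x + hermKerX (n + 1) x :=
  Finset.sum_range_succ _ _

theorem hermKer2_identity (n : ℕ) (x : ℝ) :
    (n + 2) * hermKer2 (n + 2) x - (x ^ 2 + 2) * hermKer2 (n + 1) x + 2 * x * hermKerX2 n x -
      (n + 3) * hermKer2 n x = 0 := by
  induction n with
  | zero =>
    simp [hermKer2, hermKerX2, hermKer, hermKerX, Finset.sum_range_succ, herm_succ_succ,
      herm_zero, herm_one, Nat.factorial]
    ring
  | succ n ih =>
    have h := hermKer_identity n x
    have e3 : hermKer2 (n + 1 + 2) x = hermKer2 (n + 2) x + hermKer (n + 3) x := hermKer2_succ _ _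
    have e2 : hermKer2 (n + 1 + 1) x = hermKer2 (n + 1) x + hermKer (n + 2) x := hermKer2_succ _ _
    have e2' : hermKer2 (n + 2) x = hermKer2 (n + 1) x + hermKer (n + 2) x := hermKer2_succ _ _
    rw [e3, e2, hermKer2_succ, hermKerX2_succ]
    rw [e2', hermKer2_succ] at ih
    push_cast
    linear_combination ih + h

theorem hermKerX_add (n : ℕ) (x : ℝ) : hermKerX (n + 1) x + hermKerX n x = x * hermKer (n + 1) x := by
  induction n with
  | zero =>
    simp [hermKer, hermKerX, Finset.sum_range_succ, herm_succ_succ,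
      herm_zero, herm_one, Nat.factorial]
    ring
  | succ n ih =>
    have f2 : ((n + 2).factorial : ℝ) = (n + 2) * (n + 1).factorial := by
      rw [Nat.factorial_succ]; push_cast; ring
    have h := herm_succ_succ (n + 1) x
    have e1 : hermKerX (n + 1 + 1) x = hermKerX (n + 1) x +
        herm (n + 3) x * herm (n + 2) x / (n + 2).factorial := hermKerX_succ _ _
    have e2 : hermKer (n + 1 + 1) x = hermKer (n + 1) x + herm (n + 2) x ^ 2 / (n + 2).factorial :=
      hermKer_succ _ _
    have e3 := hermKerX_succ n x
    rw [e1, e2, mul_add, ← ih, f2]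
    rw [show herm (n + 3) x = x * herm (n + 2) x - (n + 2) * herm (n + 1) x by
      have := herm_succ_succ (n + 1) x; push_cast at this; rw [this]; ring]
    rw [e3]
    have hf : ((n + 1 : ℕ).factorial : ℝ) ≠ 0 := by positivity
    have h2 : (n : ℝ) + 2 ≠ 0 := by positivity
    field_simp
    ring

theorem hermKerX2_add (n : ℕ) (x : ℝ) :
    hermKerX2 (n + 1) x + hermKerX2 n x = x * hermKer2 (n + 1) x := by
  induction n with
  | zero =>
    simp [hermKer2, hermKerX2, hermKer, hermKerX, Finset.sum_range_succ, herm_succ_succ,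
      herm_zero, herm_one, Nat.factorial]
    ring
  | succ n ih =>
    have h := hermKerX_add (n + 1) x
    have e1 := hermKerX2_succ (n + 1) x
    have e2 := hermKerX2_succ n x
    have e3 := hermKer2_succ (n + 1) x
    rw [e1, e3]
    linear_combination ih + h + e2

theorem moments_eq (n : ℕ) (x : ℝ) :
    mom2 n x = n.factorial * hermKer2 n x ∧
      mom2 (n + 1) x = (n + 1).factorial * hermKer2 (n + 1) x ∧
      momx n x = n.factorial * hermKerX2 n x := by
  induction n with
  | zero =>
    simp [mom2_zero, mom2_one, momx_zero, hermKer2, hermKerX2, hermKer, hermKerX,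
      Finset.sum_range_succ, herm_zero, herm_one, Nat.factorial]
    ring
  | succ n ih =>
    obtain ⟨h1, h2, h3⟩ := ih
    have f1 : ((n + 1).factorial : ℝ) = (n + 1) * n.factorial := by
      rw [Nat.factorial_succ]; push_cast; ring
    have f2 : ((n + 2).factorial : ℝ) = (n + 2) * ((n + 1) * n.factorial) := by
      rw [Nat.factorial_succ, Nat.cast_mul, f1]; push_cast; ring
    refine ⟨h2, ?_, ?_⟩
    · change mom2 (n + 2) x = (n + 2).factorial * hermKer2 (n + 2) x
      rw [mom2_succ_succ, h1, h2, h3, f1, f2]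
      linear_combination (-(n.factorial * (n + 1) : ℝ)) * hermKer2_identity n x
    · rw [momx_succ, h2, h3, f1]
      linear_combination (-(n.factorial * (n + 1) : ℝ)) * hermKerX2_add n x

theorem hermKer_nonneg (n : ℕ) (x : ℝ) : 0 ≤ hermKer n x :=
  Finset.sum_nonneg fun _ _ => by positivity

theorem hermKer2_le (n : ℕ) (x : ℝ) : hermKer2 n x ≤ (n + 1) * hermKer n x := by
  have : ∀ m ∈ Finset.range (n + 1), hermKer m x ≤ hermKer n x := by
    intro m hm
    refine Finset.sum_le_sum_of_subset_of_nonneg ?_ fun _ _ _ => by positivity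
    rw [Finset.mem_range] at hm
    exact Finset.range_subset_range.2 (by omega)
  refine (Finset.sum_le_sum this).trans ?_
  simp

theorem mom2_le (n : ℕ) (x : ℝ) : mom2 n x ≤ n.factorial * ((n + 1) * hermKer n x) := by
  rw [(moments_eq n x).1]
  gcongr
  exact hermKer2_le n x

theorem absDet_eq (n : ℕ) (x : ℝ) :
    absDet n x = ENNReal.ofReal (∫ X, |dgoe x X| ∂(stdG (Fin n × Fin n))) := by
  rw [absDet, ofReal_integral_eq_lintegral_ofReal (isPolyFun_dgoe x).integrable.abs
    (ae_of_all _ fun _ => abs_nonneg _)]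

theorem ofReal_abs_herm_le_absDet (n : ℕ) (x : ℝ) : ENNReal.ofReal |herm n x| ≤ absDet n x := by
  rw [absDet_eq, ← mom1_eq_herm]
  exact ENNReal.ofReal_le_ofReal (abs_integral_le_integral_abs)

theorem absDet_le (n : ℕ) (x : ℝ) :
    absDet n x ≤ ENNReal.ofReal √(n.factorial * ((n + 1) * hermKer n x)) := by
  rw [absDet_eq]
  refine ENNReal.ofReal_le_ofReal (Real.le_sqrt_of_sq_le ((?_ : _ ≤ mom2 n x).trans (mom2_le n x)))
  have hp := isPolyFun_dgoe (n := n) x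
  have h := variance_nonneg (fun X => |dgoe x X|) (stdG (Fin n × Fin n))
  have hL : MemLp (fun X => |dgoe x X|) 2 (stdG (Fin n × Fin n)) := by
    rw [memLp_two_iff_integrable_sq hp.continuous.abs.aestronglyMeasurable]
    simpa using (hp.pow 2).integrable
  have : IsProbabilityMeasure (stdG (Fin n × Fin n)) := by unfold stdG; infer_instance
  rw [variance_eq_sub hL] at h
  have e : ∫ X, ((fun X => |dgoe x X|) ^ 2) X ∂(stdG (Fin n × Fin n)) = mom2 n x := by
    simp [mom2]
  rw [e] at h
  linarith

end hermite

section oscillation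
variable {ψ φ : ℝ → ℝ} {q : ℝ}

/-- The energy `ψ² + ψ'²/Q` of a solution of `ψ'' = -Qψ`, `Q = q - x²/4`, is nondecreasing. -/
theorem energy_mono (hψ : ∀ x, HasDerivAt ψ (φ x) x)
    (hφ : ∀ x, HasDerivAt φ (-(q - x ^ 2 / 4) * ψ x) x) {x : ℝ} (hx : 0 ≤ x)
    (hq : x ^ 2 / 4 < q) :
    ψ 0 ^ 2 + φ 0 ^ 2 / q ≤ ψ x ^ 2 + φ x ^ 2 / (q - x ^ 2 / 4) := by
  have hQ : ∀ y ∈ Set.Icc 0 x, 0 < q - y ^ 2 / 4 := by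
    intro y hy
    have : y ^ 2 ≤ x ^ 2 := pow_le_pow_left₀ hy.1 hy.2 2
    linarith
  have hd : ∀ y ∈ Set.Icc 0 x, HasDerivAt (fun y => ψ y ^ 2 + φ y ^ 2 / (q - y ^ 2 / 4))
      (φ y ^ 2 * (y / 2) / (q - y ^ 2 / 4) ^ 2) y := by
    intro y hy
    have hQd : HasDerivAt (fun y : ℝ => q - y ^ 2 / 4) (-(y / 2)) y := by
      have := (((hasDerivAt_id y).fun_pow 2).div_const 4).const_sub q
      refine this.congr_deriv ?_
      simp; ring
    have h := ((hψ y).fun_pow 2).fun_add (((hφ y).fun_pow 2).fun_div hQd (hQ y hy).ne')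
    refine h.congr_deriv ?_
    have := (hQ y hy).ne'
    generalize q - y ^ 2 / 4 = Q at this ⊢
    norm_num
    field_simp
    ring
  have hm : MonotoneOn (fun y => ψ y ^ 2 + φ y ^ 2 / (q - y ^ 2 / 4)) (Set.Icc 0 x) := by
    refine monotoneOn_of_hasDerivWithinAt_nonneg (convex_Icc 0 x)
      (fun y hy => (hd y hy).continuousAt.continuousWithinAt)
      (fun y hy => (hd y (interior_subset hy)).hasDerivWithinAt) ?_
    intro y hy
    have := (interior_subset hy : y ∈ Set.Icc 0 x).1
    positivity
  simpa using hm (Set.left_mem_Icc.2 hx) (Set.right_mem_Icc.2 hx) hx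

theorem exists_abs_le_of_integral {f : ℝ → ℝ} (hf : Continuous f) {a c d b : ℝ} (hac : a ≤ c)
    (hcd : c < d) (hdb : d ≤ b) :
    ∃ x ∈ Set.Icc c d, (d - c) * |f x| ≤ ∫ y in a..b, |f y| := by
  obtain ⟨x, hx, hmin⟩ := isCompact_Icc.exists_isMinOn (Set.nonempty_Icc.2 hcd.le)
    (hf.abs.continuousOn (s := Set.Icc c d))
  refine ⟨x, hx, ?_⟩
  have hi : ∀ s t : ℝ, IntervalIntegrable (fun y => |f y|) volume s t := fun s t =>
    hf.abs.intervalIntegrable s t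
  calc (d - c) * |f x| = ∫ y in c..d, |f x| := by simp
    _ ≤ ∫ y in c..d, |f y| :=
      intervalIntegral.integral_mono_on hcd.le (by simp) (hi c d) fun y hy => hmin hy
    _ ≤ ∫ y in a..b, |f y| :=
      intervalIntegral.integral_mono_interval hac hcd.le hdb
        (ae_of_all _ fun _ => abs_nonneg _) (hi a b)

theorem energy_le_integral (hψ : ∀ x, HasDerivAt ψ (φ x) x)
    (hφ : ∀ x, HasDerivAt φ (-(q - x ^ 2 / 4) * ψ x) x) {a : ℝ} (ha : 0 ≤ a)
    (hq : (a + 1) ^ 2 / 4 + 1 / 2 ≤ q) :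
    ψ 0 ^ 2 + φ 0 ^ 2 / q ≤ ((2 * q + 40) * ∫ y in a..(a + 1), |ψ y|) ^ 2 := by
  have hψc : Continuous ψ := continuous_iff_continuousAt.2 fun x => (hψ x).continuousAt
  have hq0 : 0 < q := by nlinarith [sq_nonneg (a + 1)]
  set θ := ∫ y in a..(a + 1), |ψ y| with hθ
  have hi : ∀ s t : ℝ, IntervalIntegrable (fun y => |ψ y|) volume s t := fun s t =>
    hψc.abs.intervalIntegrable s t
  obtain ⟨x1, ⟨h1a, h1b⟩, h1⟩ := exists_abs_le_of_integral hψc (a := a) (c := a) (d := a + 1 / 3)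
    (b := a + 1) le_rfl (by linarith) (by linarith)
  obtain ⟨x2, ⟨h2a, h2b⟩, h2⟩ := exists_abs_le_of_integral hψc (a := a) (c := a + 2 / 3)
    (d := a + 1) (b := a + 1) (by linarith) (by linarith) le_rfl
  rw [← hθ] at h1 h2
  have hθ0 : 0 ≤ θ := by
    refine le_trans ?_ h1
    have := abs_nonneg (ψ x1)
    linarith
  have h1' : |ψ x1| ≤ 3 * θ := by linarith
  have h2' : |ψ x2| ≤ 3 * θ := by linarith
  have h12 : x1 < x2 := by linarith
  obtain ⟨ξ, ⟨hξ1, hξ2⟩, hξ⟩ := exists_hasDerivAt_eq_slope ψ φ h12 hψc.continuousOn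
    fun x _ => hψ x
  have hφξ : |φ ξ| ≤ 18 * θ := by
    rw [hξ, abs_div, div_le_iff₀ (by rw [abs_pos]; linarith), abs_of_pos (by linarith : 0 < x2 - x1)]
    have : |ψ x2 - ψ x1| ≤ 6 * θ := by
      refine (abs_sub _ _).trans ?_
      linarith
    nlinarith
  have hQ : ∀ y ∈ Set.Icc a (a + 1), 1 / 2 ≤ q - y ^ 2 / 4 ∧ q - y ^ 2 / 4 ≤ q := by
    intro y hy
    have h : y ^ 2 ≤ (a + 1) ^ 2 := pow_le_pow_left₀ (ha.trans hy.1) hy.2 2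
    constructor
    · linarith
    · nlinarith [sq_nonneg y]
  have hcont : Continuous fun y => -(q - y ^ 2 / 4) * ψ y := by fun_prop
  have hdiff : |φ ξ - φ x1| ≤ q * θ := by
    rw [← intervalIntegral.integral_eq_sub_of_hasDerivAt (fun y _ => hφ y)
      (hcont.intervalIntegrable _ _)]
    calc |∫ y in x1..ξ, -(q - y ^ 2 / 4) * ψ y|
        ≤ ∫ y in x1..ξ, |-(q - y ^ 2 / 4) * ψ y| :=
          intervalIntegral.abs_integral_le_integral_abs hξ1.le
      _ ≤ ∫ y in x1..ξ, q * |ψ y| := by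
          refine intervalIntegral.integral_mono_on hξ1.le
            (hcont.abs.intervalIntegrable _ _) ((hi _ _).const_mul q) fun y hy => ?_
          obtain ⟨g1, g2⟩ := hQ y ⟨by linarith [hy.1], by linarith [hy.2]⟩
          rw [abs_mul, abs_neg, abs_of_nonneg (by linarith)]
          gcongr
      _ = q * ∫ y in x1..ξ, |ψ y| := by rw [intervalIntegral.integral_const_mul]
      _ ≤ q * θ := by
          gcongr
          exact intervalIntegral.integral_mono_interval h1a hξ1.le (by linarith)
            (ae_of_all _ fun _ => abs_nonneg _) (hi _ _)
  have hφ1 : |φ x1| ≤ (18 + q) * θ := by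
    have : |φ x1| ≤ |φ ξ| + |φ ξ - φ x1| := by
      have := abs_sub_abs_le_abs_sub (φ x1) (φ ξ)
      rw [abs_sub_comm] at this
      linarith
    linarith
  obtain ⟨g1, g2⟩ := hQ x1 ⟨h1a, by linarith⟩
  have hE := energy_mono hψ hφ (ha.trans h1a) (by linarith : x1 ^ 2 / 4 < q)
  have e1 : ψ x1 ^ 2 ≤ (3 * θ) ^ 2 := by
    rw [← sq_abs]; exact pow_le_pow_left₀ (abs_nonneg _) h1' 2
  have e2 : φ x1 ^ 2 ≤ ((18 + q) * θ) ^ 2 := by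
    rw [← sq_abs]; exact pow_le_pow_left₀ (abs_nonneg _) hφ1 2
  have e3 : φ x1 ^ 2 / (q - x1 ^ 2 / 4) ≤ 2 * ((18 + q) * θ) ^ 2 := by
    rw [div_le_iff₀ (by linarith)]
    nlinarith [sq_nonneg ((18 + q) * θ)]
  refine hE.trans ((add_le_add e1 e3).trans ?_)
  have : 0 ≤ θ ^ 2 * (2 * q ^ 2 + 88 * q + 943) := by positivity
  nlinarith

end oscillation

section hermiteLower

theorem hasDerivAt_herm (n : ℕ) (x : ℝ) :
    HasDerivAt (herm n) (x * herm n x - herm (n + 1) x) x := by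
  have h := (hermP n).hasDerivAt x
  refine h.congr_deriv ?_
  simp [herm, hermP_succ]

theorem hasDerivAt_exp_neg_sq_div (x : ℝ) :
    HasDerivAt (fun x : ℝ => Real.exp (-(x ^ 2 / 4))) (Real.exp (-(x ^ 2 / 4)) * (-(x / 2))) x := by
  have h : HasDerivAt (fun y : ℝ => -(y ^ 2 / 4)) (-(x / 2)) x := by
    have := (((hasDerivAt_id x).fun_pow 2).div_const 4).fun_neg
    refine this.congr_deriv ?_
    simp; ring
  exact h.exp

theorem herm_zero_lower (n : ℕ) :
    (n.factorial : ℝ) ≤ herm (n + 1) 0 ^ 2 + (n + 1) * herm n 0 ^ 2 := by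
  induction n with
  | zero => simp [herm_zero, herm_one]
  | succ n ih =>
    rw [show n + 1 + 1 = n + 2 from rfl, herm_succ_succ, Nat.factorial_succ]
    push_cast
    have h1 : ((n : ℝ) + 1) * n.factorial ≤
        (n + 1) * (herm (n + 1) 0 ^ 2 + (n + 1) * herm n 0 ^ 2) := by gcongr
    nlinarith [sq_nonneg (herm (n + 1) 0)]

theorem factorial_le_integral_herm (n : ℕ) {a : ℝ} (ha : 0 ≤ a)
    (hn : (a + 1) ^ 2 / 4 ≤ n + 1) :
    ((n + 1).factorial : ℝ) ≤ 2 * (n + 1) *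
      ((2 * n + 43) * ∫ y in a..(a + 1), |herm (n + 1) y * Real.exp (-(y ^ 2 / 4))|) ^ 2 := by
  have h := energy_le_integral (ψ := fun y => herm (n + 1) y * Real.exp (-(y ^ 2 / 4)))
    (φ := fun y => ((n + 1) * herm n y - y / 2 * herm (n + 1) y) * Real.exp (-(y ^ 2 / 4)))
    (q := n + 3 / 2) ?_ ?_ ha (by linarith)
  · have h0 := herm_zero_lower n
    simp only [ne_eq, OfNat.ofNat_ne_zero, not_false_eq_true, zero_pow, zero_div, neg_zero,
      Real.exp_zero, mul_one, zero_mul, sub_zero] at h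
    rw [show (2 * ((n : ℝ) + 3 / 2) + 40) = 2 * n + 43 by ring] at h
    have h1 : 2 / 3 * ((n + 1) * herm n 0 ^ 2) ≤ ((n + 1) * herm n 0) ^ 2 / (n + 3 / 2) := by
      rw [le_div_iff₀ (by positivity), mul_pow]
      have : 0 ≤ ((n : ℝ) + 1) * herm n 0 ^ 2 := by positivity
      have hn0 : (0 : ℝ) ≤ n := by positivity
      nlinarith [mul_nonneg this hn0]
    rw [Nat.factorial_succ]
    push_cast
    have h2 : (n.factorial : ℝ) / 2 ≤
      ((2 * n + 43) * ∫ y in a..(a + 1), |herm (n + 1) y * Real.exp (-(y ^ 2 / 4))|) ^ 2 := by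
      refine le_trans ?_ h
      nlinarith [sq_nonneg (herm (n + 1) 0), (by positivity : (0 : ℝ) ≤ n.factorial)]
    nlinarith [mul_le_mul_of_nonneg_left h2 (by positivity : (0 : ℝ) ≤ 2 * (n + 1))]
  · intro x
    refine ((hasDerivAt_herm_succ n x).fun_mul (hasDerivAt_exp_neg_sq_div x)).congr_deriv ?_
    ring
  · intro x
    have h1 := ((hasDerivAt_herm n x).const_mul ((n : ℝ) + 1)).fun_sub
      (((hasDerivAt_id x).div_const 2).fun_mul (hasDerivAt_herm_succ n x))
    refine (h1.fun_mul (hasDerivAt_exp_neg_sq_div x)).congr_deriv ?_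
    simp only [id]
    ring

end hermiteLower

section gaussianScaling

theorem setLIntegral_gaussianReal_comp_mul {K : ℝ} (hK : 0 < K) {f : ℝ → ℝ≥0∞} (hf : Measurable f)
    (a : ℝ) :
    ∫⁻ z in Set.Ici a, f (K * z) ∂(gaussianReal 0 1) =
      ∫⁻ x in Set.Ici (K * a),
        ENNReal.ofReal ((√(2 * Real.pi * K ^ 2))⁻¹ * Real.exp (-(x ^ 2 / (2 * K ^ 2)))) * f x := by
  have hmap : (gaussianReal 0 1).map (fun z => K * z) = gaussianReal 0 (NNReal.mk (K ^ 2) (sq_nonneg K)) := by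
    rw [gaussianReal_map_const_mul]; simp
  have hv : NNReal.mk (K ^ 2) (sq_nonneg K) ≠ 0 := by
    intro h
    have := congrArg NNReal.toReal h
    simp only [NNReal.coe_mk, NNReal.coe_zero] at this
    exact hK.ne' (pow_eq_zero_iff two_ne_zero |>.1 this)
  have hpre : (fun z => K * z) ⁻¹' Set.Ici (K * a) = Set.Ici a := by
    ext z; simp only [Set.mem_preimage, Set.mem_Ici]; exact mul_le_mul_iff_right₀ hK
  rw [← hpre, ← setLIntegral_map measurableSet_Ici hf (by fun_prop), hmap,
    gaussianReal_of_var_ne_zero _ hv, restrict_withDensity measurableSet_Ici,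
    lintegral_withDensity_eq_lintegral_mul _ (measurable_gaussianPDF _ _) hf]
  refine lintegral_congr fun x => ?_
  simp only [Pi.mul_apply, gaussianPDF, gaussianPDFReal, NNReal.coe_mk, sub_zero, neg_div]

end gaussianScaling

section kernelBounds

theorem continuous_hermKer (n : ℕ) : Continuous (hermKer n) := by
  unfold hermKer
  exact continuous_finsetSum _ fun m _ => ((continuous_herm m).pow 2).div_const _

theorem integrable_herm_sq_mul_exp (m : ℕ) :
    Integrable (fun x => herm m x ^ 2 * Real.exp (-(x ^ 2 / 2))) ∧
      ∫ x, herm m x ^ 2 * Real.exp (-(x ^ 2 / 2)) = √(2 * Real.pi) * m.factorial := by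
  have hpi : 0 < √(2 * Real.pi) := by positivity
  have heq : ∀ x, herm m x ^ 2 * Real.exp (-(x ^ 2 / 2)) =
      √(2 * Real.pi) * ((hermP m ^ 2).eval x * gaussianPDFReal 0 1 x) := by
    intro x
    simp only [gaussianPDFReal, herm, Polynomial.eval_pow, NNReal.coe_one, mul_one, sub_zero,
      neg_div]
    field_simp
  constructor
  · refine ((integrable_eval_mul_gaussianPDFReal (hermP m ^ 2)).const_mul
      (√(2 * Real.pi))).congr (ae_of_all _ fun x => (heq x).symm)
  · simp_rw [heq]
    rw [integral_const_mul, ← integral_gaussianReal_mul (fun x => (hermP m ^ 2).eval x),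
      ← integral_hermP_sq]
    simp [herm]

theorem integrable_hermKer_mul_exp (n : ℕ) :
    Integrable (fun x => hermKer n x * Real.exp (-(x ^ 2 / 2))) ∧
      ∫ x, hermKer n x * Real.exp (-(x ^ 2 / 2)) = √(2 * Real.pi) * (n + 1) := by
  have heq : ∀ x, hermKer n x * Real.exp (-(x ^ 2 / 2)) =
      ∑ m ∈ Finset.range (n + 1),
        herm m x ^ 2 * Real.exp (-(x ^ 2 / 2)) / m.factorial := by
    intro x
    rw [hermKer, Finset.sum_mul]
    exact Finset.sum_congr rfl fun m _ => by ring
  simp_rw [heq]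
  have hi : ∀ m ∈ Finset.range (n + 1), Integrable fun x =>
      herm m x ^ 2 * Real.exp (-(x ^ 2 / 2)) / (m.factorial : ℝ) := fun m _ =>
    (integrable_herm_sq_mul_exp m).1.div_const _
  refine ⟨integrable_finsetSum _ hi, ?_⟩
  rw [integral_finsetSum _ hi]
  have : ∀ m ∈ Finset.range (n + 1),
      ∫ x, herm m x ^ 2 * Real.exp (-(x ^ 2 / 2)) / (m.factorial : ℝ) = √(2 * Real.pi) := by
    intro m _
    rw [integral_div, (integrable_herm_sq_mul_exp m).2]
    have : (m.factorial : ℝ) ≠ 0 := by positivity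
    field_simp
  rw [Finset.sum_congr rfl this]
  simp [mul_comm]

theorem exp_shift_le {κ y0 x : ℝ} (hκ : 0 < κ) (h : 0 ≤ y0 * (x - y0)) :
    Real.exp (-(κ * x ^ 2)) ≤ Real.exp (-(κ * y0 ^ 2)) * Real.exp (-(κ * (x - y0) ^ 2)) := by
  rw [← Real.exp_add, Real.exp_le_exp]
  nlinarith [mul_nonneg hκ.le h]

theorem integral_exp_shift (κ y0 : ℝ) :
    ∫ x, Real.exp (-(κ * (x - y0) ^ 2)) = √(Real.pi / κ) := by
  rw [integral_sub_right_eq_self (fun x => Real.exp (-(κ * x ^ 2))) y0]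
  simpa [neg_mul] using integral_gaussian κ

theorem integrable_exp_shift {κ : ℝ} (hκ : 0 < κ) (y0 : ℝ) :
    Integrable fun x => Real.exp (-(κ * (x - y0) ^ 2)) := by
  have := (integrable_exp_neg_mul_sq hκ).comp_sub_right y0
  simpa [neg_mul] using this

/-- Global upper bound for the weighted integral of the kernel bound. -/
theorem setLIntegral_kernel_le {κ y0 : ℝ} (hκ : 0 < κ) {S : Set ℝ} (hS : MeasurableSet S)
    (h : ∀ x ∈ S, 0 ≤ y0 * (x - y0)) (n : ℕ) :
    ∫⁻ x in S, ENNReal.ofReal (Real.exp (-((1 / 4 + κ) * x ^ 2)) *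
        √(n.factorial * ((n + 1) * hermKer n x))) ≤
      ENNReal.ofReal (√(n.factorial) * (√(n + 1) * ((√(2 * Real.pi) * (n + 1) +
        √(Real.pi / (2 * κ))) / 2)) * Real.exp (-(κ * y0 ^ 2))) := by
  set F : ℝ → ℝ := fun x => √(n.factorial) * √(n + 1) * Real.exp (-(κ * y0 ^ 2)) *
    ((hermKer n x * Real.exp (-(x ^ 2 / 2)) + Real.exp (-(2 * κ * (x - y0) ^ 2))) / 2) with hF
  have hker := integrable_hermKer_mul_exp n
  have hsh := integrable_exp_shift (by linarith : 0 < 2 * κ) y0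
  have hsum : Integrable fun x => hermKer n x * Real.exp (-(x ^ 2 / 2)) +
      Real.exp (-(2 * κ * (x - y0) ^ 2)) := hker.1.add hsh
  have hFi : Integrable F := (hsum.div_const 2).const_mul _
  have hF0 : ∀ x, 0 ≤ F x := by
    intro x
    have := hermKer_nonneg n x
    positivity
  have hint : ∫ x, F x = √(n.factorial) * (√(n + 1) * ((√(2 * Real.pi) * (n + 1) +
        √(Real.pi / (2 * κ))) / 2)) * Real.exp (-(κ * y0 ^ 2)) := by
    rw [hF, integral_const_mul, integral_div, integral_add hker.1 hsh, hker.2,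
      integral_exp_shift]
    ring
  rw [← hint, ofReal_integral_eq_lintegral_ofReal hFi (ae_of_all _ hF0)]
  refine (setLIntegral_mono' hS fun x hx => ?_).trans (setLIntegral_le_lintegral _ _)
  refine ENNReal.ofReal_le_ofReal ?_
  have hk := hermKer_nonneg n x
  have e1 : Real.exp (-((1 / 4 + κ) * x ^ 2)) =
      Real.exp (-(x ^ 2 / 4)) * Real.exp (-(κ * x ^ 2)) := by
    rw [← Real.exp_add]; ring_nf
  have e2 : Real.exp (-(x ^ 2 / 2)) = Real.exp (-(x ^ 2 / 4)) ^ 2 := by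
    rw [← Real.exp_nat_mul]; ring_nf
  have e3 : Real.exp (-(2 * κ * (x - y0) ^ 2)) = Real.exp (-(κ * (x - y0) ^ 2)) ^ 2 := by
    rw [← Real.exp_nat_mul]; ring_nf
  have e4 : √(n.factorial * ((n + 1) * hermKer n x)) =
      √(n.factorial) * √(n + 1) * √(hermKer n x) := by
    rw [Real.sqrt_mul (by positivity), Real.sqrt_mul (by positivity), mul_assoc]
  have e5 : hermKer n x = √(hermKer n x) ^ 2 := (Real.sq_sqrt hk).symm
  rw [hF, e1, e4]
  simp only
  rw [e2, e3]
  nth_rewrite 2 [e5]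
  have hshift := exp_shift_le hκ (h x hx)
  set s := √(hermKer n x)
  set e := Real.exp (-(x ^ 2 / 4))
  set g := Real.exp (-(κ * (x - y0) ^ 2))
  calc e * Real.exp (-(κ * x ^ 2)) * (√(n.factorial) * √(n + 1) * s)
      ≤ e * (Real.exp (-(κ * y0 ^ 2)) * g) * (√(n.factorial) * √(n + 1) * s) := by gcongr
    _ = √(n.factorial) * √(n + 1) * Real.exp (-(κ * y0 ^ 2)) * ((s * e) * g) := by ring
    _ ≤ _ := by
      gcongr
      nlinarith [sq_nonneg (s * e - g)]

end kernelBounds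

section outside

theorem herm_ratio {x : ℝ} (hx : 0 < x) (n : ℕ) (h : 4 * (n : ℝ) ≤ x ^ 2) :
    0 < herm n x ∧ x / 2 * herm n x ≤ herm (n + 1) x := by
  induction n with
  | zero => simp [herm_zero, herm_one, hx.le]
  | succ n ih =>
    push_cast at h
    obtain ⟨h0, h1⟩ := ih (by linarith)
    have hpos : 0 < herm (n + 1) x := lt_of_lt_of_le (by positivity) h1
    refine ⟨hpos, ?_⟩
    rw [show n + 1 + 1 = n + 2 from rfl, herm_succ_succ]
    have : ((n : ℝ) + 1) * herm n x ≤ x / 2 * herm (n + 1) x := by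
      calc ((n : ℝ) + 1) * herm n x ≤ x ^ 2 / 4 * herm n x := by gcongr; linarith
        _ = x / 2 * (x / 2 * herm n x) := by ring
        _ ≤ _ := by gcongr
    linarith

theorem herm_sq_div_factorial_le {x : ℝ} (hx : 0 < x) {m n : ℕ} (hmn : m ≤ n)
    (h : 4 * (n : ℝ) ≤ x ^ 2) :
    herm m x ^ 2 / m.factorial ≤ herm n x ^ 2 / n.factorial := by
  induction n, hmn using Nat.le_induction with
  | base => exact le_rfl
  | succ n hmn ih =>
    push_cast at h
    refine (ih (by linarith)).trans ?_
    obtain ⟨h0, h1⟩ := herm_ratio hx n (by linarith)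
    rw [div_le_div_iff₀ (by positivity) (by positivity), Nat.factorial_succ]
    push_cast
    have h2 : (x / 2 * herm n x) ^ 2 ≤ herm (n + 1) x ^ 2 := by gcongr
    have h3 : ((n : ℝ) + 1) * herm n x ^ 2 ≤ herm (n + 1) x ^ 2 := by
      refine le_trans ?_ h2
      rw [mul_pow]
      gcongr
      linarith
    calc herm n x ^ 2 * (((n : ℝ) + 1) * n.factorial)
        = ((n : ℝ) + 1) * herm n x ^ 2 * n.factorial := by ring
      _ ≤ _ := by gcongr

theorem sqrt_kernel_le {x : ℝ} (hx : 0 < x) {n : ℕ} (h : 4 * (n : ℝ) ≤ x ^ 2) :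
    √(n.factorial * ((n + 1) * hermKer n x)) ≤ (n + 1) * herm n x := by
  have h0 := (herm_ratio hx n h).1
  refine Real.sqrt_le_iff.2 ⟨by positivity, ?_⟩
  have : hermKer n x ≤ (n + 1) * (herm n x ^ 2 / n.factorial) := by
    calc hermKer n x ≤ ∑ m ∈ Finset.range (n + 1), herm n x ^ 2 / n.factorial :=
        Finset.sum_le_sum fun m hm => herm_sq_div_factorial_le hx
          (Nat.lt_succ_iff.1 (Finset.mem_range.1 hm)) h
      _ = _ := by simp
  calc (n.factorial : ℝ) * ((n + 1) * hermKer n x)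
      ≤ n.factorial * ((n + 1) * ((n + 1) * (herm n x ^ 2 / n.factorial))) := by gcongr
    _ = _ := by
      have : (n.factorial : ℝ) ≠ 0 := by positivity
      field_simp

theorem herm_mul_exp_antitone {x0 x : ℝ} (hx0 : 0 < x0) (hx : x0 ≤ x) {n : ℕ}
    (h : 4 * (n : ℝ) ≤ x0 ^ 2) :
    herm n x * Real.exp (-(x ^ 2 / 4)) ≤ herm n x0 * Real.exp (-(x0 ^ 2 / 4)) := by
  have hd : ∀ y, HasDerivAt (fun y => herm n y * Real.exp (-(y ^ 2 / 4)))
      ((y / 2 * herm n y - herm (n + 1) y) * Real.exp (-(y ^ 2 / 4))) y := by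
    intro y
    refine ((hasDerivAt_herm n y).fun_mul (hasDerivAt_exp_neg_sq_div y)).congr_deriv ?_
    ring
  have hm : AntitoneOn (fun y => herm n y * Real.exp (-(y ^ 2 / 4))) (Set.Ici x0) := by
    refine antitoneOn_of_hasDerivWithinAt_nonpos (convex_Ici x0)
      (fun y _ => (hd y).continuousAt.continuousWithinAt)
      (fun y _ => (hd y).hasDerivWithinAt) ?_
    intro y hy
    have hy' : x0 ≤ y := interior_subset hy
    have hsq : x0 ^ 2 ≤ y ^ 2 := by gcongr
    have := (herm_ratio (hx0.trans_le hy') n (h.trans hsq)).2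
    exact mul_nonpos_of_nonpos_of_nonneg (by linarith) (Real.exp_pos _).le
  exact hm Set.self_mem_Ici hx hx

theorem herm_le_herm {x0 x : ℝ} (hx0 : 0 < x0) (hx : x0 ≤ x) {n : ℕ}
    (h : 4 * (n : ℝ) ≤ x0 ^ 2) : herm n x0 ≤ herm n x := by
  cases n with
  | zero => simp [herm_zero]
  | succ n =>
    have hm : MonotoneOn (herm (n + 1)) (Set.Ici x0) := by
      refine monotoneOn_of_hasDerivWithinAt_nonneg (convex_Ici x0)
        (fun y _ => (continuous_herm _).continuousWithinAt)
        (fun y _ => (hasDerivAt_herm_succ n y).hasDerivWithinAt) ?_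
      intro y hy
      have hy' : x0 ≤ y := interior_subset hy
      have hsq : x0 ^ 2 ≤ y ^ 2 := by gcongr
      push_cast at h
      have := (herm_ratio (hx0.trans_le hy') n (by linarith)).1
      positivity
    exact hm Set.self_mem_Ici hx hx

theorem setLIntegral_kernel_le_herm {κ x0 : ℝ} (hκ : 0 < κ) (hx0 : 0 < x0) {n : ℕ}
    (h : 4 * (n : ℝ) ≤ x0 ^ 2) :
    ∫⁻ x in Set.Ici x0, ENNReal.ofReal (Real.exp (-((1 / 4 + κ) * x ^ 2)) *
        √(n.factorial * ((n + 1) * hermKer n x))) ≤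
      ENNReal.ofReal (√(Real.pi / κ) * (n + 1) * herm n x0 *
        Real.exp (-((1 / 4 + κ) * x0 ^ 2))) := by
  have h0 := (herm_ratio hx0 n h).1
  set F : ℝ → ℝ := fun x => (n + 1) * herm n x0 * Real.exp (-((1 / 4 + κ) * x0 ^ 2)) *
    Real.exp (-(κ * (x - x0) ^ 2)) with hF
  have hFi : Integrable F := (integrable_exp_shift hκ x0).const_mul _
  have hF0 : ∀ x, 0 ≤ F x := fun x => by positivity
  have hint : ∫ x, F x = √(Real.pi / κ) * (n + 1) * herm n x0 *
        Real.exp (-((1 / 4 + κ) * x0 ^ 2)) := by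
    rw [hF, integral_const_mul, integral_exp_shift]
    ring
  rw [← hint, ofReal_integral_eq_lintegral_ofReal hFi (ae_of_all _ hF0)]
  refine (setLIntegral_mono' measurableSet_Ici fun x hx => ?_).trans
    (setLIntegral_le_lintegral _ _)
  refine ENNReal.ofReal_le_ofReal ?_
  have hx' : x0 ≤ x := hx
  have hsq : x0 ^ 2 ≤ x ^ 2 := by gcongr
  have split : ∀ y : ℝ, Real.exp (-((1 / 4 + κ) * y ^ 2)) =
      Real.exp (-(y ^ 2 / 4)) * Real.exp (-(κ * y ^ 2)) := by
    intro y; rw [← Real.exp_add]; ring_nf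
  calc Real.exp (-((1 / 4 + κ) * x ^ 2)) * √(n.factorial * ((n + 1) * hermKer n x))
      ≤ Real.exp (-((1 / 4 + κ) * x ^ 2)) * ((n + 1) * herm n x) := by
        gcongr
        exact sqrt_kernel_le (hx0.trans_le hx') (h.trans hsq)
    _ = (n + 1) * (herm n x * Real.exp (-(x ^ 2 / 4))) * Real.exp (-(κ * x ^ 2)) := by
        rw [split]; ring
    _ ≤ (n + 1) * (herm n x0 * Real.exp (-(x0 ^ 2 / 4))) *
        (Real.exp (-(κ * x0 ^ 2)) * Real.exp (-(κ * (x - x0) ^ 2))) := by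
        refine mul_le_mul (mul_le_mul_of_nonneg_left (herm_mul_exp_antitone hx0 hx' h)
          (by positivity)) (exp_shift_le hκ (mul_nonneg hx0.le (by linarith)))
          (Real.exp_pos _).le (by positivity)
    _ = F x := by
        rw [hF]; simp only; rw [split]; ring

end outside

section lower

theorem le_setLIntegral_herm {κ x0 : ℝ} (hκ : 0 < κ) (hx0 : 0 < x0) {n : ℕ}
    (h : 4 * (n : ℝ) ≤ x0 ^ 2) :
    ENNReal.ofReal (herm n x0 * Real.exp (-((1 / 4 + κ) * (x0 + 1) ^ 2))) ≤
      ∫⁻ x in Set.Ici x0, ENNReal.ofReal (Real.exp (-((1 / 4 + κ) * x ^ 2)) * |herm n x|) := by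
  have h0 := (herm_ratio hx0 n h).1
  calc ENNReal.ofReal (herm n x0 * Real.exp (-((1 / 4 + κ) * (x0 + 1) ^ 2)))
      = ∫⁻ x in Set.Icc x0 (x0 + 1),
          ENNReal.ofReal (herm n x0 * Real.exp (-((1 / 4 + κ) * (x0 + 1) ^ 2))) := by
        simp
    _ ≤ ∫⁻ x in Set.Icc x0 (x0 + 1),
          ENNReal.ofReal (Real.exp (-((1 / 4 + κ) * x ^ 2)) * |herm n x|) := by
        refine setLIntegral_mono' measurableSet_Icc fun x hx => ENNReal.ofReal_le_ofReal ?_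
        rw [mul_comm]
        have hxp : 0 < x := hx0.trans_le hx.1
        have hxl := hx.2
        gcongr
        exact (herm_le_herm hx0 hx.1 h).trans (le_abs_self _)
    _ ≤ _ := lintegral_mono_set Set.Icc_subset_Ici_self

theorem le_setLIntegral_herm_bulk {κ a : ℝ} (hκ : 0 < κ) (ha : 0 ≤ a) (n : ℕ)
    (hn : (a + 1) ^ 2 / 4 ≤ n + 1) :
    ENNReal.ofReal (√((n + 1).factorial) / (√(2 * (n + 1)) * (2 * n + 43)) *
        Real.exp (-(κ * (a + 1) ^ 2))) ≤
      ∫⁻ x in Set.Ici a, ENNReal.ofReal (Real.exp (-((1 / 4 + κ) * x ^ 2)) *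
        |herm (n + 1) x|) := by
  have hcont : Continuous fun y => |herm (n + 1) y * Real.exp (-(y ^ 2 / 4))| := by
    have := continuous_herm (n + 1)
    fun_prop
  have hfac := factorial_le_integral_herm n ha hn
  set θ := ∫ y in a..(a + 1), |herm (n + 1) y * Real.exp (-(y ^ 2 / 4))| with hθ
  have hθ0 : 0 ≤ θ := intervalIntegral.integral_nonneg (by linarith) fun _ _ => abs_nonneg _
  have h1 : √((n + 1).factorial) / (√(2 * (n + 1)) * (2 * n + 43)) ≤ θ := by
    rw [div_le_iff₀ (by positivity)]
    refine Real.sqrt_le_iff.2 ⟨by positivity, hfac.trans_eq ?_⟩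
    rw [mul_pow θ, mul_pow (√(2 * ((n : ℝ) + 1))), Real.sq_sqrt (by positivity)]
    ring
  calc ENNReal.ofReal (√((n + 1).factorial) / (√(2 * (n + 1)) * (2 * n + 43)) *
        Real.exp (-(κ * (a + 1) ^ 2)))
      ≤ ENNReal.ofReal (θ * Real.exp (-(κ * (a + 1) ^ 2))) := by
        refine ENNReal.ofReal_le_ofReal ?_
        gcongr
    _ = ∫⁻ x in Set.Ioc a (a + 1), ENNReal.ofReal
          (|herm (n + 1) x * Real.exp (-(x ^ 2 / 4))| * Real.exp (-(κ * (a + 1) ^ 2))) := by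
        rw [hθ, intervalIntegral.integral_of_le (by linarith), ← integral_mul_const,
          ofReal_integral_eq_lintegral_ofReal]
        · exact ((hcont.mul continuous_const).integrableOn_Icc).mono_set Set.Ioc_subset_Icc_self
        · exact ae_of_all _ fun _ => by positivity
    _ ≤ ∫⁻ x in Set.Ioc a (a + 1),
          ENNReal.ofReal (Real.exp (-((1 / 4 + κ) * x ^ 2)) * |herm (n + 1) x|) := by
        refine setLIntegral_mono' measurableSet_Ioc fun x hx => ENNReal.ofReal_le_ofReal ?_
        have hxp : 0 < x := ha.trans_lt hx.1
        have hxl := hx.2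
        have split : Real.exp (-((1 / 4 + κ) * x ^ 2)) =
            Real.exp (-(x ^ 2 / 4)) * Real.exp (-(κ * x ^ 2)) := by
          rw [← Real.exp_add]; ring_nf
        rw [split, abs_mul, abs_of_pos (Real.exp_pos _)]
        calc |herm (n + 1) x| * Real.exp (-(x ^ 2 / 4)) * Real.exp (-(κ * (a + 1) ^ 2))
            ≤ |herm (n + 1) x| * Real.exp (-(x ^ 2 / 4)) * Real.exp (-(κ * x ^ 2)) := by gcongr
          _ = _ := by ring
    _ ≤ _ := lintegral_mono_set fun x hx => hx.1.le

end lower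

section ratioProfile

/-- The larger root of `W² = uW - s`. -/
def ratioRoot (u s : ℝ) : ℝ := (u + √(u ^ 2 - 4 * s)) / 2

/-- A primitive of `s ↦ log (ratioRoot u s)`, vanishing at `0`. -/
def ratioPrim (u s : ℝ) : ℝ :=
  s * Real.log (ratioRoot u s) - u * √(u ^ 2 - 4 * s) / 4 - s / 2 + u ^ 2 / 4

variable {u : ℝ}

theorem ratioRoot_disc_pos (hu : 2 < u) {s : ℝ} (hs : s ≤ 1) : 0 < u ^ 2 - 4 * s := by nlinarith

theorem ratioRoot_sq (hu : 2 < u) {s : ℝ} (hs : s ≤ 1) :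
    ratioRoot u s ^ 2 = u * ratioRoot u s - s := by
  have h := Real.sq_sqrt (ratioRoot_disc_pos hu hs).le
  unfold ratioRoot
  nlinarith

theorem ratioRoot_zero (hu : 2 < u) : ratioRoot u 0 = u := by
  unfold ratioRoot
  rw [mul_zero, sub_zero, Real.sqrt_sq (by linarith)]
  ring

theorem ratioRoot_ge (s : ℝ) : u / 2 ≤ ratioRoot u s := by
  unfold ratioRoot
  linarith [Real.sqrt_nonneg (u ^ 2 - 4 * s)]

theorem ratioRoot_antitone {s t : ℝ} (hst : s ≤ t) : ratioRoot u t ≤ ratioRoot u s := by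
  unfold ratioRoot
  gcongr

theorem ratioRoot_sub_le (hu : 2 < u) {s t : ℝ} (hst : s ≤ t) (ht : t ≤ 1) :
    ratioRoot u s - ratioRoot u t ≤ (t - s) / √(u ^ 2 - 4) := by
  have hR : 0 < √(u ^ 2 - 4) := Real.sqrt_pos.2 (by nlinarith)
  have h1 := Real.sq_sqrt (ratioRoot_disc_pos hu ht).le
  have h2 := Real.sq_sqrt (ratioRoot_disc_pos hu (hst.trans ht)).le
  have h3 : √(u ^ 2 - 4) ≤ √(u ^ 2 - 4 * t) := Real.sqrt_le_sqrt (by linarith)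
  have h4 : √(u ^ 2 - 4 * t) ≤ √(u ^ 2 - 4 * s) := Real.sqrt_le_sqrt (by linarith)
  rw [le_div_iff₀ hR]
  unfold ratioRoot
  set A := √(u ^ 2 - 4 * s)
  set B := √(u ^ 2 - 4 * t)
  nlinarith [mul_nonneg (sub_nonneg.2 h4) (by linarith : 0 ≤ A + B - 2 * √(u ^ 2 - 4))]

theorem ratioPrim_zero (hu : 2 < u) : ratioPrim u 0 = 0 := by
  unfold ratioPrim
  rw [mul_zero, sub_zero, Real.sqrt_sq (by linarith)]
  ring

theorem hasDerivAt_ratioPrim (hu : 2 < u) {s : ℝ} (hs : s ≤ 1) :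
    HasDerivAt (ratioPrim u) (Real.log (ratioRoot u s)) s := by
  have hD := ratioRoot_disc_pos hu hs
  have hR : HasDerivAt (fun s => √(u ^ 2 - 4 * s)) (-4 / (2 * √(u ^ 2 - 4 * s))) s := by
    have h : HasDerivAt (fun s : ℝ => u ^ 2 - 4 * s) (-4) s := by
      refine (((hasDerivAt_id s).const_mul 4).const_sub (u ^ 2)).congr_deriv ?_
      simp
    exact h.sqrt hD.ne'
  have hW : HasDerivAt (ratioRoot u) (-4 / (2 * √(u ^ 2 - 4 * s)) / 2) s :=
    (hR.const_add u).div_const 2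
  have hWpos : 0 < ratioRoot u s := lt_of_lt_of_le (by linarith) (ratioRoot_ge s)
  have h := ((((hasDerivAt_id s).fun_mul (hW.log hWpos.ne')).fun_sub
    ((hR.const_mul u).div_const 4)).fun_sub ((hasDerivAt_id s).div_const 2)).add_const (u ^ 2 / 4)
  refine h.congr_deriv ?_
  have hsq := ratioRoot_sq hu hs
  have hs' : s = u * ratioRoot u s - ratioRoot u s ^ 2 := by linarith
  have hRW : √(u ^ 2 - 4 * s) = 2 * ratioRoot u s - u := by unfold ratioRoot; ring
  have hRpos : 0 < √(u ^ 2 - 4 * s) := Real.sqrt_pos.2 hD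
  simp only [id]
  rw [hRW] at hRpos ⊢
  have e : s / ratioRoot u s = u - ratioRoot u s := by
    rw [div_eq_iff hWpos.ne']; linarith
  set W := ratioRoot u s
  have : s * (-4 / (2 * (2 * W - u)) / 2 / W) = (s / W) * (-4 / (2 * (2 * W - u)) / 2) := by ring
  rw [this, e]
  obtain ⟨R, hRe⟩ : ∃ R, R = 2 * W - u := ⟨_, rfl⟩
  rw [← hRe] at hRpos ⊢
  have hu' : u = 2 * W - R := by linarith
  rw [hu']
  field_simp
  ring

theorem ratioPrim_bounds (hu : 2 < u) {s t : ℝ} (hst : s < t) (ht : t ≤ 1) :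
    (t - s) * Real.log (ratioRoot u t) ≤ ratioPrim u t - ratioPrim u s ∧
      ratioPrim u t - ratioPrim u s ≤ (t - s) * Real.log (ratioRoot u s) := by
  obtain ⟨c, ⟨hc1, hc2⟩, hc⟩ := exists_hasDerivAt_eq_slope (ratioPrim u)
    (fun s => Real.log (ratioRoot u s)) hst
    (fun y hy => (hasDerivAt_ratioPrim hu (hy.2.trans ht)).continuousAt.continuousWithinAt)
    (fun y hy => hasDerivAt_ratioPrim hu (hy.2.le.trans ht))
  have hpos : ∀ s, 0 < ratioRoot u s := fun s => lt_of_lt_of_le (by linarith) (ratioRoot_ge s)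
  have hts : 0 < t - s := by linarith
  have e : ratioPrim u t - ratioPrim u s = (t - s) * Real.log (ratioRoot u c) := by
    rw [hc]; field_simp
  rw [e]
  exact ⟨mul_le_mul_of_nonneg_left (Real.log_le_log (hpos t) (ratioRoot_antitone hc2.le)) hts.le,
    mul_le_mul_of_nonneg_left (Real.log_le_log (hpos c) (ratioRoot_antitone hc1.le)) hts.le⟩

/-- The constant in the error bound for the ratios of a perturbed three-term recursion. -/
def ratioErr (u : ℝ) : ℝ := 4 / (u ^ 2 - 4) / √(u ^ 2 - 4)

theorem ratioErr_nonneg (hu : 2 < u) : 0 ≤ ratioErr u := by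
  have : 0 < u ^ 2 - 4 := by nlinarith
  unfold ratioErr
  positivity

theorem recursion_ratio_bounds (hu : 2 < u) {T : ℝ} (hT : 0 < T) {h : ℕ → ℝ} (h0 : h 0 = 1)
    (h1 : h 1 = u) (hrec : ∀ m, h (m + 2) = u * h (m + 1) - (m + 1) / T * h m) (m : ℕ)
    (hm : (m : ℝ) ≤ T) :
    0 < h m ∧ ratioRoot u (m / T) * h m ≤ h (m + 1) ∧
      h (m + 1) ≤ (ratioRoot u (m / T) + ratioErr u / T) * h m := by
  induction m with
  | zero =>
    simp only [h0, h1, Nat.cast_zero, zero_div, ratioRoot_zero hu]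
    have := ratioErr_nonneg hu
    refine ⟨one_pos, by linarith, ?_⟩
    have : 0 ≤ ratioErr u / T := by positivity
    linarith
  | succ m ih =>
    push_cast at hm ⊢
    obtain ⟨hp, hl, hh⟩ := ih (by linarith)
    set s : ℝ := (m + 1) / T with hs
    have hs1 : s ≤ 1 := by rw [hs, div_le_one hT]; exact hm
    have hs0 : 0 ≤ s := by positivity
    have hms : (m : ℝ) / T ≤ s := by rw [hs]; gcongr; linarith
    have hdiff : s - (m : ℝ) / T = 1 / T := by rw [hs]; ring
    have hW := ratioRoot_sq hu hs1
    have hWge := ratioRoot_ge (u := u) s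
    have hWanti := ratioRoot_antitone (u := u) hms
    have hWlip := ratioRoot_sub_le hu hms hs1
    rw [hdiff] at hWlip
    set W := ratioRoot u s
    have hWpos : 0 < W := by linarith
    have hWh : W * h m ≤ h (m + 1) :=
      (mul_le_mul_of_nonneg_right hWanti hp.le).trans hl
    have hp1 : 0 < h (m + 1) := lt_of_lt_of_le (by positivity) hWh
    have hsplit : h (m + 2) = W * h (m + 1) + s * (h (m + 1) - W * h m) / W := by
      rw [hrec, ← hs]
      have hsW : s = u * W - W ^ 2 := by linarith
      have : u = W + s / W := by field_simp; linarith
      rw [this]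
      field_simp
      ring
    refine ⟨hp1, ?_, ?_⟩
    · rw [show m + 1 + 1 = m + 2 from rfl, hsplit]
      have : 0 ≤ s * (h (m + 1) - W * h m) / W :=
        div_nonneg (mul_nonneg hs0 (by linarith)) hWpos.le
      linarith
    · rw [show m + 1 + 1 = m + 2 from rfl, hsplit, add_mul]
      gcongr
      have hR : 0 < √(u ^ 2 - 4) := Real.sqrt_pos.2 (by nlinarith)
      have hd : 0 < u ^ 2 - 4 := by nlinarith
      have hu0 : 0 < u := by linarith
      have b1 : h (m + 1) - W * h m ≤ (1 / T / √(u ^ 2 - 4) + ratioErr u / T) * h m := by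
        have := mul_le_mul_of_nonneg_right hWlip hp.le
        nlinarith
      have b2 : h m ≤ h (m + 1) / (u / 2) := by
        rw [le_div_iff₀ (by linarith)]
        nlinarith [mul_le_mul_of_nonneg_right hWge hp.le]
      have hE := ratioErr_nonneg hu
      have hcoef : 0 ≤ 1 / T / √(u ^ 2 - 4) + ratioErr u / T := by positivity
      have b3 : s * (h (m + 1) - W * h m) ≤
          (1 / T / √(u ^ 2 - 4) + ratioErr u / T) * (h (m + 1) / (u / 2)) := by
        calc s * (h (m + 1) - W * h m) ≤ 1 * (h (m + 1) - W * h m) :=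
              mul_le_mul_of_nonneg_right hs1 (by linarith)
          _ ≤ (1 / T / √(u ^ 2 - 4) + ratioErr u / T) * h m := by linarith
          _ ≤ _ := mul_le_mul_of_nonneg_left b2 hcoef
      calc s * (h (m + 1) - W * h m) / W
          ≤ (1 / T / √(u ^ 2 - 4) + ratioErr u / T) * (h (m + 1) / (u / 2)) / (u / 2) := by
            gcongr
        _ = ratioErr u / T * h (m + 1) := by
            unfold ratioErr
            field_simp
            ring

theorem recursion_log_bounds (hu : 2 < u) {T : ℝ} (hT : 0 < T) {h : ℕ → ℝ} (h0 : h 0 = 1)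
    (h1 : h 1 = u) (hrec : ∀ m, h (m + 2) = u * h (m + 1) - (m + 1) / T * h m) (m : ℕ)
    (hm : (m : ℝ) ≤ T) :
    T * ratioPrim u (m / T) ≤ Real.log (h m) ∧
      Real.log (h m) ≤ T * ratioPrim u (m / T) + ratioErr u * (m / T) +
        (Real.log u - Real.log (ratioRoot u (m / T))) := by
  induction m with
  | zero => simp [h0, ratioPrim_zero hu, ratioRoot_zero hu]
  | succ m ih =>
    push_cast at hm ⊢
    obtain ⟨il, iu⟩ := ih (by linarith)
    obtain ⟨hp, hl, hh⟩ := recursion_ratio_bounds hu hT h0 h1 hrec m (by linarith)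
    have hst : (m : ℝ) / T < (m + 1) / T := by gcongr; linarith
    have ht : ((m : ℝ) + 1) / T ≤ 1 := by rw [div_le_one hT]; exact hm
    obtain ⟨pl, pu⟩ := ratioPrim_bounds hu hst ht
    have hdiff : ((m : ℝ) + 1) / T - m / T = 1 / T := by ring
    rw [hdiff] at pl pu
    have hWge := ratioRoot_ge (u := u) ((m : ℝ) / T)
    set W := ratioRoot u ((m : ℝ) / T)
    set W' := ratioRoot u (((m : ℝ) + 1) / T)
    have hWpos : 0 < W := by linarith
    have hE := ratioErr_nonneg hu
    have hET : 0 ≤ ratioErr u / T := by positivity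
    have pl' : Real.log W' ≤
        T * ratioPrim u ((m + 1) / T) - T * ratioPrim u (m / T) := by
      have := mul_le_mul_of_nonneg_left pl hT.le
      rw [← mul_assoc, mul_one_div_cancel hT.ne', one_mul] at this
      linarith
    have pu' : T * ratioPrim u ((m + 1) / T) - T * ratioPrim u (m / T) ≤ Real.log W := by
      have := mul_le_mul_of_nonneg_left pu hT.le
      rw [← mul_assoc T (1 / T), mul_one_div_cancel hT.ne', one_mul] at this
      linarith
    have ll : Real.log W + Real.log (h m) ≤ Real.log (h (m + 1)) := by
      rw [← Real.log_mul hWpos.ne' hp.ne']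
      exact Real.log_le_log (by positivity) hl
    have lu : Real.log (h (m + 1)) ≤ Real.log W + ratioErr u / T + Real.log (h m) := by
      have hpos : 0 < h (m + 1) := lt_of_lt_of_le (by positivity) hl
      refine (Real.log_le_log hpos hh).trans ?_
      rw [Real.log_mul (by positivity) hp.ne']
      gcongr
      have : Real.log (W + ratioErr u / T) = Real.log W + Real.log (1 + ratioErr u / T / W) := by
        rw [← Real.log_mul hWpos.ne' (by positivity)]
        congr 1
        field_simp
      rw [this]
      gcongr
      have h3 := Real.log_le_sub_one_of_pos (by positivity : 0 < 1 + ratioErr u / T / W)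
      have h4 : ratioErr u / T / W ≤ ratioErr u / T := div_le_self hET (by linarith)
      linarith
    have e : ratioErr u * (((m : ℝ) + 1) / T) = ratioErr u * (m / T) + ratioErr u / T := by ring
    constructor
    · linarith
    · linarith

end ratioProfile

section hermiteOutside

theorem log_factorial_bounds (n : ℕ) :
    n - Real.log (n + 1) ≤ n * Real.log (n + 1) - Real.log n.factorial ∧
      n * Real.log (n + 1) - Real.log n.factorial ≤ n := by
  induction n with
  | zero => simp
  | succ n ih =>
    have hlog : Real.log ((n + 1).factorial) = Real.log (n + 1) + Real.log n.factorial := by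
      rw [Nat.factorial_succ]
      push_cast
      rw [Real.log_mul (by positivity) (by positivity)]
    rw [hlog]
    push_cast
    rw [show (n : ℝ) + 1 + 1 = n + 2 by ring]
    have hq : Real.log ((n + 2) / (n + 1)) = Real.log (n + 2) - Real.log (n + 1) :=
      Real.log_div (by positivity) (by positivity)
    have up := Real.log_le_sub_one_of_pos (by positivity : (0 : ℝ) < (n + 2) / (n + 1))
    have lo := Real.one_sub_inv_le_log_of_pos (by positivity : (0 : ℝ) < (n + 2) / (n + 1))
    rw [hq] at up lo
    have up' : (n + 1) * (Real.log (n + 2) - Real.log (n + 1)) ≤ 1 := by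
      refine (mul_le_mul_of_nonneg_left up (by positivity)).trans_eq ?_
      field_simp
      ring
    have lo' : 1 ≤ (n + 2) * (Real.log (n + 2) - Real.log (n + 1)) := by
      refine Eq.trans_le ?_ (mul_le_mul_of_nonneg_left lo (by positivity))
      field_simp
      ring
    constructor
    · nlinarith
    · nlinarith

/-- The exponential growth rate of `herm n (√(n+1) u) / √n!`. -/
def hermRate (u : ℝ) : ℝ :=
  Real.log ((u + √(u ^ 2 - 4)) / 2) - u * √(u ^ 2 - 4) / 4 + u ^ 2 / 4

theorem log_herm_bounds {u : ℝ} (hu : 2 < u) :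
    ∃ C, ∀ n : ℕ, |Real.log (herm n (√(n + 1) * u)) - Real.log n.factorial / 2 -
      (n + 1) * hermRate u| ≤ C + Real.log (n + 1) := by
  refine ⟨ratioErr u + Real.log u + 1, fun n => ?_⟩
  set T : ℝ := n + 1 with hTd
  have hT : 0 < T := by positivity
  have hsT : 0 < √T := Real.sqrt_pos.2 hT
  have hsT2 : √T ^ 2 = T := Real.sq_sqrt hT.le
  set h : ℕ → ℝ := fun m => herm m (√T * u) / √T ^ m with hh
  have hrec : ∀ m, h (m + 2) = u * h (m + 1) - (m + 1) / T * h m := by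
    intro m
    simp only [hh]
    rw [herm_succ_succ, pow_succ, pow_succ, show ((m : ℝ) + 1) / T = (m + 1) / √T ^ 2 by rw [hsT2]]
    clear_value h T
    generalize √T = r at hsT ⊢
    field_simp
  have h0 : h 0 = 1 := by simp [hh, herm_zero]
  have h1 : h 1 = u := by
    simp only [hh, herm_one, pow_one]
    field_simp
  have hnT : (n : ℝ) ≤ T := by linarith
  obtain ⟨hp, -, -⟩ := recursion_ratio_bounds hu hT h0 h1 hrec n hnT
  obtain ⟨bl, bu⟩ := recursion_log_bounds hu hT h0 h1 hrec n hnT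
  have hherm : herm n (√T * u) = √T ^ n * h n := by
    simp only [hh]; field_simp
  have hlog : Real.log (herm n (√T * u)) = n * Real.log T / 2 + Real.log (h n) := by
    rw [hherm, Real.log_mul (by positivity) hp.ne', Real.log_pow, Real.log_sqrt hT.le]
    ring
  obtain ⟨fl, fu⟩ := log_factorial_bounds n
  rw [← hTd] at fl fu
  have hst : (n : ℝ) / T < 1 := by rw [div_lt_one hT]; linarith
  obtain ⟨pl, pu⟩ := ratioPrim_bounds hu hst le_rfl
  have hdiff : 1 - (n : ℝ) / T = 1 / T := by
    rw [hTd]; field_simp; ring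
  rw [hdiff] at pl pu
  have hge1 := ratioRoot_ge (u := u) 1
  have hgen := ratioRoot_ge (u := u) ((n : ℝ) / T)
  have hlen : ratioRoot u ((n : ℝ) / T) ≤ u := by
    rw [← ratioRoot_zero hu]
    simpa [ratioRoot_zero hu] using ratioRoot_antitone (u := u) (by positivity : 0 ≤ (n : ℝ) / T)
  have l1 : 0 ≤ Real.log (ratioRoot u 1) := Real.log_nonneg (by linarith)
  have l2 : 0 ≤ Real.log (ratioRoot u ((n : ℝ) / T)) := Real.log_nonneg (by linarith)
  have l3 : Real.log (ratioRoot u ((n : ℝ) / T)) ≤ Real.log u :=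
    Real.log_le_log (by linarith) hlen
  have pl' : Real.log (ratioRoot u 1) ≤ T * ratioPrim u 1 - T * ratioPrim u (n / T) := by
    have := mul_le_mul_of_nonneg_left pl hT.le
    rw [← mul_assoc, mul_one_div_cancel hT.ne', one_mul] at this
    linarith
  have pu' : T * ratioPrim u 1 - T * ratioPrim u (n / T) ≤
      Real.log (ratioRoot u ((n : ℝ) / T)) := by
    have := mul_le_mul_of_nonneg_left pu hT.le
    rw [← mul_assoc T (1 / T), mul_one_div_cancel hT.ne', one_mul] at this
    linarith
  have hE : ratioErr u * ((n : ℝ) / T) ≤ ratioErr u :=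
    mul_le_of_le_one_right (ratioErr_nonneg hu) hst.le
  have hE0 := ratioErr_nonneg hu
  have hrate : T * hermRate u = T * ratioPrim u 1 + T / 2 := by
    unfold hermRate ratioPrim ratioRoot
    rw [mul_one]
    ring
  have hlT : 0 ≤ Real.log T := Real.log_nonneg (by rw [hTd]; linarith [Nat.cast_nonneg (α := ℝ) n])
  rw [hlog, hrate, abs_le]
  have hTn : T = n + 1 := hTd
  constructor
  · linarith
  · linarith

end hermiteOutside

section rates

theorem eventually_poly_mul_exp_sqrt_le (C D : ℝ) (k : ℕ) {ε : ℝ} (hε : 0 < ε) :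
    ∀ᶠ n : ℕ in atTop,
      C * ((n : ℝ) + 1) ^ k * Real.exp (D * √((n : ℝ) + 1)) ≤ Real.exp (((n : ℝ) + 1) * ε) := by
  have hy : Tendsto (fun n : ℕ => √((n : ℝ) + 1)) atTop atTop :=
    Real.tendsto_sqrt_atTop.comp (tendsto_atTop_add_const_right _ 1 tendsto_natCast_atTop_atTop)
  have h0 : Tendsto (fun y : ℝ => |C| * (y ^ (2 * k) * Real.exp (-y))) atTop (nhds 0) := by
    simpa using (Real.tendsto_pow_mul_exp_neg_atTop_nhds_zero (2 * k)).const_mul |C|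
  have hev : ∀ᶠ y : ℝ in atTop, |C| * (y ^ (2 * k) * Real.exp (-y)) ≤ 1 :=
    h0.eventually_le_const zero_lt_one
  filter_upwards [hy.eventually hev, hy.eventually_ge_atTop ((D + 1) / ε)] with n h1 h2
  have hsq : √((n : ℝ) + 1) ^ 2 = n + 1 := Real.sq_sqrt (by positivity)
  set y := √((n : ℝ) + 1)
  have hy0 : 0 ≤ y := Real.sqrt_nonneg _
  rw [div_le_iff₀ hε] at h2
  have h3 : D * y - y ^ 2 * ε ≤ -y := by nlinarith
  rw [← hsq, ← pow_mul]
  calc C * y ^ (2 * k) * Real.exp (D * y)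
      ≤ |C| * y ^ (2 * k) * Real.exp (D * y) := by gcongr; exact le_abs_self C
    _ ≤ |C| * y ^ (2 * k) * Real.exp (-y + y ^ 2 * ε) := by gcongr; linarith
    _ = |C| * (y ^ (2 * k) * Real.exp (-y)) * Real.exp (y ^ 2 * ε) := by
      rw [Real.exp_add]; ring
    _ ≤ 1 * Real.exp (y ^ 2 * ε) := by gcongr
    _ = _ := one_mul _

/-- Upper exponential rate (in `n + 1`) of a sequence in `ℝ≥0∞`. -/
def UpperRate (E : ℕ → ℝ≥0∞) (s : ℝ) : Prop :=
  ∀ ε > 0, ∀ᶠ n : ℕ in atTop, E n ≤ ENNReal.ofReal (Real.exp (((n : ℝ) + 1) * (s + ε)))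

/-- Lower exponential rate (in `n + 1`) of a sequence in `ℝ≥0∞`. -/
def LowerRate (E : ℕ → ℝ≥0∞) (s : ℝ) : Prop :=
  ∀ ε > 0, ∀ᶠ n : ℕ in atTop, ENNReal.ofReal (Real.exp (((n : ℝ) + 1) * (s - ε))) ≤ E n

theorem UpperRate.of_le {E : ℕ → ℝ≥0∞} {s : ℝ} (C : ℝ) (k : ℕ)
    (h : ∀ᶠ n : ℕ in atTop, E n ≤
      ENNReal.ofReal (C * ((n : ℝ) + 1) ^ k * Real.exp (((n : ℝ) + 1) * s))) : UpperRate E s := by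
  intro ε hε
  filter_upwards [h, eventually_poly_mul_exp_sqrt_le C 0 k hε] with n h1 h2
  refine h1.trans (ENNReal.ofReal_le_ofReal ?_)
  rw [zero_mul, Real.exp_zero, mul_one] at h2
  rw [mul_add, Real.exp_add, mul_comm (Real.exp (((n : ℝ) + 1) * s))]
  gcongr

theorem LowerRate.of_le {E : ℕ → ℝ≥0∞} {s : ℝ} {C : ℝ} (hC : 0 < C) (D : ℝ) (k : ℕ)
    (h : ∀ᶠ n : ℕ in atTop, ENNReal.ofReal (Real.exp (((n : ℝ) + 1) * s) /
      (C * ((n : ℝ) + 1) ^ k * Real.exp (D * √((n : ℝ) + 1)))) ≤ E n) : LowerRate E s := by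
  intro ε hε
  filter_upwards [h, eventually_poly_mul_exp_sqrt_le C D k hε] with n h1 h2
  refine (ENNReal.ofReal_le_ofReal ?_).trans h1
  rw [le_div_iff₀ (by positivity)]
  calc Real.exp (((n : ℝ) + 1) * (s - ε)) *
        (C * ((n : ℝ) + 1) ^ k * Real.exp (D * √((n : ℝ) + 1)))
      ≤ Real.exp (((n : ℝ) + 1) * (s - ε)) * Real.exp (((n : ℝ) + 1) * ε) := by gcongr
    _ = _ := by rw [← Real.exp_add]; ring_nf

theorem tendsto_log_div_of_rates {E : ℕ → ℝ≥0∞} {s : ℝ} (hu : UpperRate E s)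
    (hl : LowerRate E s) :
    Tendsto (fun n : ℕ => Real.log (E n).toReal / ((n : ℝ) + 1)) atTop (nhds s) := by
  rw [Metric.tendsto_nhds]
  intro ε hε
  filter_upwards [hu (ε / 2) (by linarith), hl (ε / 2) (by linarith)] with n h1 h2
  have hfin : E n ≠ ⊤ := ne_top_of_le_ne_top ENNReal.ofReal_ne_top h1
  have h1' : (E n).toReal ≤ Real.exp (((n : ℝ) + 1) * (s + ε / 2)) :=
    ENNReal.toReal_le_of_le_ofReal (Real.exp_pos _).le h1
  have h2' : Real.exp (((n : ℝ) + 1) * (s - ε / 2)) ≤ (E n).toReal :=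
    (ENNReal.ofReal_le_iff_le_toReal hfin).1 h2
  have hpos : 0 < (E n).toReal := (Real.exp_pos _).trans_le h2'
  have l1 : Real.log (E n).toReal ≤ ((n : ℝ) + 1) * (s + ε / 2) :=
    (Real.log_le_iff_le_exp hpos).2 h1'
  have l2 : ((n : ℝ) + 1) * (s - ε / 2) ≤ Real.log (E n).toReal :=
    (Real.le_log_iff_exp_le hpos).2 h2'
  have hn : (0 : ℝ) < n + 1 := by positivity
  have g1 : Real.log (E n).toReal / ((n : ℝ) + 1) ≤ s + ε / 2 := by
    rw [div_le_iff₀ hn]; linarith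
  have g2 : s - ε / 2 ≤ Real.log (E n).toReal / ((n : ℝ) + 1) := by
    rw [le_div_iff₀ hn]; linarith
  rw [Real.dist_eq, abs_lt]
  constructor <;> linarith

theorem LowerRate.of_approx {ι : Type*} {E : ι → ℕ → ℝ≥0∞} {F : ℕ → ℝ≥0∞} {s : ℝ}
    (h : ∀ ε > 0, ∃ i s', s - ε ≤ s' ∧ LowerRate (E i) s' ∧ ∀ n, E i n ≤ F n) :
    LowerRate F s := by
  intro ε hε
  obtain ⟨i, s', hs, hl, hle⟩ := h (ε / 2) (by linarith)
  filter_upwards [hl (ε / 2) (by linarith)] with n hn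
  refine le_trans (ENNReal.ofReal_le_ofReal ?_) (hn.trans (hle n))
  rw [Real.exp_le_exp]
  exact mul_le_mul_of_nonneg_left (by linarith) (by positivity)

end rates

section meanCount

/-- The ratio between the energy scale and the matrix scale. -/
def pK (p : ℕ) : ℝ := √((p : ℝ) / (p - 1))

/-- The Gaussian exponent left over after removing the Hermite weight `x²/4`. -/
def pκ (p : ℕ) : ℝ := ((p : ℝ) - 2) / (4 * p)

/-- The mean number of critical points above level `η` in dimension `n + 1`. -/
def meanCrt (p : ℕ) (η : ℝ) (n : ℕ) : ℝ≥0∞ :=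
  ENNReal.ofReal (√((p : ℝ) - 1) ^ n) * krConst n *
    ∫⁻ z in Set.Ici (√((n + 1 : ℕ) : ℝ) * η), absDet n (√((p : ℝ) / (p - 1)) * z)
      ∂(gaussianReal 0 1)

theorem meanCrt_antitone (p : ℕ) {η η' : ℝ} (h : η ≤ η') (n : ℕ) :
    meanCrt p η' n ≤ meanCrt p η n := by
  unfold meanCrt
  gcongr

variable {p : ℕ}

theorem pK_pos (hp : 3 ≤ p) : 0 < pK p := by
  have : (3 : ℝ) ≤ p := by exact_mod_cast hp
  exact Real.sqrt_pos.2 (div_pos (by linarith) (by linarith))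

theorem pK_sq (hp : 3 ≤ p) : pK p ^ 2 = p / (p - 1) := by
  have : (3 : ℝ) ≤ p := by exact_mod_cast hp
  exact Real.sq_sqrt (div_nonneg (by linarith) (by linarith))

theorem pκ_pos (hp : 3 ≤ p) : 0 < pκ p := by
  have : (3 : ℝ) ≤ p := by exact_mod_cast hp
  exact div_pos (by linarith) (by linarith)

/-- The normalization of the Gaussian density. -/
def pc (p : ℕ) : ℝ := (√(2 * Real.pi * pK p ^ 2))⁻¹

theorem pc_pos (hp : 3 ≤ p) : 0 < pc p := by
  have := pK_pos hp
  unfold pc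
  positivity

theorem density_eq (hp : 3 ≤ p) (x : ℝ) :
    (√(2 * Real.pi * pK p ^ 2))⁻¹ * Real.exp (-(x ^ 2 / (2 * pK p ^ 2))) =
      pc p * Real.exp (-((1 / 4 + pκ p) * x ^ 2)) := by
  have h3 : (3 : ℝ) ≤ p := by exact_mod_cast hp
  have h1 : (p : ℝ) - 1 ≠ 0 := by linarith
  have h2 : (p : ℝ) ≠ 0 := by linarith
  have : x ^ 2 / (2 * pK p ^ 2) = (1 / 4 + pκ p) * x ^ 2 := by
    rw [pK_sq hp, pκ]
    field_simp
    ring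
  rw [this, pc]

theorem setLIntegral_weight (hp : 3 ≤ p) {f : ℝ → ℝ} (hf : Continuous f) (η : ℝ) (n : ℕ) :
    ∫⁻ z in Set.Ici (√((n + 1 : ℕ) : ℝ) * η), ENNReal.ofReal (f (pK p * z)) ∂(gaussianReal 0 1) =
      ENNReal.ofReal (pc p) * ∫⁻ x in Set.Ici (√((n : ℝ) + 1) * (pK p * η)),
        ENNReal.ofReal (Real.exp (-((1 / 4 + pκ p) * x ^ 2)) * f x) := by
  rw [setLIntegral_gaussianReal_comp_mul (pK_pos hp) (f := fun x => ENNReal.ofReal (f x))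
    hf.measurable.ennreal_ofReal, ← lintegral_const_mul _ (by fun_prop)]
  push_cast
  rw [show pK p * (√((n : ℝ) + 1) * η) = √((n : ℝ) + 1) * (pK p * η) by ring]
  refine lintegral_congr fun x => ?_
  have := pc_pos hp
  rw [density_eq hp, ← ENNReal.ofReal_mul (by positivity), ← ENNReal.ofReal_mul (by positivity),
    mul_assoc]

theorem meanCrt_le (hp : 3 ≤ p) {n : ℕ} (hn : 4 ≤ n) {η B : ℝ} (hB : 0 ≤ B)
    (h : ∫⁻ x in Set.Ici (√((n : ℝ) + 1) * (pK p * η)),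
        ENNReal.ofReal (Real.exp (-((1 / 4 + pκ p) * x ^ 2)) *
          √(n.factorial * ((n + 1) * hermKer n x))) ≤ ENNReal.ofReal (√(n.factorial) * B)) :
    meanCrt p η n ≤ ENNReal.ofReal (√((p : ℝ) - 1) ^ n * (2 * (n + 1)) * pc p * B) := by
  obtain ⟨A, hA, hkr, -, hA2⟩ := krConst_bounds hn
  have hc := pc_pos hp
  have hAf : A * √(n.factorial) ≤ 2 * (n + 1) := by
    refine abs_le_of_sq_le_sq' ?_ (by positivity) |>.2
    rw [mul_pow, Real.sq_sqrt (by positivity)]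
    nlinarith [Nat.cast_nonneg (α := ℝ) n]
  have hI : ∫⁻ z in Set.Ici (√((n + 1 : ℕ) : ℝ) * η), absDet n (√((p : ℝ) / (p - 1)) * z)
      ∂(gaussianReal 0 1) ≤ ENNReal.ofReal (pc p * (√(n.factorial) * B)) := by
    have hcont : Continuous fun x => √(n.factorial * ((n + 1) * hermKer n x)) := by
      have := continuous_hermKer n
      fun_prop
    refine (lintegral_mono fun z => absDet_le n _).trans ?_
    refine (setLIntegral_weight hp hcont η n).trans_le ?_
    rw [ENNReal.ofReal_mul hc.le]
    gcongr
  unfold meanCrt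
  rw [hkr, ← ENNReal.ofReal_mul (by positivity)]
  refine (mul_le_mul_right hI _).trans ?_
  rw [← ENNReal.ofReal_mul (by positivity)]
  refine ENNReal.ofReal_le_ofReal ?_
  calc √((p : ℝ) - 1) ^ n * A * (pc p * (√(n.factorial) * B))
      = √((p : ℝ) - 1) ^ n * (A * √(n.factorial)) * pc p * B := by ring
    _ ≤ _ := by gcongr

theorem le_meanCrt (hp : 3 ≤ p) {n : ℕ} (hn : 4 ≤ n) {η b : ℝ} (hb : 0 ≤ b)
    (h : ENNReal.ofReal (√(n.factorial) * b) ≤ ∫⁻ x in Set.Ici (√((n : ℝ) + 1) * (pK p * η)),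
        ENNReal.ofReal (Real.exp (-((1 / 4 + pκ p) * x ^ 2)) * |herm n x|)) :
    ENNReal.ofReal (√((p : ℝ) - 1) ^ n * pc p * b) ≤ meanCrt p η n := by
  obtain ⟨A, hA, hkr, hA2, -⟩ := krConst_bounds hn
  have hc := pc_pos hp
  have hAf : 1 ≤ A * √(n.factorial) := by
    refine abs_le_of_sq_le_sq' ?_ (by positivity) |>.2
    rw [mul_pow, Real.sq_sqrt (by positivity)]
    linarith
  have hI : ENNReal.ofReal (pc p * (√(n.factorial) * b)) ≤
      ∫⁻ z in Set.Ici (√((n + 1 : ℕ) : ℝ) * η), absDet n (√((p : ℝ) / (p - 1)) * z)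
      ∂(gaussianReal 0 1) := by
    have hcont : Continuous fun x => |herm n x| := (continuous_herm n).abs
    refine le_trans ?_ (lintegral_mono fun z => ofReal_abs_herm_le_absDet n _)
    refine le_trans ?_ (setLIntegral_weight hp hcont η n).ge
    rw [ENNReal.ofReal_mul hc.le]
    gcongr
  unfold meanCrt
  rw [hkr, ← ENNReal.ofReal_mul (by positivity)]
  refine le_trans ?_ (mul_le_mul_right hI _)
  rw [← ENNReal.ofReal_mul (by positivity)]
  refine ENNReal.ofReal_le_ofReal ?_
  calc √((p : ℝ) - 1) ^ n * pc p * b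
      = √((p : ℝ) - 1) ^ n * 1 * pc p * b := by ring
    _ ≤ √((p : ℝ) - 1) ^ n * (A * √(n.factorial)) * pc p * b := by gcongr
    _ = _ := by ring

theorem sqrt_pow_eq (hp : 3 ≤ p) (n : ℕ) :
    √((p : ℝ) - 1) ^ n = Real.exp (((n : ℝ) + 1) * (Real.log ((p : ℝ) - 1) / 2)) /
      √((p : ℝ) - 1) := by
  have h3 : (3 : ℝ) ≤ p := by exact_mod_cast hp
  have h1 : 0 < (p : ℝ) - 1 := by linarith
  have hs : 0 < √((p : ℝ) - 1) := Real.sqrt_pos.2 h1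
  rw [eq_div_iff hs.ne', ← pow_succ, ← Real.log_sqrt h1.le]
  have := Real.exp_nat_mul (Real.log √((p : ℝ) - 1)) (n + 1)
  rw [Real.exp_log hs] at this
  rw [← this]
  push_cast
  rfl

theorem sqrt_pow_le (hp : 3 ≤ p) (n : ℕ) :
    √((p : ℝ) - 1) ^ n ≤ Real.exp (((n : ℝ) + 1) * (Real.log ((p : ℝ) - 1) / 2)) := by
  have h3 : (3 : ℝ) ≤ p := by exact_mod_cast hp
  rw [sqrt_pow_eq hp]
  refine div_le_self (Real.exp_pos _).le ?_
  rw [Real.one_le_sqrt]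
  linarith

theorem upperRate_bulk (hp : 3 ≤ p) {η w : ℝ} (hw : 0 ≤ w) (h : w = 0 ∨ w = η) :
    UpperRate (meanCrt p η)
      (Real.log ((p : ℝ) - 1) / 2 - pκ p * (pK p * w) ^ 2) := by
  have hκ := pκ_pos hp
  have hc := pc_pos hp
  have hK := pK_pos hp
  set C0 : ℝ := (√(2 * Real.pi) + √(Real.pi / (2 * pκ p))) / 2 with hC0
  refine UpperRate.of_le (2 * pc p * C0) 3 ?_
  filter_upwards [eventually_ge_atTop 4] with n hn
  have hN1 : (1 : ℝ) ≤ (n : ℝ) + 1 := by linarith [Nat.cast_nonneg (α := ℝ) n]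
  have hy : ∀ x ∈ Set.Ici (√((n : ℝ) + 1) * (pK p * η)),
      0 ≤ √((n : ℝ) + 1) * (pK p * w) * (x - √((n : ℝ) + 1) * (pK p * w)) := by
    intro x hx
    rcases h with h | h
    · simp [h]
    · rw [h] at hw ⊢
      exact mul_nonneg (by positivity) (sub_nonneg.2 hx)
  have h1 := setLIntegral_kernel_le hκ measurableSet_Ici hy n
  rw [mul_assoc (√(n.factorial : ℝ))] at h1
  refine (meanCrt_le hp hn (by positivity) h1).trans (ENNReal.ofReal_le_ofReal ?_)
  have hs1 : √((n : ℝ) + 1) ≤ n + 1 := Real.sqrt_le_iff.2 ⟨by linarith, by nlinarith⟩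
  have e1 : (√((n : ℝ) + 1) * (pK p * w)) ^ 2 = (n + 1) * (pK p * w) ^ 2 := by
    rw [mul_pow, Real.sq_sqrt (by positivity)]
  have e2 : Real.exp (((n : ℝ) + 1) * (Real.log ((p : ℝ) - 1) / 2 - pκ p * (pK p * w) ^ 2)) =
      Real.exp (((n : ℝ) + 1) * (Real.log ((p : ℝ) - 1) / 2)) *
        Real.exp (-(pκ p * (((n : ℝ) + 1) * (pK p * w) ^ 2))) := by
    rw [← Real.exp_add]; ring_nf
  have e3 : (√(2 * Real.pi) * ((n : ℝ) + 1) + √(Real.pi / (2 * pκ p))) / 2 ≤ C0 * (n + 1) := by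
    have := Real.sqrt_nonneg (Real.pi / (2 * pκ p))
    rw [hC0]
    nlinarith
  rw [e1, e2]
  calc √((p : ℝ) - 1) ^ n * (2 * ((n : ℝ) + 1)) * pc p *
        (√((n : ℝ) + 1) * ((√(2 * Real.pi) * (n + 1) + √(Real.pi / (2 * pκ p))) / 2) *
          Real.exp (-(pκ p * (((n : ℝ) + 1) * (pK p * w) ^ 2))))
      ≤ Real.exp (((n : ℝ) + 1) * (Real.log ((p : ℝ) - 1) / 2)) * (2 * ((n : ℝ) + 1)) * pc p *
        (((n : ℝ) + 1) * (C0 * (n + 1)) *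
          Real.exp (-(pκ p * (((n : ℝ) + 1) * (pK p * w) ^ 2)))) := by
        gcongr
        exact sqrt_pow_le hp n
    _ = _ := by ring

/-- The exponential rate above the threshold, in the matrix scale `u`. -/
def outRate (p : ℕ) (u : ℝ) : ℝ :=
  Real.log ((p : ℝ) - 1) / 2 + hermRate u - (1 / 4 + pκ p) * u ^ 2

theorem out_condition {u : ℝ} (hu : 2 < u) (n : ℕ) :
    0 < √((n : ℝ) + 1) * u ∧ 4 * (n : ℝ) ≤ (√((n : ℝ) + 1) * u) ^ 2 := by
  have : 0 < √((n : ℝ) + 1) := Real.sqrt_pos.2 (by positivity)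
  refine ⟨by positivity, ?_⟩
  rw [mul_pow, Real.sq_sqrt (by positivity)]
  have hn := Nat.cast_nonneg (α := ℝ) n
  have hu4 : 4 ≤ u ^ 2 := by nlinarith
  nlinarith [mul_le_mul_of_nonneg_left hu4 (by positivity : (0 : ℝ) ≤ (n : ℝ) + 1)]

theorem upperRate_out (hp : 3 ≤ p) {η : ℝ} (hη : 2 < pK p * η) :
    UpperRate (meanCrt p η) (outRate p (pK p * η)) := by
  have hκ := pκ_pos hp
  have hc := pc_pos hp
  obtain ⟨C, hC⟩ := log_herm_bounds hη
  set u := pK p * η with hu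
  refine UpperRate.of_le (2 * pc p * √(Real.pi / pκ p) * Real.exp C) 3 ?_
  filter_upwards [eventually_ge_atTop 4] with n hn
  obtain ⟨hx0, hx4⟩ := out_condition hη n
  have hherm := (herm_ratio hx0 n hx4).1
  have hf : (0 : ℝ) < √(n.factorial) := Real.sqrt_pos.2 (by positivity)
  have hb : herm n (√((n : ℝ) + 1) * u) / √(n.factorial) ≤
      Real.exp C * (n + 1) * Real.exp (((n : ℝ) + 1) * hermRate u) := by
    have := (abs_le.1 (hC n)).2
    rw [← Real.log_le_log_iff (by positivity) (by positivity),
      Real.log_div hherm.ne' hf.ne', Real.log_sqrt (by positivity),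
      Real.log_mul (by positivity) (by positivity), Real.log_mul (by positivity) (by positivity),
      Real.log_exp, Real.log_exp]
    linarith
  have h1 := setLIntegral_kernel_le_herm hκ hx0 hx4
  have e0 : √(Real.pi / pκ p) * ((n : ℝ) + 1) * herm n (√((n : ℝ) + 1) * u) *
      Real.exp (-((1 / 4 + pκ p) * (√((n : ℝ) + 1) * u) ^ 2)) =
      √(n.factorial) * (√(Real.pi / pκ p) * ((n : ℝ) + 1) *
        (herm n (√((n : ℝ) + 1) * u) / √(n.factorial)) *
      Real.exp (-((1 / 4 + pκ p) * (√((n : ℝ) + 1) * u) ^ 2))) := by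
    field_simp
  rw [e0] at h1
  refine (meanCrt_le hp hn (by positivity) h1).trans (ENNReal.ofReal_le_ofReal ?_)
  have e1 : (√((n : ℝ) + 1) * u) ^ 2 = (n + 1) * u ^ 2 := by
    rw [mul_pow, Real.sq_sqrt (by positivity)]
  have e2 : Real.exp (((n : ℝ) + 1) * outRate p u) =
      Real.exp (((n : ℝ) + 1) * (Real.log ((p : ℝ) - 1) / 2)) *
        Real.exp (((n : ℝ) + 1) * hermRate u) *
        Real.exp (-((1 / 4 + pκ p) * (((n : ℝ) + 1) * u ^ 2))) := by
    rw [← Real.exp_add, ← Real.exp_add, outRate]; ring_nf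
  rw [e1, e2]
  calc √((p : ℝ) - 1) ^ n * (2 * ((n : ℝ) + 1)) * pc p * (√(Real.pi / pκ p) * ((n : ℝ) + 1) *
        (herm n (√((n : ℝ) + 1) * u) / √(n.factorial)) *
      Real.exp (-((1 / 4 + pκ p) * (((n : ℝ) + 1) * u ^ 2))))
      ≤ Real.exp (((n : ℝ) + 1) * (Real.log ((p : ℝ) - 1) / 2)) * (2 * ((n : ℝ) + 1)) * pc p *
        (√(Real.pi / pκ p) * ((n : ℝ) + 1) *
        (Real.exp C * (n + 1) * Real.exp (((n : ℝ) + 1) * hermRate u)) *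
      Real.exp (-((1 / 4 + pκ p) * (((n : ℝ) + 1) * u ^ 2)))) := by
        gcongr
        exact sqrt_pow_le hp n
    _ = _ := by ring

theorem sq_shift_eq (n : ℕ) (u : ℝ) :
    (√((n : ℝ) + 1) * u + 1) ^ 2 = (n + 1) * u ^ 2 + 2 * u * √((n : ℝ) + 1) + 1 := by
  have := Real.sq_sqrt (by positivity : (0 : ℝ) ≤ (n : ℝ) + 1)
  linear_combination u ^ 2 * this

theorem lowerRate_out (hp : 3 ≤ p) {η : ℝ} (hη : 2 < pK p * η) :
    LowerRate (meanCrt p η) (outRate p (pK p * η)) := by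
  have h3 : (3 : ℝ) ≤ p := by exact_mod_cast hp
  have hκ := pκ_pos hp
  have hc := pc_pos hp
  obtain ⟨C, hC⟩ := log_herm_bounds hη
  set u := pK p * η with hu
  have hs : 0 < √((p : ℝ) - 1) := Real.sqrt_pos.2 (by linarith)
  refine LowerRate.of_le (C := √((p : ℝ) - 1) / pc p * Real.exp C * Real.exp (1 / 4 + pκ p))
    (by positivity) ((1 / 4 + pκ p) * (2 * u)) 1 ?_
  filter_upwards [eventually_ge_atTop 4] with n hn
  obtain ⟨hx0, hx4⟩ := out_condition hη n
  have hherm := (herm_ratio hx0 n hx4).1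
  have hf : (0 : ℝ) < √(n.factorial) := Real.sqrt_pos.2 (by positivity)
  have hb : Real.exp (((n : ℝ) + 1) * hermRate u) / (Real.exp C * (n + 1)) ≤
      herm n (√((n : ℝ) + 1) * u) / √(n.factorial) := by
    have := (abs_le.1 (hC n)).1
    rw [← Real.log_le_log_iff (by positivity) (by positivity),
      Real.log_div hherm.ne' hf.ne', Real.log_sqrt (by positivity),
      Real.log_div (by positivity) (by positivity), Real.log_mul (by positivity) (by positivity),
      Real.log_exp, Real.log_exp]
    linarith
  have h1 := le_setLIntegral_herm hκ hx0 hx4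
  have e0 : herm n (√((n : ℝ) + 1) * u) *
      Real.exp (-((1 / 4 + pκ p) * (√((n : ℝ) + 1) * u + 1) ^ 2)) =
      √(n.factorial) * ((herm n (√((n : ℝ) + 1) * u) / √(n.factorial)) *
      Real.exp (-((1 / 4 + pκ p) * (√((n : ℝ) + 1) * u + 1) ^ 2))) := by
    field_simp
  rw [e0] at h1
  refine le_trans (ENNReal.ofReal_le_ofReal ?_) (le_meanCrt hp hn (by positivity) h1)
  have e2 : Real.exp (-((1 / 4 + pκ p) * (√((n : ℝ) + 1) * u + 1) ^ 2)) =
      Real.exp (-((1 / 4 + pκ p) * (((n : ℝ) + 1) * u ^ 2))) /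
        (Real.exp ((1 / 4 + pκ p) * (2 * u) * √((n : ℝ) + 1)) * Real.exp (1 / 4 + pκ p)) := by
    rw [← Real.exp_add, ← Real.exp_sub, sq_shift_eq]; ring_nf
  have e3 : Real.exp (((n : ℝ) + 1) * outRate p u) =
      Real.exp (((n : ℝ) + 1) * (Real.log ((p : ℝ) - 1) / 2)) *
        Real.exp (((n : ℝ) + 1) * hermRate u) *
        Real.exp (-((1 / 4 + pκ p) * (((n : ℝ) + 1) * u ^ 2))) := by
    rw [← Real.exp_add, ← Real.exp_add, outRate]; ring_nf
  rw [e2, e3]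
  refine le_trans (le_of_eq ?_) (mul_le_mul_of_nonneg_left (mul_le_mul_of_nonneg_right hb
    (by positivity)) (by positivity))
  rw [sqrt_pow_eq hp]
  field_simp

theorem eventually_bulk_condition {u : ℝ} (hu0 : 0 < u) (hu : u < 2) :
    ∀ᶠ n : ℕ in atTop, (√((n : ℝ) + 1) * u + 1) ^ 2 / 4 ≤ n := by
  have hy : Tendsto (fun n : ℕ => √((n : ℝ) + 1)) atTop atTop :=
    Real.tendsto_sqrt_atTop.comp (tendsto_atTop_add_const_right _ 1 tendsto_natCast_atTop_atTop)
  have hd : 0 < 4 - u ^ 2 := by nlinarith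
  filter_upwards [hy.eventually_ge_atTop ((2 * u + 5) / (4 - u ^ 2)),
    hy.eventually_ge_atTop 1] with n h1 h2
  rw [div_le_iff₀ hd] at h1
  have hsq := Real.sq_sqrt (by positivity : (0 : ℝ) ≤ (n : ℝ) + 1)
  rw [sq_shift_eq]
  nlinarith

theorem lowerRate_bulk (hp : 3 ≤ p) {η : ℝ} (hη0 : 0 < η) (hη : pK p * η < 2) :
    LowerRate (meanCrt p η)
      (Real.log ((p : ℝ) - 1) / 2 - pκ p * (pK p * η) ^ 2) := by
  have h3 : (3 : ℝ) ≤ p := by exact_mod_cast hp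
  have hκ := pκ_pos hp
  have hc := pc_pos hp
  have hK := pK_pos hp
  set u := pK p * η with hu
  have hu0 : 0 < u := by positivity
  have hs : 0 < √((p : ℝ) - 1) := Real.sqrt_pos.2 (by linarith)
  refine LowerRate.of_le (C := √((p : ℝ) - 1) / pc p * 100 * Real.exp (pκ p))
    (by positivity) (pκ p * (2 * u)) 2 ?_
  filter_upwards [eventually_ge_atTop 4, eventually_bulk_condition hu0 hη] with n hn hcond
  obtain ⟨m, rfl⟩ : ∃ m, n = m + 1 := ⟨n - 1, by omega⟩
  have ha : 0 ≤ √(((m + 1 : ℕ) : ℝ) + 1) * u := by positivity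
  have h1 := le_setLIntegral_herm_bulk hκ ha m (by exact_mod_cast hcond)
  rw [div_eq_mul_one_div, mul_assoc] at h1
  refine le_trans (ENNReal.ofReal_le_ofReal ?_) (le_meanCrt hp hn (by positivity) h1)
  have e2 : Real.exp (-(pκ p * (√(((m + 1 : ℕ) : ℝ) + 1) * u + 1) ^ 2)) =
      Real.exp (-(pκ p * ((((m + 1 : ℕ) : ℝ) + 1) * u ^ 2))) /
        (Real.exp (pκ p * (2 * u) * √(((m + 1 : ℕ) : ℝ) + 1)) * Real.exp (pκ p)) := by
    rw [← Real.exp_add, ← Real.exp_sub, sq_shift_eq]; ring_nf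
  have e3 : Real.exp ((((m + 1 : ℕ) : ℝ) + 1) * (Real.log ((p : ℝ) - 1) / 2 - pκ p * u ^ 2)) =
      Real.exp ((((m + 1 : ℕ) : ℝ) + 1) * (Real.log ((p : ℝ) - 1) / 2)) *
        Real.exp (-(pκ p * ((((m + 1 : ℕ) : ℝ) + 1) * u ^ 2))) := by
    rw [← Real.exp_add]; ring_nf
  have hm := Nat.cast_nonneg (α := ℝ) m
  have hb : 1 / (100 * (((m + 1 : ℕ) : ℝ) + 1) ^ 2) ≤
      1 / (√(2 * ((m : ℝ) + 1)) * (2 * m + 43)) := by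
    refine one_div_le_one_div_of_le (by positivity) ?_
    have hs2 : √(2 * ((m : ℝ) + 1)) ≤ 2 * (m + 1) :=
      Real.sqrt_le_iff.2 ⟨by linarith, by nlinarith⟩
    push_cast
    calc √(2 * ((m : ℝ) + 1)) * (2 * m + 43) ≤ (2 * (m + 1)) * (2 * m + 43) := by gcongr
      _ ≤ _ := by nlinarith
  rw [e2, e3]
  refine le_trans (le_of_eq ?_) (mul_le_mul_of_nonneg_left (mul_le_mul_of_nonneg_right hb
    (by positivity)) (by positivity))
  rw [sqrt_pow_eq hp]
  field_simp

end meanCount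

section assembly
variable {p : ℕ}

theorem THRp_eq (p : ℕ) : THRp p = 2 / pK p := by
  rw [THRp, pK, div_eq_mul_inv 2, ← Real.sqrt_inv, inv_div]

theorem pκ_mul (hp : 3 ≤ p) (η : ℝ) :
    pκ p * (pK p * η) ^ 2 = ((p : ℝ) - 2) / (4 * ((p : ℝ) - 1)) * η ^ 2 := by
  have h3 : (3 : ℝ) ≤ p := by exact_mod_cast hp
  have h1 : (p : ℝ) - 1 ≠ 0 := by linarith
  have h2 : (p : ℝ) ≠ 0 := by linarith
  rw [mul_pow, pK_sq hp, pκ]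
  field_simp

theorem outRate_eq (hp : 3 ≤ p) {η : ℝ} (hη : 0 < η) :
    outRate p (pK p * η) = Real.log ((p : ℝ) - 1) / 2 -
      ((p : ℝ) - 2) / (4 * ((p : ℝ) - 1)) * η ^ 2 - Jp p η := by
  have hK := pK_pos hp
  rw [← pκ_mul hp, outRate, hermRate, Jp, THRp_eq p]
  set u := pK p * η with hu
  have hu0 : 0 < u := by positivity
  have e1 : η = u / pK p := by rw [hu]; field_simp
  have e2 : √(η ^ 2 - (2 / pK p) ^ 2) = √(u ^ 2 - 4) / pK p := by
    rw [e1, show (u / pK p) ^ 2 - (2 / pK p) ^ 2 = (u ^ 2 - 4) / pK p ^ 2 by ring,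
      Real.sqrt_div' _ (by positivity), Real.sqrt_sq hK.le]
  rw [e2, e1]
  have hpos : 0 < u + √(u ^ 2 - 4) := by positivity
  rw [← add_div, Real.log_div hpos.ne' hK.ne', Real.log_div two_ne_zero hK.ne',
    Real.log_div hpos.ne' two_ne_zero]
  field_simp
  ring

theorem continuousAt_outRate (p : ℕ) : ContinuousAt (outRate p) 2 := by
  have : ContinuousAt hermRate 2 := by
    unfold hermRate
    have h : ((2 : ℝ) + √(2 ^ 2 - 4)) / 2 ≠ 0 := by norm_num
    fun_prop (disch := assumption)
  unfold outRate
  fun_prop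

theorem outRate_two (p : ℕ) :
    outRate p 2 = Real.log ((p : ℝ) - 1) / 2 - pκ p * 2 ^ 2 := by
  have h : (2 : ℝ) ^ 2 - 4 = 0 := by norm_num
  rw [outRate, hermRate, h, Real.sqrt_zero]
  norm_num
  ring

theorem rates_meanCrt (hp : 3 ≤ p) (η : ℝ) :
    UpperRate (meanCrt p η) (SigmaPure p η) ∧ LowerRate (meanCrt p η) (SigmaPure p η) := by
  have hK := pK_pos hp
  have hκ := pκ_pos hp
  have hT := THRp_eq p
  rcases le_or_gt η 0 with h0 | h0
  · rw [show SigmaPure p η = Real.log ((p : ℝ) - 1) / 2 by rw [SigmaPure, if_pos h0]]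
    constructor
    · simpa using upperRate_bulk hp (η := η) le_rfl (Or.inl rfl)
    · refine LowerRate.of_approx (E := meanCrt p) fun ε hε => ?_
      have hc : Tendsto (fun δ : ℝ => pκ p * (pK p * δ) ^ 2) (nhdsWithin 0 (Set.Ioi 0))
          (nhds 0) := by
        have : Continuous fun δ : ℝ => pκ p * (pK p * δ) ^ 2 := by fun_prop
        simpa using (this.tendsto 0).mono_left nhdsWithin_le_nhds
      have hc2 : Tendsto (fun δ : ℝ => pK p * δ) (nhdsWithin 0 (Set.Ioi 0)) (nhds 0) := by
        have : Continuous fun δ : ℝ => pK p * δ := by fun_prop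
        simpa using (this.tendsto 0).mono_left nhdsWithin_le_nhds
      obtain ⟨δ, hδ1, hδ2, hδ0⟩ := ((hc.eventually_le_const hε).and
        ((hc2.eventually_lt_const two_pos).and self_mem_nhdsWithin)).exists
      exact ⟨δ, _, by linarith, lowerRate_bulk hp hδ0 hδ2,
        meanCrt_antitone p (h0.trans (le_of_lt hδ0))⟩
  · rcases lt_trichotomy η (THRp p) with h1 | h1 | h1
    · have hu : pK p * η < 2 := by rwa [hT, lt_div_iff₀ hK, mul_comm] at h1
      rw [SigmaPure, if_neg h0.not_ge, if_pos h1.le, ← pκ_mul hp]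
      exact ⟨upperRate_bulk hp h0.le (Or.inr rfl), lowerRate_bulk hp h0 hu⟩
    · have hu : pK p * η = 2 := by rw [h1, hT]; field_simp
      rw [SigmaPure, if_neg h0.not_ge, if_pos h1.le, ← pκ_mul hp]
      refine ⟨upperRate_bulk hp h0.le (Or.inr rfl), ?_⟩
      refine LowerRate.of_approx (E := meanCrt p) fun ε hε => ?_
      have hc : Tendsto (outRate p) (nhdsWithin 2 (Set.Ioi 2)) (nhds (outRate p 2)) :=
        (continuousAt_outRate p).tendsto.mono_left nhdsWithin_le_nhds
      obtain ⟨u, hu1, hu2⟩ := ((hc.eventually_const_le (by linarith :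
        outRate p 2 - ε < outRate p 2)).and self_mem_nhdsWithin).exists
      have hu2' : 2 < u := hu2
      have hdiv : pK p * (u / pK p) = u := by field_simp
      refine ⟨u / pK p, outRate p u, ?_, ?_, meanCrt_antitone p ?_⟩
      · rw [hu, ← outRate_two]; exact hu1
      · have := lowerRate_out hp (η := u / pK p) (by rw [hdiv]; exact hu2')
        rwa [hdiv] at this
      · rw [h1, hT]; gcongr
    · have hu : 2 < pK p * η := by rwa [hT, div_lt_iff₀ hK, mul_comm] at h1
      rw [SigmaPure, if_neg h0.not_ge, if_neg h1.not_ge, ← outRate_eq hp h0]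
      exact ⟨upperRate_out hp hu, lowerRate_out hp hu⟩

end assembly

/-- the annealed complexity of the pure p-spin spherical model is given by the
explicit formula `SigmaPure`. -/
theorem statement_5 {Ω : Type*} [MeasureSpace Ω] [IsProbabilityMeasure (ℙ : Measure Ω)]
    (p : ℕ) (hp : 3 ≤ p)
    (G : (N : ℕ) → Ω → (k : ℕ) → (Fin k → Fin N) → ℝ)
    (hG : ∀ N, 1 ≤ N → StdGaussianCouplings N p (G N))
    (η : ℝ) :
    Tendsto (fun N : ℕ =>
        Real.log (∫⁻ ω, ecount (crtSet N p (pureC p) (G N ω) η) ∂ℙ).toReal / N)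
      atTop (nhds (SigmaPure p η)) := by
  rw [← tendsto_add_atTop_iff_nat 1]
  obtain ⟨hu, hl⟩ := rates_meanCrt hp η
  refine (tendsto_log_div_of_rates hu hl).congr' ?_
  filter_upwards [eventually_gt_atTop 0] with n hn
  rw [lintegral_ecount_crtSet hp hn (G (n + 1)) (hG (n + 1) (by omega)) η]
  rw [meanCrt, Nat.cast_succ n]
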